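/- arXiv:2512.20899 — 2 statements merged into one kernel-verified Lean document; each statement's English description precedes it below -/
import Mathlib

section
/- Weighted derivative bounds for the Bessel potential (Lemma 2.1(f), inequality (2.2)): for every 1 < p < ∞, every β ∈ ℝ, and every multi-index α on ℝ³ with |α| = 1 or |α| = 2, there exists a constant C > 0 such that for every Schwartz function f on ℝ³: ‖⟨·⟩^{β} ∂^α(𝓜f)‖_{L^p(ℝ³)} ≤ C ‖⟨·⟩^{β} f‖_{L^p(ℝ³)}. -/
open MeasureTheory Set
open scoped ENNReal

noncomputable section

/-- The Japanese bracket `⟨v⟩ = (1+|v|²)^(1/2)` on `ℝ³`. -/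
def jap (v : EuclideanSpace ℝ (Fin 3)) : ℝ := Real.sqrt (1 + ‖v‖ ^ 2)

/-- Partial derivative in the `i`-th coordinate direction. -/
def pd (i : Fin 3) (φ : EuclideanSpace ℝ (Fin 3) → ℝ) (v : EuclideanSpace ℝ (Fin 3)) : ℝ :=
  fderiv ℝ φ v (EuclideanSpace.single i 1)

/-- Iterated partial derivative along a list of coordinate directions (a multi-index). -/
def pdMany : List (Fin 3) → (EuclideanSpace ℝ (Fin 3) → ℝ) → EuclideanSpace ℝ (Fin 3) → ℝ
  | [], φ => φ
  | i :: l, φ => pd i (pdMany l φ)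

/-- The projection kernel `P(z) = Id − z⊗z/|z|²`. -/
def Pker (z : EuclideanSpace ℝ (Fin 3)) (i j : Fin 3) : ℝ :=
  (if i = j then (1 : ℝ) else 0) - z i * z j / ‖z‖ ^ 2

/-- The Landau matrix `A[h](v) = (1/(8π)) ∫ (P(v−z)/|v−z|) h(z) dz` (entry `(i,j)`). -/
def LandauA (h : EuclideanSpace ℝ (Fin 3) → ℝ) (v : EuclideanSpace ℝ (Fin 3)) (i j : Fin 3) : ℝ :=
  (1 / (8 * Real.pi)) * ∫ z, Pker (v - z) i j / ‖v - z‖ * h z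

/-- The Landau potential `a[h](v) = (1/(4π)) ∫ h(z)/|v−z| dz`. -/
def landaua (h : EuclideanSpace ℝ (Fin 3) → ℝ) (v : EuclideanSpace ℝ (Fin 3)) : ℝ :=
  (1 / (4 * Real.pi)) * ∫ z, h z / ‖v - z‖

/-- The Bessel potential operator `𝓜 = (I − Δ)⁻¹` via its integral kernel. -/
def besselM (h : EuclideanSpace ℝ (Fin 3) → ℝ) (v : EuclideanSpace ℝ (Fin 3)) : ℝ :=
  (1 / (4 * Real.pi)) * ∫ z, Real.exp (-‖v - z‖) / ‖v - z‖ * h z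

/-- Squared euclidean norm of the gradient. -/
def gradNormSq (φ : EuclideanSpace ℝ (Fin 3) → ℝ) (v : EuclideanSpace ℝ (Fin 3)) : ℝ :=
  ∑ i, (pd i φ v) ^ 2

/-- Euclidean norm of the gradient. -/
def gradNorm (φ : EuclideanSpace ℝ (Fin 3) → ℝ) (v : EuclideanSpace ℝ (Fin 3)) : ℝ :=
  Real.sqrt (gradNormSq φ v)

section Aux


/-! ### Part 1: the Bellman function -/

def kap (q : ℝ) : ℝ := 2 / q - 1

def bX (p ε ζ : ℝ) : ℝ := (ζ ^ 2 + ε) ^ (p / 2)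
def bX1 (p ε ζ : ℝ) : ℝ := p * ζ * (ζ ^ 2 + ε) ^ (p / 2 - 1)
def bX2 (p ε ζ : ℝ) : ℝ :=
  p * (ζ ^ 2 + ε) ^ (p / 2 - 1) + p * (p - 2) * ζ ^ 2 * (ζ ^ 2 + ε) ^ (p / 2 - 2)
def bS (p q ε ζ η : ℝ) : ℝ := bX p ε ζ + bX q ε η
def bQ (p q δ ε ζ η : ℝ) : ℝ := bS p q ε ζ η + δ * (ζ ^ 2 * bS p q ε ζ η ^ kap q)
def bQz (p q δ ε ζ η : ℝ) : ℝ := bX1 p ε ζ + δ * (2 * ζ * bS p q ε ζ η ^ kap q +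
  ζ ^ 2 * (kap q * bS p q ε ζ η ^ (kap q - 1) * bX1 p ε ζ))
def bQe (p q δ ε ζ η : ℝ) : ℝ := bX1 q ε η +
  δ * (ζ ^ 2 * (kap q * bS p q ε ζ η ^ (kap q - 1) * bX1 q ε η))
def bQzz (p q δ ε ζ η : ℝ) : ℝ := bX2 p ε ζ + δ * (2 * bS p q ε ζ η ^ kap q +
  4 * ζ * (kap q * bS p q ε ζ η ^ (kap q - 1) * bX1 p ε ζ) +
  ζ ^ 2 * (kap q * bS p q ε ζ η ^ (kap q - 1) * bX2 p ε ζ) +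
  ζ ^ 2 * (kap q * (kap q - 1) * bS p q ε ζ η ^ (kap q - 2) * bX1 p ε ζ ^ 2))
def bQze (p q δ ε ζ η : ℝ) : ℝ :=
  δ * (2 * ζ * (kap q * bS p q ε ζ η ^ (kap q - 1) * bX1 q ε η) +
  ζ ^ 2 * (kap q * (kap q - 1) * bS p q ε ζ η ^ (kap q - 2) * bX1 p ε ζ * bX1 q ε η))
def bQee (p q δ ε ζ η : ℝ) : ℝ := bX2 q ε η +
  δ * (ζ ^ 2 * (kap q * bS p q ε ζ η ^ (kap q - 1) * bX2 q ε η) +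
  ζ ^ 2 * (kap q * (kap q - 1) * bS p q ε ζ η ^ (kap q - 2) * bX1 q ε η ^ 2))

lemma base_pos {ε : ℝ} (hε : 0 < ε) (ζ : ℝ) : 0 < ζ ^ 2 + ε := by positivity

lemma bX_pos {ε : ℝ} (hε : 0 < ε) (p ζ : ℝ) : 0 < bX p ε ζ :=
  Real.rpow_pos_of_pos (base_pos hε ζ) _

lemma bS_pos {ε : ℝ} (hε : 0 < ε) (p q ζ η : ℝ) : 0 < bS p q ε ζ η :=
  add_pos (bX_pos hε _ _) (bX_pos hε _ _)

lemma hasDerivAt_base {ε : ℝ} {f : ℝ → ℝ} {f' s : ℝ} (hf : HasDerivAt f f' s) :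
    HasDerivAt (fun s => f s ^ 2 + ε) (2 * f s * f') s := by
  simpa using (hf.pow 2).add_const ε

lemma hasDerivAt_base_rpow {ε : ℝ} (hε : 0 < ε) {f : ℝ → ℝ} {f' s : ℝ} (hf : HasDerivAt f f' s)
    (r : ℝ) : HasDerivAt (fun s => (f s ^ 2 + ε) ^ r)
      (2 * f s * f' * r * (f s ^ 2 + ε) ^ (r - 1)) s :=
  (hasDerivAt_base hf).rpow_const (Or.inl (base_pos hε _).ne')

lemma hasDerivAt_bX {ε : ℝ} (hε : 0 < ε) (p : ℝ) {f : ℝ → ℝ} {f' s : ℝ}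
    (hf : HasDerivAt f f' s) : HasDerivAt (fun s => bX p ε (f s)) (bX1 p ε (f s) * f') s := by
  refine HasDerivAt.congr_deriv (hasDerivAt_base_rpow hε hf (p / 2)) ?_
  simp only [bX1]; ring

lemma hasDerivAt_bX1 {ε : ℝ} (hε : 0 < ε) (p : ℝ) {f : ℝ → ℝ} {f' s : ℝ}
    (hf : HasDerivAt f f' s) : HasDerivAt (fun s => bX1 p ε (f s)) (bX2 p ε (f s) * f') s := by
  refine HasDerivAt.congr_deriv ((hf.const_mul p).mul (hasDerivAt_base_rpow hε hf (p / 2 - 1))) ?_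
  simp only [bX2]
  rw [show p / 2 - 1 - 1 = p / 2 - 2 by ring]; ring

lemma hasDerivAt_bS_rpow {ε : ℝ} (hε : 0 < ε) (p q r : ℝ) {f g : ℝ → ℝ} {f' g' s : ℝ}
    (hf : HasDerivAt f f' s) (hg : HasDerivAt g g' s) :
    HasDerivAt (fun s => bS p q ε (f s) (g s) ^ r)
      ((bX1 p ε (f s) * f' + bX1 q ε (g s) * g') * r * bS p q ε (f s) (g s) ^ (r - 1)) s :=
  ((hasDerivAt_bX hε p hf).add (hasDerivAt_bX hε q hg)).rpow_const
    (Or.inl (bS_pos hε p q _ _).ne')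

lemma hasDerivAt_bQ {ε : ℝ} (hε : 0 < ε) (p q δ : ℝ) {f g : ℝ → ℝ} {f' g' s : ℝ}
    (hf : HasDerivAt f f' s) (hg : HasDerivAt g g' s) :
    HasDerivAt (fun s => bQ p q δ ε (f s) (g s))
      (bQz p q δ ε (f s) (g s) * f' + bQe p q δ ε (f s) (g s) * g') s := by
  refine HasDerivAt.congr_deriv (((hasDerivAt_bX hε p hf).add (hasDerivAt_bX hε q hg)).add
    (((hf.pow 2).mul (hasDerivAt_bS_rpow hε p q (kap q) hf hg)).const_mul δ)) ?_
  simp only [bQz, bQe, Pi.pow_apply, Pi.mul_apply]; push_cast; ring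

lemma hasDerivAt_bQz {ε : ℝ} (hε : 0 < ε) (p q δ : ℝ) {f g : ℝ → ℝ} {f' g' s : ℝ}
    (hf : HasDerivAt f f' s) (hg : HasDerivAt g g' s) :
    HasDerivAt (fun s => bQz p q δ ε (f s) (g s))
      (bQzz p q δ ε (f s) (g s) * f' + bQze p q δ ε (f s) (g s) * g') s := by
  refine HasDerivAt.congr_deriv ((hasDerivAt_bX1 hε p hf).add
    ((((hf.const_mul 2).mul (hasDerivAt_bS_rpow hε p q (kap q) hf hg)).add
    ((hf.pow 2).mul ((((hasDerivAt_bS_rpow hε p q (kap q - 1) hf hg)).const_mul (kap q)).mul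
      (hasDerivAt_bX1 hε p hf)))).const_mul δ)) ?_
  simp only [bQzz, bQze]
  rw [show kap q - 1 - 1 = kap q - 2 by ring]
  simp only [Pi.pow_apply, Pi.mul_apply]; push_cast; ring

lemma hasDerivAt_bQe {ε : ℝ} (hε : 0 < ε) (p q δ : ℝ) {f g : ℝ → ℝ} {f' g' s : ℝ}
    (hf : HasDerivAt f f' s) (hg : HasDerivAt g g' s) :
    HasDerivAt (fun s => bQe p q δ ε (f s) (g s))
      (bQze p q δ ε (f s) (g s) * f' + bQee p q δ ε (f s) (g s) * g') s := by
  refine HasDerivAt.congr_deriv ((hasDerivAt_bX1 hε q hg).add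
    ((((hf.pow 2).mul ((((hasDerivAt_bS_rpow hε p q (kap q - 1) hf hg)).const_mul (kap q)).mul
      (hasDerivAt_bX1 hε q hg)))).const_mul δ)) ?_
  simp only [bQee, bQze]
  rw [show kap q - 1 - 1 = kap q - 2 by ring]
  simp only [Pi.pow_apply, Pi.mul_apply]; push_cast; ring

set_option maxHeartbeats 1600000 in
/-- Purely algebraic core of the Hessian estimate. -/
lemma hess_core {p q κ δ a b A B S s z e w1 w2 : ℝ} (hp : 2 ≤ p) (hq1 : 1 < q) (hq2 : q ≤ 2)
    (hκ0 : 0 ≤ κ) (hκ1 : κ ≤ 1) (hκp : (1 - κ) * p = 2) (hκq : κ * q = 2 - q)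
    (hδ : δ = q * (q - 1) / 64)
    (ha : 0 < a) (hb : 0 < b) (hA : 0 < A) (hB : 0 < B) (hs : 0 < s)
    (hz : z ^ 2 ≤ a) (he : e ^ 2 ≤ b) (hS : S = a * A + b * B)
    (has : a * s ≤ S) (hBs : 1 ≤ B * s) (hbB : b * B ^ 2 * s ≤ S) :
    δ * (s * w1 ^ 2 + w2 ^ 2 / s) ≤
      ((p * A + p * (p - 2) * z ^ 2 * (A / a)) + δ * (2 * s + 4 * z * (κ * (s / S) * (p * z * A)) +
        z ^ 2 * (κ * (s / S) * (p * A + p * (p - 2) * z ^ 2 * (A / a))) +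
        z ^ 2 * (κ * (κ - 1) * (s / S ^ 2) * (p * z * A) ^ 2))) * w1 ^ 2 +
      2 * (δ * (2 * z * (κ * (s / S) * (q * e * B)) +
        z ^ 2 * (κ * (κ - 1) * (s / S ^ 2) * (p * z * A) * (q * e * B)))) * w1 * w2 +
      ((q * B + q * (q - 2) * e ^ 2 * (B / b)) + δ * (
        z ^ 2 * (κ * (s / S) * (q * B + q * (q - 2) * e ^ 2 * (B / b))) +
        z ^ 2 * (κ * (κ - 1) * (s / S ^ 2) * (q * e * B) ^ 2))) * w2 ^ 2 := by
  have hSpos : 0 < S := by rw [hS]; positivity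
  have hδpos : 0 < δ := by rw [hδ]; have := sub_pos.2 hq1; positivity
  have hXS : a * A ≤ S := by rw [hS]; nlinarith [mul_pos hb hB]
  have hYS : b * B ≤ S := by rw [hS]; nlinarith [mul_pos ha hA]
  have hzA : z ^ 2 * A ≤ S := le_trans (by gcongr) hXS
  -- zz
  have hzz : 2 * δ * s ≤ (p * A + p * (p - 2) * z ^ 2 * (A / a)) + δ * (2 * s +
        4 * z * (κ * (s / S) * (p * z * A)) +
        z ^ 2 * (κ * (s / S) * (p * A + p * (p - 2) * z ^ 2 * (A / a))) +
        z ^ 2 * (κ * (κ - 1) * (s / S ^ 2) * (p * z * A) ^ 2)) := by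
    have hp2 : 0 ≤ p - 2 := by linarith
    have h1 : 0 ≤ p * A + p * (p - 2) * z ^ 2 * (A / a) := by positivity
    have h2 : 0 ≤ z ^ 2 * (κ * (s / S) * (p * A + p * (p - 2) * z ^ 2 * (A / a))) := by positivity
    have h3 : 0 ≤ 4 * z * (κ * (s / S) * (p * z * A)) +
        z ^ 2 * (κ * (κ - 1) * (s / S ^ 2) * (p * z * A) ^ 2) := by
      have : 4 * z * (κ * (s / S) * (p * z * A)) +
        z ^ 2 * (κ * (κ - 1) * (s / S ^ 2) * (p * z * A) ^ 2) =
        κ * (s / S ^ 2) * (p * z ^ 2 * A) * (4 * S - ((1 - κ) * p) * (z ^ 2 * A)) := by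
        field_simp; ring
      rw [this, hκp]
      have : 0 ≤ 4 * S - 2 * (z ^ 2 * A) := by linarith
      positivity
    linarith only [h1, mul_nonneg hδpos.le h2, mul_nonneg hδpos.le h3]
  -- ze
  have hr : (z * e * B * (s / S)) ^ 2 ≤ 1 := by
    have : (z * e * B * (s / S)) ^ 2 = ((z ^ 2 * s) * (e ^ 2 * B ^ 2 * s)) / S ^ 2 := by
      field_simp
    rw [this, div_le_one (by positivity)]
    have h1 : z ^ 2 * s ≤ S := le_trans (by gcongr) has
    have h2 : e ^ 2 * B ^ 2 * s ≤ S := le_trans (by gcongr) hbB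
    calc _ ≤ S * S := by gcongr
      _ = S ^ 2 := by ring
  have hze : |δ * (2 * z * (κ * (s / S) * (q * e * B)) +
        z ^ 2 * (κ * (κ - 1) * (s / S ^ 2) * (p * z * A) * (q * e * B)))| ≤ 4 * δ := by
    have : δ * (2 * z * (κ * (s / S) * (q * e * B)) +
        z ^ 2 * (κ * (κ - 1) * (s / S ^ 2) * (p * z * A) * (q * e * B))) =
        δ * ((κ * q) * (z * e * B * (s / S)) * (2 - ((1 - κ) * p) * (z ^ 2 * A / S))) := by
      field_simp; ring
    rw [this, hκp, hκq, abs_mul, abs_of_pos hδpos, abs_mul, abs_mul, mul_comm 4 δ]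
    gcongr
    have h1 : |z * e * B * (s / S)| ≤ 1 := by rwa [sq_le_one_iff_abs_le_one] at hr
    have h2 : |2 - 2 * (z ^ 2 * A / S)| ≤ 2 := by
      have h3 : 0 ≤ z ^ 2 * A / S := by positivity
      have h4 : z ^ 2 * A / S ≤ 1 := by rw [div_le_one hSpos]; exact hzA
      rw [abs_le]; constructor <;> linarith
    have h3 : |2 - q| ≤ 1 := by rw [abs_le]; constructor <;> linarith
    calc |2 - q| * |z * e * B * (s / S)| * |2 - 2 * (z ^ 2 * A / S)| ≤ 1 * 1 * 2 := by gcongr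
      _ ≤ 4 := by norm_num
  -- ee
  have hee : 28 * δ * B ≤ (q * B + q * (q - 2) * e ^ 2 * (B / b)) + δ * (
        z ^ 2 * (κ * (s / S) * (q * B + q * (q - 2) * e ^ 2 * (B / b))) +
        z ^ 2 * (κ * (κ - 1) * (s / S ^ 2) * (q * e * B) ^ 2)) := by
    have hY2 : q * (q - 1) * B ≤ q * B + q * (q - 2) * e ^ 2 * (B / b) := by
      have h1 : e ^ 2 * (B / b) ≤ B := by
        calc e ^ 2 * (B / b) ≤ b * (B / b) := by gcongr
          _ = B := by field_simp
      nlinarith only [h1, mul_nonneg (by linarith : (0:ℝ) ≤ q) (by linarith : (0:ℝ) ≤ 2 - q)]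
    have hY20 : 0 ≤ q * B + q * (q - 2) * e ^ 2 * (B / b) := by
      refine le_trans ?_ hY2
      have := sub_pos.2 hq1; positivity
    have h2 : 0 ≤ z ^ 2 * (κ * (s / S) * (q * B + q * (q - 2) * e ^ 2 * (B / b))) := by positivity
    have h3 : -(4 * B) ≤ z ^ 2 * (κ * (κ - 1) * (s / S ^ 2) * (q * e * B) ^ 2) := by
      have : z ^ 2 * (κ * (κ - 1) * (s / S ^ 2) * (q * e * B) ^ 2) =
        -((κ * (1 - κ)) * q ^ 2 * ((z ^ 2 * s / S) * ((e ^ 2 * B) / S) * B)) := by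
        field_simp; ring
      rw [this, neg_le_neg_iff]
      have h4 : z ^ 2 * s / S ≤ 1 := by
        rw [div_le_one hSpos]; exact le_trans (by gcongr) has
      have h5 : e ^ 2 * B / S ≤ 1 := by
        rw [div_le_one hSpos]; exact le_trans (by gcongr) hYS
      have h6 : κ * (1 - κ) ≤ 1 := by nlinarith only [hκ0, hκ1]
      have h60 : 0 ≤ 1 - κ := by linarith
      have h7 : q ^ 2 ≤ 4 := by nlinarith only [hq1, hq2]
      calc _ ≤ 1 * 4 * (1 * 1 * B) := by gcongr
        _ = 4 * B := by ring
    have : 28 * δ * B ≤ q * (q - 1) * B - 4 * δ * B := by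
      have : q * (q - 1) = 64 * δ := by rw [hδ]; ring
      rw [this]; nlinarith only [mul_pos hδpos hB]
    linarith only [hY2, this, mul_nonneg hδpos.le h2, mul_le_mul_of_nonneg_left h3 hδpos.le]
  set Z := (p * A + p * (p - 2) * z ^ 2 * (A / a)) + δ * (2 * s +
        4 * z * (κ * (s / S) * (p * z * A)) +
        z ^ 2 * (κ * (s / S) * (p * A + p * (p - 2) * z ^ 2 * (A / a))) +
        z ^ 2 * (κ * (κ - 1) * (s / S ^ 2) * (p * z * A) ^ 2))
  set M := δ * (2 * z * (κ * (s / S) * (q * e * B)) +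
        z ^ 2 * (κ * (κ - 1) * (s / S ^ 2) * (p * z * A) * (q * e * B)))
  set N := (q * B + q * (q - 2) * e ^ 2 * (B / b)) + δ * (
        z ^ 2 * (κ * (s / S) * (q * B + q * (q - 2) * e ^ 2 * (B / b))) +
        z ^ 2 * (κ * (κ - 1) * (s / S ^ 2) * (q * e * B) ^ 2))
  have hB' : 1 / s ≤ B := by rw [div_le_iff₀ hs]; exact hBs
  have hN : 28 * δ * (1 / s) ≤ N := le_trans (by gcongr) hee
  have hMw : -(4 * δ * (|w1| * |w2|)) ≤ M * w1 * w2 := by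
    have : |M * w1 * w2| ≤ 4 * δ * (|w1| * |w2|) := by
      rw [abs_mul, abs_mul, mul_assoc]; gcongr
    linarith [neg_abs_le (M * w1 * w2)]
  have hwsq : 8 * (|w1| * |w2|) ≤ s * w1 ^ 2 + 16 * (w2 ^ 2 / s) := by
    have : s * w1 ^ 2 + 16 * (w2 ^ 2 / s) - 8 * (|w1| * |w2|) = (s * |w1| - 4 * |w2|) ^ 2 / s := by
      field_simp
      rw [← sq_abs w1, ← sq_abs w2]; ring
    have h2 : 0 ≤ (s * |w1| - 4 * |w2|) ^ 2 / s := by positivity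
    linarith
  have e1 : w2 ^ 2 / s = (1 / s) * w2 ^ 2 := by ring
  have hw2 : 0 ≤ w2 ^ 2 / s := by positivity
  have t1 := mul_le_mul_of_nonneg_right hzz (sq_nonneg w1)
  have t2 := mul_le_mul_of_nonneg_right hN (sq_nonneg w2)
  have t3 := mul_le_mul_of_nonneg_left hwsq hδpos.le
  have t4 := mul_nonneg hδpos.le hw2
  rw [mul_assoc (28 * δ), ← e1] at t2
  linarith only [t1, t2, t3, t4, hMw]

lemma conj_facts {p q : ℝ} (hp : 2 ≤ p) (hpq : 1 / p + 1 / q = 1) :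
    1 < q ∧ q ≤ 2 ∧ 0 ≤ kap q ∧ kap q ≤ 1 ∧ (1 - kap q) * p = 2 ∧ kap q * q = 2 - q ∧
    p = q / (q - 1) := by
  have hp0 : 0 < p := by linarith
  have hq0 : q ≠ 0 := by
    rintro rfl; simp at hpq; subst hpq; linarith
  have h1 : q + p = p * q := by field_simp at hpq; linarith
  have h2 : (p - 1) * (q - 1) = 1 := by linarith
  have hq1 : 1 < q := by nlinarith
  have hq2 : q ≤ 2 := by nlinarith
  have hqp : 0 < q := by linarith
  refine ⟨hq1, hq2, ?_, ?_, ?_, ?_, ?_⟩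
  · rw [kap, sub_nonneg, le_div_iff₀ hqp]; linarith
  · rw [kap, sub_le_iff_le_add, div_le_iff₀ hqp]; linarith
  · rw [kap]; field_simp; linarith
  · rw [kap]; field_simp
  · have : q - 1 ≠ 0 := by linarith
    field_simp; linarith

lemma bellman_aux {p q ε : ℝ} (hp : 2 ≤ p) (hpq : 1 / p + 1 / q = 1) (hε : 0 < ε) (ζ η : ℝ) :
    (ζ ^ 2 + ε) * bS p q ε ζ η ^ kap q ≤ bS p q ε ζ η ∧
    1 ≤ (η ^ 2 + ε) ^ (q / 2 - 1) * bS p q ε ζ η ^ kap q ∧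
    (η ^ 2 + ε) * ((η ^ 2 + ε) ^ (q / 2 - 1)) ^ 2 * bS p q ε ζ η ^ kap q ≤ bS p q ε ζ η := by
  obtain ⟨hq1, hq2, hk0, hk1, hkp, hkq, -⟩ := conj_facts hp hpq
  have ha := base_pos hε ζ
  have hb := base_pos hε η
  have hS := bS_pos hε p q ζ η
  have hX := bX_pos hε p ζ
  have hY := bX_pos hε q η
  have hXS : bX p ε ζ ≤ bS p q ε ζ η := by rw [bS]; linarith
  have hYS : bX q ε η ≤ bS p q ε ζ η := by rw [bS]; linarith
  set S := bS p q ε ζ η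
  have hSs : S ^ (1 - kap q) * S ^ kap q = S := by
    rw [← Real.rpow_add hS]; simp
  have hs : 0 < S ^ kap q := Real.rpow_pos_of_pos hS _
  refine ⟨?_, ?_, ?_⟩
  · have : ζ ^ 2 + ε = bX p ε ζ ^ (1 - kap q) := by
      rw [bX, ← Real.rpow_mul ha.le]
      rw [show p / 2 * (1 - kap q) = 1 by linarith]; simp
    calc _ = bX p ε ζ ^ (1 - kap q) * S ^ kap q := by rw [← this]
      _ ≤ S ^ (1 - kap q) * S ^ kap q := by
        gcongr
      _ = S := hSs
  · have : (η ^ 2 + ε) ^ (q / 2 - 1) = (bX q ε η ^ kap q)⁻¹ := by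
      rw [bX, ← Real.rpow_mul hb.le, ← Real.rpow_neg hb.le]
      congr 1; linarith
    rw [this, inv_mul_eq_div, one_le_div (Real.rpow_pos_of_pos hY _)]
    gcongr
  · have : (η ^ 2 + ε) * ((η ^ 2 + ε) ^ (q / 2 - 1)) ^ 2 = bX q ε η ^ (1 - kap q) := by
      rw [bX, ← Real.rpow_mul hb.le, ← Real.rpow_natCast ((η ^ 2 + ε) ^ (q / 2 - 1)), ← Real.rpow_mul hb.le,
        ← Real.rpow_one_add' hb.le]
      · congr 1; push_cast; linarith
      · push_cast; linarith
    rw [this]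
    calc _ ≤ S ^ (1 - kap q) * S ^ kap q := by
          gcongr
      _ = S := hSs

def bdel (q : ℝ) : ℝ := q * (q - 1) / 64

lemma rpow_sub_two {x : ℝ} (hx : 0 < x) (r : ℝ) : x ^ (r - 2) = x ^ r / x ^ 2 := by
  rw [Real.rpow_sub hx]; norm_num

/-- Hessian bound. -/
lemma bQ_hess {p q ε : ℝ} (hp : 2 ≤ p) (hpq : 1 / p + 1 / q = 1) (hε : 0 < ε) (ζ η w1 w2 : ℝ) :
    bdel q * (bS p q ε ζ η ^ kap q * w1 ^ 2 + w2 ^ 2 / bS p q ε ζ η ^ kap q) ≤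
      bQzz p q (bdel q) ε ζ η * w1 ^ 2 + 2 * bQze p q (bdel q) ε ζ η * w1 * w2 +
        bQee p q (bdel q) ε ζ η * w2 ^ 2 := by
  obtain ⟨hq1, hq2, hk0, hk1, hkp, hkq, -⟩ := conj_facts hp hpq
  obtain ⟨h1, h2, h3⟩ := bellman_aux hp hpq hε ζ η
  have ha := base_pos hε ζ
  have hb := base_pos hε η
  have hS := bS_pos hε p q ζ η
  have hSe : bS p q ε ζ η = (ζ ^ 2 + ε) * (ζ ^ 2 + ε) ^ (p / 2 - 1) +
      (η ^ 2 + ε) * (η ^ 2 + ε) ^ (q / 2 - 1) := by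
    rw [bS, bX, bX, ← Real.rpow_one_add' ha.le (by linarith), ← Real.rpow_one_add' hb.le (by linarith)]
    congr 2 <;> ring
  have key := hess_core (w1 := w1) (w2 := w2) hp hq1 hq2 hk0 hk1 hkp hkq rfl ha hb
    (Real.rpow_pos_of_pos ha (p / 2 - 1)) (Real.rpow_pos_of_pos hb (q / 2 - 1))
    (Real.rpow_pos_of_pos hS (kap q)) (by linarith : ζ ^ 2 ≤ ζ ^ 2 + ε)
    (by linarith : η ^ 2 ≤ η ^ 2 + ε) hSe h1 h2 h3
  simp only [bQzz, bQze, bQee, bX1, bX2, bdel]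
  rw [Real.rpow_sub_one hS.ne', rpow_sub_two hS,
    show p / 2 - 2 = p / 2 - 1 - 1 by ring, show q / 2 - 2 = q / 2 - 1 - 1 by ring,
    Real.rpow_sub_one ha.ne' (p / 2 - 1), Real.rpow_sub_one hb.ne' (q / 2 - 1)]
  exact key

/-- Zeroth order bound. -/
lemma bQ_grad {p q ε : ℝ} (hp : 2 ≤ p) (hpq : 1 / p + 1 / q = 1) (hε : 0 < ε) (ζ η : ℝ) :
    bdel q * (bS p q ε ζ η ^ kap q * ζ ^ 2 + η ^ 2 / bS p q ε ζ η ^ kap q) ≤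
      bQz p q (bdel q) ε ζ η * ζ + bQe p q (bdel q) ε ζ η * η := by
  obtain ⟨hq1, hq2, hk0, hk1, hkp, hkq, -⟩ := conj_facts hp hpq
  obtain ⟨h1, h2, h3⟩ := bellman_aux hp hpq hε ζ η
  have hS := bS_pos hε p q ζ η
  have hs := Real.rpow_pos_of_pos hS (kap q)
  have hs1 := Real.rpow_pos_of_pos hS (kap q - 1)
  have hA := Real.rpow_pos_of_pos (base_pos hε ζ) (p / 2 - 1)
  have hB := Real.rpow_pos_of_pos (base_pos hε η) (q / 2 - 1)
  have hq0 : 0 < q := by linarith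
  have hd : 0 < bdel q := by rw [bdel]; have := sub_pos.2 hq1; positivity
  have hd1 : bdel q ≤ 1 := by rw [bdel]; nlinarith
  simp only [bQz, bQe, bX1]
  set A := (ζ ^ 2 + ε) ^ (p / 2 - 1)
  set B := (η ^ 2 + ε) ^ (q / 2 - 1)
  set s := bS p q ε ζ η ^ kap q
  set s1 := bS p q ε ζ η ^ (kap q - 1)
  set d := bdel q
  have e1 : 0 ≤ p * ζ ^ 2 * A := by positivity
  have e2 : 0 ≤ d * (ζ ^ 2 * (kap q * s1 * (p * ζ ^ 2 * A))) := by positivity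
  have e3 : 0 ≤ d * (ζ ^ 2 * (kap q * s1 * (q * η ^ 2 * B))) := by positivity
  have e4 : d * (η ^ 2 / s) ≤ q * η ^ 2 * B := by
    have : 1 / s ≤ B := by rw [div_le_iff₀ hs]; exact h2
    calc d * (η ^ 2 / s) = d * η ^ 2 * (1 / s) := by ring
      _ ≤ q * η ^ 2 * B := by gcongr; linarith
  have e5 : 0 ≤ d * (s * ζ ^ 2) := by positivity
  nlinarith [e1, e2, e3, e4, e5]



def bA (p q δ ε ζ η : ℝ) : ℝ := p * (ζ ^ 2 + ε) ^ (p / 2 - 1) + δ * (2 * bS p q ε ζ η ^ kap q +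
  ζ ^ 2 * (kap q * bS p q ε ζ η ^ (kap q - 1) * (p * (ζ ^ 2 + ε) ^ (p / 2 - 1))))
def bB (p q δ ε ζ η : ℝ) : ℝ := q * (η ^ 2 + ε) ^ (q / 2 - 1) +
  δ * (ζ ^ 2 * (kap q * bS p q ε ζ η ^ (kap q - 1) * (q * (η ^ 2 + ε) ^ (q / 2 - 1))))

lemma bQz_eq (p q δ ε ζ η : ℝ) : bQz p q δ ε ζ η = bA p q δ ε ζ η * ζ := by
  simp only [bQz, bA, bX1]; ring
lemma bQe_eq (p q δ ε ζ η : ℝ) : bQe p q δ ε ζ η = bB p q δ ε ζ η * η := by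
  simp only [bQe, bB, bX1]; ring

section cont
variable {X : Type*} [TopologicalSpace X] {ε : ℝ} {f g : X → ℝ}

lemma cont_base (hε : 0 < ε) (r : ℝ) (hf : Continuous f) :
    Continuous fun x => (f x ^ 2 + ε) ^ r :=
  Continuous.rpow_const (by fun_prop) fun x => Or.inl (base_pos hε _).ne'

lemma cont_bX (hε : 0 < ε) (p : ℝ) (hf : Continuous f) : Continuous fun x => bX p ε (f x) :=
  cont_base hε _ hf

lemma cont_bX1 (hε : 0 < ε) (p : ℝ) (hf : Continuous f) : Continuous fun x => bX1 p ε (f x) := by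
  have := cont_base hε (p / 2 - 1) hf
  unfold bX1; fun_prop

lemma cont_bX2 (hε : 0 < ε) (p : ℝ) (hf : Continuous f) : Continuous fun x => bX2 p ε (f x) := by
  have := cont_base hε (p / 2 - 1) hf
  have := cont_base hε (p / 2 - 2) hf
  unfold bX2; fun_prop

lemma cont_bS_rpow (hε : 0 < ε) (p q r : ℝ) (hf : Continuous f) (hg : Continuous g) :
    Continuous fun x => bS p q ε (f x) (g x) ^ r :=
  Continuous.rpow_const ((cont_bX hε p hf).add (cont_bX hε q hg))
    fun x => Or.inl (bS_pos hε p q _ _).ne'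

lemma cont_bQ (hε : 0 < ε) (p q δ : ℝ) (hf : Continuous f) (hg : Continuous g) :
    Continuous fun x => bQ p q δ ε (f x) (g x) := by
  have := cont_bS_rpow hε p q (kap q) hf hg
  have h2 : Continuous fun x => bS p q ε (f x) (g x) := (cont_bX hε p hf).add (cont_bX hε q hg)
  unfold bQ; fun_prop

lemma cont_bA (hε : 0 < ε) (p q δ : ℝ) (hf : Continuous f) (hg : Continuous g) :
    Continuous fun x => bA p q δ ε (f x) (g x) := by
  have := cont_bS_rpow hε p q (kap q) hf hg
  have := cont_bS_rpow hε p q (kap q - 1) hf hg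
  have := cont_base hε (p / 2 - 1) hf
  unfold bA; fun_prop

lemma cont_bB (hε : 0 < ε) (p q δ : ℝ) (hf : Continuous f) (hg : Continuous g) :
    Continuous fun x => bB p q δ ε (f x) (g x) := by
  have := cont_bS_rpow hε p q (kap q - 1) hf hg
  have := cont_base hε (q / 2 - 1) hg
  unfold bB; fun_prop

lemma cont_bQzz (hε : 0 < ε) (p q δ : ℝ) (hf : Continuous f) (hg : Continuous g) :
    Continuous fun x => bQzz p q δ ε (f x) (g x) := by
  have := cont_bS_rpow hε p q (kap q) hf hg
  have := cont_bS_rpow hε p q (kap q - 1) hf hg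
  have := cont_bS_rpow hε p q (kap q - 2) hf hg
  have := cont_bX1 hε p hf
  have := cont_bX2 hε p hf
  unfold bQzz; fun_prop

lemma cont_bQze (hε : 0 < ε) (p q δ : ℝ) (hf : Continuous f) (hg : Continuous g) :
    Continuous fun x => bQze p q δ ε (f x) (g x) := by
  have := cont_bS_rpow hε p q (kap q - 1) hf hg
  have := cont_bS_rpow hε p q (kap q - 2) hf hg
  have := cont_bX1 hε p hf
  have := cont_bX1 hε q hg
  unfold bQze; fun_prop

lemma cont_bQee (hε : 0 < ε) (p q δ : ℝ) (hf : Continuous f) (hg : Continuous g) :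
    Continuous fun x => bQee p q δ ε (f x) (g x) := by
  have := cont_bS_rpow hε p q (kap q - 1) hf hg
  have := cont_bS_rpow hε p q (kap q - 2) hf hg
  have := cont_bX1 hε q hg
  have := cont_bX2 hε q hg
  unfold bQee; fun_prop

end cont

/-- A continuous function of two variables is bounded on a square. -/
lemma bdd_square {F : ℝ → ℝ → ℝ} (hF : Continuous fun z : ℝ × ℝ => F z.1 z.2) (M : ℝ) :
    ∃ C, 0 ≤ C ∧ ∀ ζ η, |ζ| ≤ M → |η| ≤ M → |F ζ η| ≤ C := by
  obtain ⟨C, hC⟩ := ((isCompact_Icc (a := -M) (b := M)).prod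
    (isCompact_Icc (a := -M) (b := M))).exists_bound_of_continuousOn hF.continuousOn
  refine ⟨max C 0, le_max_right _ _, fun ζ η h1 h2 => le_trans ?_ (le_max_left _ _)⟩
  exact hC (ζ, η) ⟨abs_le.1 h1, abs_le.1 h2⟩

lemma bQ_sub_le {p q δ ε : ℝ} (hε : 0 < ε) (M : ℝ) :
    ∃ C, 0 ≤ C ∧ ∀ ζ η, |ζ| ≤ M → |η| ≤ M →
      |bQ p q δ ε ζ η - bQ p q δ ε 0 0| ≤ C * (ζ ^ 2 + η ^ 2) := by
  obtain ⟨C1, h10, h1⟩ := bdd_square (cont_bA hε p q δ continuous_fst continuous_snd) M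
  obtain ⟨C2, h20, h2⟩ := bdd_square (cont_bB hε p q δ continuous_fst continuous_snd) M
  refine ⟨C1 + C2, by positivity, fun ζ η hz he => ?_⟩
  have hd : ∀ s : ℝ, HasDerivAt (fun s => bQ p q δ ε (s * ζ) (s * η))
      (bQz p q δ ε (s * ζ) (s * η) * ζ + bQe p q δ ε (s * ζ) (s * η) * η) s := fun s => by
    have a1 : HasDerivAt (fun s : ℝ => s * ζ) ζ s := by simpa using (hasDerivAt_id s).mul_const ζ
    have a2 : HasDerivAt (fun s : ℝ => s * η) η s := by simpa using (hasDerivAt_id s).mul_const η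
    exact hasDerivAt_bQ hε p q δ a1 a2
  have := Convex.norm_image_sub_le_of_norm_hasDerivWithin_le (s := Icc (0:ℝ) 1)
    (C := (C1 + C2) * (ζ ^ 2 + η ^ 2)) (fun s _ => (hd s).hasDerivWithinAt) ?_ (convex_Icc 0 1)
    (left_mem_Icc.2 zero_le_one) (right_mem_Icc.2 zero_le_one)
  · simpa using this
  · rintro s ⟨hs0, hs1⟩
    have b : ∀ y : ℝ, |y| ≤ M → |s * y| ≤ M := fun y hy => by
      rw [abs_mul, abs_of_nonneg hs0]; nlinarith [abs_nonneg y]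
    have h1 := h1 _ _ (b _ hz) (b _ he)
    have h2 := h2 _ _ (b _ hz) (b _ he)
    rw [bQz_eq, bQe_eq, Real.norm_eq_abs]
    have e1 : |bA p q δ ε (s * ζ) (s * η) * (s * ζ) * ζ| ≤ C1 * ζ ^ 2 := by
      rw [mul_assoc, abs_mul, show s * ζ * ζ = s * ζ ^ 2 by ring, abs_mul s, abs_of_nonneg hs0,
        abs_of_nonneg (sq_nonneg ζ)]
      gcongr
      nlinarith [sq_nonneg ζ]
    have e2 : |bB p q δ ε (s * ζ) (s * η) * (s * η) * η| ≤ C2 * η ^ 2 := by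
      rw [mul_assoc, abs_mul, show s * η * η = s * η ^ 2 by ring, abs_mul s, abs_of_nonneg hs0,
        abs_of_nonneg (sq_nonneg η)]
      gcongr
      nlinarith [sq_nonneg η]
    refine (abs_add_le _ _).trans ?_
    nlinarith [mul_nonneg h10 (sq_nonneg η), mul_nonneg h20 (sq_nonneg ζ)]

/-- limit function -/
lemma bQ_tendsto {p q : ℝ} (hp : 2 ≤ p) (hpq : 1 / p + 1 / q = 1) (δ ζ η : ℝ) :
    Filter.Tendsto (fun ε => bQ p q δ ε ζ η - bQ p q δ ε 0 0) (nhdsWithin 0 (Ioi 0))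
      (nhds (bQ p q δ 0 ζ η)) := by
  obtain ⟨hq1, hq2, hk0, hk1, hkp, hkq, -⟩ := conj_facts hp hpq
  have hX : ∀ r z, 0 < r → Continuous fun ε => bX r ε z := fun r z hr => by
    unfold bX
    exact (Real.continuous_rpow_const (by positivity)).comp (by fun_prop)
  have hS : ∀ z e, Continuous fun ε => bS p q ε z e := fun z e =>
    (hX p z (by linarith)).add (hX q e (by linarith))
  have hQ : ∀ z e, Continuous fun ε => bQ p q δ ε z e := fun z e => by
    have := (Real.continuous_rpow_const hk0).comp (hS z e)
    have h2 := hS z e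
    unfold bQ
    exact h2.add (continuous_const.mul (continuous_const.mul this))
  have : Filter.Tendsto (fun ε => bQ p q δ ε ζ η - bQ p q δ ε 0 0) (nhds 0)
      (nhds (bQ p q δ 0 ζ η - bQ p q δ 0 0 0)) := ((hQ ζ η).sub (hQ 0 0)).tendsto 0
  have h0 : bQ p q δ 0 0 0 = 0 := by
    have h1 : p / 2 ≠ 0 := by linarith
    have h2 : q / 2 ≠ 0 := by linarith
    simp [bQ, bS, bX, Real.zero_rpow h1, Real.zero_rpow h2]
  rw [h0, sub_zero] at this
  exact this.mono_left nhdsWithin_le_nhds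

lemma bX_zero (p ζ : ℝ) : bX p 0 ζ = |ζ| ^ p := by
  rw [bX, add_zero, ← sq_abs, ← Real.rpow_natCast, ← Real.rpow_mul (abs_nonneg _)]
  congr 1; push_cast; ring

lemma bQ_zero_le {p q : ℝ} (hp : 2 ≤ p) (hpq : 1 / p + 1 / q = 1) (ζ η : ℝ) :
    bQ p q (bdel q) 0 ζ η ≤ 2 * (|ζ| ^ p + |η| ^ q) := by
  obtain ⟨hq1, hq2, hk0, hk1, hkp, hkq, -⟩ := conj_facts hp hpq
  have hd : 0 < bdel q := by rw [bdel]; have := sub_pos.2 hq1; positivity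
  have hd1 : bdel q ≤ 1 := by rw [bdel]; nlinarith
  have hS : bS p q 0 ζ η = |ζ| ^ p + |η| ^ q := by rw [bS, bX_zero, bX_zero]
  rw [bQ, hS]
  set S := |ζ| ^ p + |η| ^ q
  have hS0 : 0 ≤ S := by positivity
  have h1 : ζ ^ 2 = (|ζ| ^ p) ^ (1 - kap q) := by
    rw [← Real.rpow_mul (abs_nonneg _), mul_comm, hkp, ← sq_abs]; norm_num
  have h2 : |ζ| ^ p ≤ S := by simp only [S]; linarith [Real.rpow_nonneg (abs_nonneg η) q]
  have h3 : ζ ^ 2 * S ^ kap q ≤ S := by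
    rw [h1]
    calc _ ≤ S ^ (1 - kap q) * S ^ kap q := by gcongr
      _ = S := by
        rw [← Real.rpow_add_of_nonneg hS0 (by linarith) hk0]; simp
  have h4 : 0 ≤ ζ ^ 2 * S ^ kap q := by positivity
  nlinarith

lemma bQ_dom {p q : ℝ} (hp : 2 ≤ p) (hpq : 1 / p + 1 / q = 1) (M : ℝ) :
    ∃ C, 0 ≤ C ∧ ∀ ε, 0 < ε → ε ≤ 1 → ∀ ζ η, |ζ| ≤ M → |η| ≤ M →
      |bQ p q (bdel q) ε ζ η - bQ p q (bdel q) ε 0 0| ≤ C * (ζ ^ 2 + |η| ^ q) := by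
  obtain ⟨hq1, hq2, hk0, hk1, hkp, hkq, -⟩ := conj_facts hp hpq
  have hd : 0 < bdel q := by rw [bdel]; have := sub_pos.2 hq1; positivity
  have hd1 : bdel q ≤ 1 := by rw [bdel]; nlinarith
  set a := (p / 2) * (M ^ 2 + 1) ^ (p / 2 - 1)
  set b := ((M ^ 2 + 1) ^ (p / 2) + (M ^ 2 + 1) ^ (q / 2)) ^ kap q
  have ha : 0 ≤ a := by positivity
  have hb : 0 ≤ b := by positivity
  refine ⟨1 + a + b, by positivity, fun ε hε hε1 ζ η hz he => ?_⟩
  have hz2 : ζ ^ 2 ≤ M ^ 2 := by rw [← sq_abs]; gcongr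
  have he2 : η ^ 2 ≤ M ^ 2 := by rw [← sq_abs]; gcongr
  have hX0 : bX p ε 0 ≤ bX p ε ζ := by
    unfold bX
    exact Real.rpow_le_rpow (by positivity) (by simp [sq_nonneg]) (by linarith)
  have hY0 : bX q ε 0 ≤ bX q ε η := by
    unfold bX
    exact Real.rpow_le_rpow (by positivity) (by simp [sq_nonneg]) (by linarith)
  have hX1 : bX p ε ζ - bX p ε 0 ≤ a * ζ ^ 2 := by
    have := Convex.norm_image_sub_le_of_norm_hasDerivWithin_le (s := Icc ε (ζ ^ 2 + ε))
      (f := fun x : ℝ => x ^ (p / 2)) (f' := fun x => (p / 2) * x ^ (p / 2 - 1)) (C := a)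
      (fun x hx => (Real.hasDerivAt_rpow_const (Or.inl (by linarith [hx.1]))).hasDerivWithinAt)
      ?_ (convex_Icc _ _) (left_mem_Icc.2 (by nlinarith [sq_nonneg ζ]))
      (right_mem_Icc.2 (by nlinarith [sq_nonneg ζ]))
    · simp only [Real.norm_eq_abs, add_sub_cancel_right, abs_of_nonneg (sq_nonneg ζ)] at this
      simp only [bX]
      refine le_trans (le_of_eq ?_) ((le_abs_self _).trans this)
      norm_num
    · rintro x ⟨hx1, hx2⟩
      have : 0 < x := by linarith
      rw [Real.norm_eq_abs, abs_of_nonneg (by positivity)]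
      simp only [a]
      gcongr <;> linarith
  have hY1 : bX q ε η - bX q ε 0 ≤ |η| ^ q := by
    rw [← bX_zero]
    have := Real.rpow_add_le_add_rpow (sq_nonneg η) hε.le (by linarith : 0 ≤ q / 2) (by linarith)
    simp only [bX]
    norm_num at this ⊢
    linarith
  have hS0 := bS_pos hε p q ζ η
  have hS1 : bS p q ε ζ η ^ kap q ≤ b := by
    simp only [b, bS, bX]
    gcongr
  have hS2 : 0 ≤ bS p q ε ζ η ^ kap q := by positivity
  have e : bQ p q (bdel q) ε ζ η - bQ p q (bdel q) ε 0 0 = (bX p ε ζ - bX p ε 0) +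
    (bX q ε η - bX q ε 0) + bdel q * (ζ ^ 2 * bS p q ε ζ η ^ kap q) := by
    simp only [bQ, bS]; ring
  have hη : 0 ≤ |η| ^ q := by positivity
  have t1 : 0 ≤ bdel q * (ζ ^ 2 * bS p q ε ζ η ^ kap q) := by positivity
  have t2 : bdel q * (ζ ^ 2 * bS p q ε ζ η ^ kap q) ≤ 1 * (ζ ^ 2 * b) := by gcongr
  rw [e, abs_of_nonneg (by linarith)]
  nlinarith [sq_nonneg ζ, mul_nonneg ha hη, mul_nonneg hb hη]

open scoped SchwartzMap FourierTransform LineDeriv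


/-! ### Part 2: the semigroup -/

abbrev E3 := EuclideanSpace ℝ (Fin 3)

def lam (ξ : E3) : ℝ := 1 + (2 * Real.pi) ^ 2 * ‖ξ‖ ^ 2

lemma lam_ge (ξ : E3) : 1 ≤ lam ξ := by
  unfold lam
  have : 0 ≤ (2 * Real.pi) ^ 2 * ‖ξ‖ ^ 2 := by positivity
  linarith

lemma lam_tg : Function.HasTemperateGrowth lam := by
  unfold lam
  fun_prop

lemma lam_cont : Continuous lam := by unfold lam; fun_prop

def hk (t : ℝ) (ξ : E3) : ℝ := Real.exp (-(max t 0 * lam ξ))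

lemma exp_neg_comp_tg {f : E3 → ℝ} (hf : Function.HasTemperateGrowth f) (h0 : ∀ x, 0 ≤ f x) :
    Function.HasTemperateGrowth (fun x => Real.exp (-(f x))) := by
  have ho : IsOpen (Ioi (-1 : ℝ)) := isOpen_Ioi
  refine Function.HasTemperateGrowth.comp' (g := fun y : ℝ => Real.exp (-y)) (f := f)
    (t := Ioi (-1)) ?_ ho.uniqueDiffOn ?_ ?_ hf
  · rintro _ ⟨x, rfl⟩
    exact lt_of_lt_of_le (by norm_num) (h0 x)
  · exact (Real.contDiff_exp.comp contDiff_neg).contDiffOn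
  · intro N
    refine ⟨0, Real.exp 1, (Real.exp_pos _).le, fun n _ x hx => ?_⟩
    rw [iteratedFDerivWithin_of_isOpen n ho hx, norm_iteratedFDeriv_eq_norm_iteratedDeriv]
    have := congrFun (iteratedDeriv_exp_const_mul n (-1)) x
    simp only [neg_mul, one_mul] at this
    rw [this]
    simp only [norm_mul, norm_pow, norm_neg, norm_one, one_pow, one_mul, pow_zero, mul_one,
      Real.norm_eq_abs, Real.abs_exp]
    apply Real.exp_le_exp.2
    have : -1 < x := hx
    linarith

lemma hk_tg (t : ℝ) : Function.HasTemperateGrowth (hk t) := by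
  refine exp_neg_comp_tg (f := fun ξ => max t 0 * lam ξ) ?_ fun x => ?_
  · exact (Function.HasTemperateGrowth.const _).mul lam_tg
  · exact mul_nonneg (le_max_right _ _) (by linarith [lam_ge x])

lemma hk_pos (t : ℝ) (ξ : E3) : 0 < hk t ξ := Real.exp_pos _
lemma hk_le_one (t : ℝ) (ξ : E3) : hk t ξ ≤ 1 := by
  unfold hk
  rw [Real.exp_le_one_iff, neg_nonpos]
  exact mul_nonneg (le_max_right _ _) (by linarith [lam_ge ξ])
lemma hk_le {t : ℝ} (ht : 0 ≤ t) (ξ : E3) : hk t ξ ≤ Real.exp (-t) := by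
  unfold hk
  rw [max_eq_left ht, Real.exp_le_exp]
  nlinarith [lam_ge ξ]

/-- real part as a real-linear map on Schwartz space -/
def reS : 𝓢(E3, ℂ) →L[ℝ] 𝓢(E3, ℝ) := SchwartzMap.postcompCLM Complex.reCLM

lemma reS_apply (F : 𝓢(E3, ℂ)) (x : E3) : reS F x = (F x).re := rfl

/-- semigroup in terms of the symbol -/
def P (ψ : 𝓢(E3, ℂ)) (t : ℝ) : 𝓢(E3, ℝ) := reS (𝓕⁻ (SchwartzMap.smulLeftCLM ℂ (hk t) ψ))

lemma P_add (ψ φ : 𝓢(E3, ℂ)) (t : ℝ) : P (ψ + φ) t = P ψ t + P φ t := by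
  simp [P, FourierTransform.fourierInv_add]
lemma P_neg (ψ : 𝓢(E3, ℂ)) (t : ℝ) : P (-ψ) t = - P ψ t := by
  simp only [P, map_neg]
  rw [FourierTransform.fourierInv_neg, map_neg]
lemma P_sub (ψ φ : 𝓢(E3, ℂ)) (t : ℝ) : P (ψ - φ) t = P ψ t - P φ t := by
  rw [sub_eq_add_neg, P_add, P_neg, sub_eq_add_neg]

lemma P_formula (ψ : 𝓢(E3, ℂ)) (t : ℝ) (x : E3) :
    P ψ t x = (∫ ξ, Real.fourierChar (inner ℝ ξ x) • (hk t ξ • ψ ξ)).re := by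
  rw [P, reS_apply, SchwartzMap.fourierInv_coe, Real.fourierInv_eq]
  simp [SchwartzMap.smulLeftCLM_apply_apply (hk_tg t)]

/-- symbol of the derivative -/
def dk (v : E3) (ψ : 𝓢(E3, ℂ)) : 𝓢(E3, ℂ) :=
  (2 * Real.pi * Complex.I) • SchwartzMap.smulLeftCLM ℂ (inner ℝ · v) ψ

lemma dk_apply (v : E3) (ψ : 𝓢(E3, ℂ)) (ξ : E3) :
    dk v ψ ξ = 2 * Real.pi * Complex.I * ((inner ℝ ξ v : ℝ) * ψ ξ) := by
  have : Function.HasTemperateGrowth (inner ℝ · v : E3 → ℝ) := by fun_prop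
  simp [dk, SchwartzMap.smulLeftCLM_apply_apply this]

lemma lineDeriv_reS (v : E3) (F : 𝓢(E3, ℂ)) : ∂_{v} (reS F) = reS (∂_{v} F) := by
  ext x
  rw [SchwartzMap.lineDerivOp_apply_eq_fderiv, reS_apply, SchwartzMap.lineDerivOp_apply_eq_fderiv]
  have h1 : HasFDerivAt (fun y => Complex.reCLM (F y)) (Complex.reCLM ∘L fderiv ℝ F x) x :=
    Complex.reCLM.hasFDerivAt.comp x (F.hasFDerivAt x)
  have : fderiv ℝ (reS F) x = Complex.reCLM ∘L fderiv ℝ F x := h1.fderiv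
  rw [this]; rfl

lemma P_deriv (v : E3) (ψ : 𝓢(E3, ℂ)) (t : ℝ) : ∂_{v} (P ψ t) = P (dk v ψ) t := by
  rw [P, lineDeriv_reS, SchwartzMap.lineDerivOp_fourierInv_eq, P]
  congr 2
  have : Function.HasTemperateGrowth (inner ℝ · v : E3 → ℝ) := by fun_prop
  ext ξ
  simp [SchwartzMap.smulLeftCLM_apply_apply this, SchwartzMap.smulLeftCLM_apply_apply (hk_tg t),
    dk_apply]
  ring

abbrev ee (k : Fin 3) : E3 := EuclideanSpace.single k 1

/-- symbol of `Δ - 1` -/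
def lm (ψ : 𝓢(E3, ℂ)) : 𝓢(E3, ℂ) := ∑ k, dk (ee k) (dk (ee k) ψ) - ψ

lemma inner_ee (ξ : E3) (k : Fin 3) : inner ℝ ξ (ee k) = ξ k := by
  simp [ee, EuclideanSpace.inner_single_right]

lemma lm_apply (ψ : 𝓢(E3, ℂ)) (ξ : E3) : lm ψ ξ = -(lam ξ : ℂ) * ψ ξ := by
  simp only [lm, sub_apply, add_apply, dk_apply, inner_ee, lam,
    EuclideanSpace.real_norm_sq_eq, Fin.sum_univ_three]
  push_cast
  ring_nf
  simp only [Complex.I_sq]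
  ring

lemma P_sum (s : Finset (Fin 3)) (ψ : Fin 3 → 𝓢(E3, ℂ)) (t : ℝ) :
    P (∑ k ∈ s, ψ k) t = ∑ k ∈ s, P (ψ k) t := by
  classical
  induction s using Finset.induction_on with
  | empty => simp [P]
  | insert a s ha ih => rw [Finset.sum_insert ha, Finset.sum_insert ha, P_add, ih]

lemma P_lm (ψ : 𝓢(E3, ℂ)) (t : ℝ) : P (lm ψ) t = ∑ k, ∂_{ee k} (∂_{ee k} (P ψ t)) - P ψ t := by
  simp only [P_deriv, lm, P_sub, P_sum]

/-- symbol of the resolvent -/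
def il (ψ : 𝓢(E3, ℂ)) : 𝓢(E3, ℂ) := SchwartzMap.smulLeftCLM ℂ (fun ξ => (lam ξ)⁻¹) ψ

lemma lam_inv_tg : Function.HasTemperateGrowth (fun ξ => (lam ξ)⁻¹) := by
  have h1 := Function.hasTemperateGrowth_one_add_norm_sq_rpow (H := E3) (-1)
  have h2 : Function.HasTemperateGrowth (fun ξ : E3 => (2 * Real.pi) • ξ) := by fun_prop
  have e : (fun ξ => (lam ξ)⁻¹) =
      (fun x : E3 => (1 + ‖x‖ ^ 2) ^ (-1 : ℝ)) ∘ fun ξ : E3 => (2 * Real.pi) • ξ := by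
    ext ξ
    simp only [Function.comp, Real.rpow_neg_one, lam, norm_smul, mul_pow,
      Real.norm_eq_abs, sq_abs]
  rw [e]
  exact h1.comp h2

lemma il_apply (ψ : 𝓢(E3, ℂ)) (ξ : E3) : il ψ ξ = (lam ξ : ℂ)⁻¹ * ψ ξ := by
  simp [il, SchwartzMap.smulLeftCLM_apply_apply lam_inv_tg]

lemma lam_ne (ξ : E3) : (lam ξ : ℂ) ≠ 0 := by
  exact_mod_cast (by linarith [lam_ge ξ] : lam ξ ≠ 0)

lemma lm_il (ψ : 𝓢(E3, ℂ)) : lm (il ψ) = -ψ := by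
  ext ξ
  rw [lm_apply, il_apply, neg_apply]
  field_simp [lam_ne ξ]

lemma il_lm (ψ : 𝓢(E3, ℂ)) : il (lm ψ) = -ψ := by
  ext ξ
  rw [il_apply, lm_apply, neg_apply]
  field_simp [lam_ne ξ]

lemma lm_dk (v : E3) (ψ : 𝓢(E3, ℂ)) : lm (dk v ψ) = dk v (lm ψ) := by
  ext ξ; simp only [lm_apply, dk_apply]; ring

lemma dk_neg (v : E3) (ψ : 𝓢(E3, ℂ)) : dk v (-ψ) = -dk v ψ := by
  ext ξ; simp [dk_apply]

lemma cont_hk : Continuous fun z : ℝ × E3 => hk z.1 z.2 := by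
  unfold hk
  have := lam_cont
  fun_prop

lemma P_cont (ψ : 𝓢(E3, ℂ)) : Continuous fun z : ℝ × E3 => P ψ z.1 z.2 := by
  simp only [P_formula]
  refine Complex.continuous_re.comp ?_
  refine continuous_of_dominated (bound := fun ξ => ‖ψ ξ‖) ?_ ?_ ψ.integrable.norm ?_
  · intro z
    refine Continuous.aestronglyMeasurable ?_
    have : Continuous fun ξ => hk z.1 ξ :=
      cont_hk.comp (by fun_prop : Continuous fun ξ : E3 => (z.1, ξ))
    have := ψ.continuous
    fun_prop
  · intro z
    refine .of_forall fun ξ => ?_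
    rw [Circle.norm_smul, norm_smul, Real.norm_of_nonneg (hk_pos _ _).le]
    nlinarith [hk_le_one z.1 ξ, norm_nonneg (ψ ξ)]
  · refine .of_forall fun ξ => ?_
    have : Continuous fun z : ℝ × E3 => hk z.1 ξ :=
      cont_hk.comp (by fun_prop : Continuous fun z : ℝ × E3 => (z.1, ξ))
    fun_prop

lemma P_bdd (ψ : 𝓢(E3, ℂ)) (t : ℝ) (x : E3) : |P ψ t x| ≤ ∫ ξ, ‖ψ ξ‖ := by
  rw [P_formula]
  refine (Complex.abs_re_le_norm _).trans ?_
  refine (norm_integral_le_integral_norm _).trans ?_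
  refine integral_mono_of_nonneg (.of_forall fun _ => norm_nonneg _) ψ.integrable.norm
    (.of_forall fun ξ => ?_)
  simp only
  rw [Circle.norm_smul, norm_smul, Real.norm_of_nonneg (hk_pos _ _).le]
  nlinarith [hk_le_one t ξ, norm_nonneg (ψ ξ)]

lemma schwartz_sq_integrable (ψ : 𝓢(E3, ℂ)) : Integrable fun x => ‖ψ x‖ ^ 2 :=
  (ψ.memLp 2).norm.integrable_sq

lemma schwartz_mul_integrable (f g : 𝓢(E3, ℝ)) : Integrable fun x => f x * g x :=
  MemLp.integrable_mul (p := 2) (q := 2) (f.memLp 2) (g.memLp 2)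

lemma P_L2 (ψ : 𝓢(E3, ℂ)) {t : ℝ} (ht : 0 ≤ t) :
    ∫ x, P ψ t x ^ 2 ≤ Real.exp (-(2 * t)) * ∫ ξ, ‖ψ ξ‖ ^ 2 := by
  set F := SchwartzMap.smulLeftCLM ℂ (hk t) ψ
  have h1 : ∫ x, ‖𝓕⁻ F x‖ ^ 2 = ∫ x, ‖F x‖ ^ 2 := by
    have := SchwartzMap.integral_norm_sq_fourier (𝓕⁻ F)
    rw [FourierTransform.fourier_fourierInv_eq] at this
    exact this.symm
  calc ∫ x, P ψ t x ^ 2 ≤ ∫ x, ‖𝓕⁻ F x‖ ^ 2 := by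
        refine integral_mono_of_nonneg (.of_forall fun _ => sq_nonneg _)
          (schwartz_sq_integrable (𝓕⁻ F)) (.of_forall fun x => ?_)
        simp only
        rw [← sq_abs]
        gcongr
        exact Complex.abs_re_le_norm _
    _ = ∫ x, ‖F x‖ ^ 2 := h1
    _ ≤ ∫ x, Real.exp (-(2 * t)) * ‖ψ x‖ ^ 2 := by
        refine integral_mono_of_nonneg (.of_forall fun _ => sq_nonneg _)
          ((schwartz_sq_integrable ψ).const_mul _) (.of_forall fun x => ?_)
        simp only [F]
        rw [SchwartzMap.smulLeftCLM_apply_apply (hk_tg t), norm_smul, mul_pow,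
          Real.norm_of_nonneg (hk_pos _ _).le, show -(2 * t) = ((2:ℕ):ℝ) * (-t) by push_cast; ring,
          Real.exp_nat_mul]
        gcongr
        · exact (hk_pos _ _).le
        · exact hk_le ht _
    _ = _ := integral_const_mul _ _

lemma P_hasDerivAt (ψ : 𝓢(E3, ℂ)) {t : ℝ} (ht : 0 < t) (x : E3) :
    HasDerivAt (fun s => P ψ s x) (P (lm ψ) t x) t := by
  simp only [P_formula]
  have hc := ψ.continuous
  have hlc := (lm ψ).continuous
  have hkc : ∀ s, Continuous fun ξ => hk s ξ := fun s =>
    cont_hk.comp (by fun_prop : Continuous fun ξ : E3 => (s, ξ))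
  have key := hasDerivAt_integral_of_dominated_loc_of_deriv_le (μ := volume) (𝕜 := ℝ)
    (F := fun s ξ => Real.fourierChar (inner ℝ ξ x) • (hk s ξ • ψ ξ))
    (F' := fun s ξ => Real.fourierChar (inner ℝ ξ x) • (hk s ξ • lm ψ ξ))
    (x₀ := t) (s := Ioi 0) (bound := fun ξ => ‖lm ψ ξ‖) (Ioi_mem_nhds ht)
    (.of_forall fun s => ?_) ?_ ?_ (.of_forall fun ξ s hs => ?_) (lm ψ).integrable.norm
    (.of_forall fun ξ s hs => ?_)
  · exact Complex.reCLM.hasFDerivAt.comp_hasDerivAt t key.2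
  · refine Continuous.aestronglyMeasurable ?_
    have := hkc s
    fun_prop
  · refine ψ.integrable.norm.mono' (Continuous.aestronglyMeasurable ?_) (.of_forall fun ξ => ?_)
    · have := hkc t
      fun_prop
    · rw [Circle.norm_smul, norm_smul, Real.norm_of_nonneg (hk_pos _ _).le]
      nlinarith [hk_le_one t ξ, norm_nonneg (ψ ξ)]
  · refine Continuous.aestronglyMeasurable ?_
    have := hkc t
    fun_prop
  · rw [Circle.norm_smul, norm_smul, Real.norm_of_nonneg (hk_pos _ _).le]
    nlinarith [hk_le_one s ξ, norm_nonneg (lm ψ ξ)]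
  · have hs : 0 < s := hs
    have h1 : HasDerivAt (fun s => Real.exp (-(s * lam ξ)))
        (Real.exp (-(s * lam ξ)) * (-(1 * lam ξ))) s :=
      ((hasDerivAt_id s).mul_const (lam ξ)).neg.exp
    have h2 : HasDerivAt (fun s => hk s ξ) (Real.exp (-(s * lam ξ)) * (-(1 * lam ξ))) s := by
      refine h1.congr_of_eventuallyEq ?_
      filter_upwards [Ioi_mem_nhds hs] with r hr
      rw [hk, max_eq_left (le_of_lt hr)]
    have h3 := (h2.smul_const (ψ ξ)).const_smul (Real.fourierChar (inner ℝ ξ x) : ℂ)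
    refine HasDerivAt.congr_deriv h3 ?_
    rw [lm_apply, hk, max_eq_left hs.le, Circle.smul_def]
    simp only [Complex.real_smul, smul_eq_mul]
    push_cast; ring



/-! ### Part 3: the bilinear embedding -/

lemma schwartz_bdd (F : 𝓢(E3, ℝ)) : ∃ M, 0 ≤ M ∧ ∀ x, |F x| ≤ M :=
  ⟨‖F.toBoundedContinuousFunction‖, norm_nonneg _, fun x =>
    F.toBoundedContinuousFunction.norm_coe_le_norm x⟩

lemma schwartz_bdd2 (F G : 𝓢(E3, ℝ)) : ∃ M, 0 ≤ M ∧ (∀ x, |F x| ≤ M) ∧ ∀ x, |G x| ≤ M := by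
  obtain ⟨M, h0, h⟩ := schwartz_bdd F
  obtain ⟨M', h0', h'⟩ := schwartz_bdd G
  exact ⟨max M M', le_max_of_le_left h0, fun x => (h x).trans (le_max_left _ _),
    fun x => (h' x).trans (le_max_right _ _)⟩

lemma schwartz_lineDeriv (F : 𝓢(E3, ℝ)) (v x : E3) :
    HasDerivAt (fun t : ℝ => F (x + t • v)) (∂_{v} F x) 0 := by
  have h : HasLineDerivAt ℝ F (fderiv ℝ F x v) x v := (F.hasFDerivAt x).hasLineDerivAt v
  rw [SchwartzMap.lineDerivOp_apply_eq_fderiv]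
  exact h

/-- composition of a continuous function of two variables with Schwartz functions, times Schwartz -/
lemma comp_mul_integrable {H : ℝ → ℝ → ℝ} (hH : Continuous fun z : ℝ × ℝ => H z.1 z.2)
    (F G K : 𝓢(E3, ℝ)) : Integrable fun x => H (F x) (G x) * K x := by
  obtain ⟨M, -, h1, h2⟩ := schwartz_bdd2 F G
  obtain ⟨C, -, hC⟩ := bdd_square hH M
  refine K.integrable.bdd_mul (c := C) (Continuous.aestronglyMeasurable ?_) (.of_forall fun x => ?_)
  · exact hH.comp (F.continuous.prodMk G.continuous)
  · exact hC _ _ (h1 x) (h2 x)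

lemma comp_mul_mul_integrable {H : ℝ → ℝ → ℝ} (hH : Continuous fun z : ℝ × ℝ => H z.1 z.2)
    (F G K L : 𝓢(E3, ℝ)) : Integrable fun x => H (F x) (G x) * K x * L x := by
  obtain ⟨M, -, h1, h2⟩ := schwartz_bdd2 F G
  obtain ⟨C, -, hC⟩ := bdd_square hH M
  simp only [mul_assoc]
  refine (schwartz_mul_integrable K L).bdd_mul (c := C) (Continuous.aestronglyMeasurable ?_)
    (.of_forall fun x => ?_)
  · exact hH.comp (F.continuous.prodMk G.continuous)
  · exact hC _ _ (h1 x) (h2 x)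

/-- integration by parts for the Bellman gradient -/
lemma ibp_comp {H H1 H2 : ℝ → ℝ → ℝ} (hH : Continuous fun z : ℝ × ℝ => H z.1 z.2)
    (hH1 : Continuous fun z : ℝ × ℝ => H1 z.1 z.2) (hH2 : Continuous fun z : ℝ × ℝ => H2 z.1 z.2)
    (hd : ∀ (f g : ℝ → ℝ) (f' g' s : ℝ), HasDerivAt f f' s → HasDerivAt g g' s →
      HasDerivAt (fun s => H (f s) (g s)) (H1 (f s) (g s) * f' + H2 (f s) (g s) * g') s)
    (F G K : 𝓢(E3, ℝ)) (v : E3) :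
    ∫ x, H (F x) (G x) * ∂_{v} K x =
      - ∫ x, (H1 (F x) (G x) * ∂_{v} F x + H2 (F x) (G x) * ∂_{v} G x) * K x := by
  have := integral_bilinear_hasLineDerivAt_right_eq_neg_left_of_integrable (μ := volume)
    (B := ContinuousLinearMap.mul ℝ ℝ) (f := fun x => H (F x) (G x)) (g := fun x => K x)
    (f' := fun x => H1 (F x) (G x) * ∂_{v} F x + H2 (F x) (G x) * ∂_{v} G x)
    (g' := fun x => ∂_{v} K x) (v := v) ?_ ?_ ?_ ?_ ?_
  · simpa only [ContinuousLinearMap.mul_apply'] using this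
  · simp only [ContinuousLinearMap.mul_apply', add_mul]
    exact (comp_mul_mul_integrable hH1 F G _ K).add (comp_mul_mul_integrable hH2 F G _ K)
  · exact comp_mul_integrable hH F G (∂_{v} K)
  · exact comp_mul_integrable hH F G K
  · intro x _
    have h := hd _ _ _ _ 0 (schwartz_lineDeriv F v x) (schwartz_lineDeriv G v x)
    simp only [zero_smul, add_zero] at h
    exact h
  · intro x _
    exact schwartz_lineDeriv K v x

def LL (F : 𝓢(E3, ℝ)) : 𝓢(E3, ℝ) := ∑ k, ∂_{ee k} (∂_{ee k} F) - F

lemma LL_apply (F : 𝓢(E3, ℝ)) (x : E3) : LL F x = ∑ k, ∂_{ee k} (∂_{ee k} F) x - F x := by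
  simp only [LL, sub_apply, Fin.sum_univ_three, add_apply]

lemma LL_symm (A B : 𝓢(E3, ℝ)) : ∫ x, A x * LL B x = ∫ x, LL A x * B x := by
  have h : ∀ k, ∫ x, A x * ∂_{ee k} (∂_{ee k} B) x = ∫ x, ∂_{ee k} (∂_{ee k} A) x * B x := by
    intro k
    rw [SchwartzMap.integral_mul_lineDerivOp_right_eq_neg_left,
      SchwartzMap.integral_mul_lineDerivOp_right_eq_neg_left, neg_neg]
  simp only [LL_apply, mul_sub, sub_mul, Finset.mul_sum, Finset.sum_mul]
  rw [integral_sub, integral_sub, integral_finsetSum, integral_finsetSum]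
  · simp only [h]
  · exact fun k _ => schwartz_mul_integrable _ _
  · exact fun k _ => schwartz_mul_integrable _ _
  · exact integrable_finsetSum _ fun k _ => schwartz_mul_integrable _ _
  · exact schwartz_mul_integrable _ _
  · exact integrable_finsetSum _ fun k _ => schwartz_mul_integrable _ _
  · exact schwartz_mul_integrable _ _

section
variable {p q ε : ℝ}

lemma cont_bQz' (hε : 0 < ε) (δ : ℝ) : Continuous fun z : ℝ × ℝ => bQz p q δ ε z.1 z.2 := by
  simp only [bQz_eq]
  exact (cont_bA hε p q δ continuous_fst continuous_snd).mul continuous_fst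

lemma cont_bQe' (hε : 0 < ε) (δ : ℝ) : Continuous fun z : ℝ × ℝ => bQe p q δ ε z.1 z.2 := by
  simp only [bQe_eq]
  exact (cont_bB hε p q δ continuous_fst continuous_snd).mul continuous_snd

/-- the Hessian form -/
def hf (p q ε : ℝ) (ζ η w1 w2 : ℝ) : ℝ := bQzz p q (bdel q) ε ζ η * w1 ^ 2 +
  2 * bQze p q (bdel q) ε ζ η * w1 * w2 + bQee p q (bdel q) ε ζ η * w2 ^ 2

lemma hf_eq (ζ η w1 w2 : ℝ) : hf p q ε ζ η w1 w2 =
    (bQzz p q (bdel q) ε ζ η * w1 * w1 + bQze p q (bdel q) ε ζ η * w2 * w1) +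
    (bQze p q (bdel q) ε ζ η * w1 * w2 + bQee p q (bdel q) ε ζ η * w2 * w2) := by
  unfold hf; ring

lemma int_zz (hε : 0 < ε) (F G K L : 𝓢(E3, ℝ)) :
    Integrable fun x => bQzz p q (bdel q) ε (F x) (G x) * K x * L x :=
  comp_mul_mul_integrable (cont_bQzz hε p q _ continuous_fst continuous_snd) F G K L
lemma int_ze (hε : 0 < ε) (F G K L : 𝓢(E3, ℝ)) :
    Integrable fun x => bQze p q (bdel q) ε (F x) (G x) * K x * L x :=
  comp_mul_mul_integrable (cont_bQze hε p q _ continuous_fst continuous_snd) F G K L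
lemma int_ee (hε : 0 < ε) (F G K L : 𝓢(E3, ℝ)) :
    Integrable fun x => bQee p q (bdel q) ε (F x) (G x) * K x * L x :=
  comp_mul_mul_integrable (cont_bQee hε p q _ continuous_fst continuous_snd) F G K L
lemma int_z (hε : 0 < ε) (F G K : 𝓢(E3, ℝ)) :
    Integrable fun x => bQz p q (bdel q) ε (F x) (G x) * K x :=
  comp_mul_integrable (cont_bQz' hε _) F G K
lemma int_e (hε : 0 < ε) (F G K : 𝓢(E3, ℝ)) :
    Integrable fun x => bQe p q (bdel q) ε (F x) (G x) * K x :=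
  comp_mul_integrable (cont_bQe' hε _) F G K

lemma int_hf (hε : 0 < ε) (F G K L : 𝓢(E3, ℝ)) :
    Integrable fun x => hf p q ε (F x) (G x) (K x) (L x) := by
  simp only [hf_eq]
  exact ((int_zz hε F G K K).add (int_ze hε F G L K)).add
    ((int_ze hε F G K L).add (int_ee hε F G L L))

lemma ibp_k (hε : 0 < ε) (F G : 𝓢(E3, ℝ)) (v : E3) :
    ∫ x, (bQz p q (bdel q) ε (F x) (G x) * ∂_{v} (∂_{v} F) x +
      bQe p q (bdel q) ε (F x) (G x) * ∂_{v} (∂_{v} G) x) =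
    - ∫ x, hf p q ε (F x) (G x) (∂_{v} F x) (∂_{v} G x) := by
  have h1 := ibp_comp (cont_bQz' hε (bdel q)) (cont_bQzz hε p q (bdel q) continuous_fst continuous_snd)
    (cont_bQze hε p q (bdel q) continuous_fst continuous_snd)
    (fun f g f' g' s h h' => hasDerivAt_bQz hε p q (bdel q) h h') F G (∂_{v} F) v
  have h2 := ibp_comp (cont_bQe' hε (bdel q)) (cont_bQze hε p q (bdel q) continuous_fst continuous_snd)
    (cont_bQee hε p q (bdel q) continuous_fst continuous_snd)
    (fun f g f' g' s h h' => hasDerivAt_bQe hε p q (bdel q) h h') F G (∂_{v} G) v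
  rw [integral_add (int_z hε F G _) (int_e hε F G _), h1, h2, ← neg_add, ← integral_add]
  · congr 1
    refine integral_congr_ae (.of_forall fun x => ?_)
    simp only [hf_eq]; ring
  · simp only [add_mul]
    exact (int_zz hε F G _ _).add (int_ze hε F G _ _)
  · simp only [add_mul]
    exact (int_ze hε F G _ _).add (int_ee hε F G _ _)

/-- full integrated identity -/
lemma ibp_full (hε : 0 < ε) (F G : 𝓢(E3, ℝ)) :
    ∫ x, (bQz p q (bdel q) ε (F x) (G x) * LL F x + bQe p q (bdel q) ε (F x) (G x) * LL G x) =
    - ∫ x, (∑ k, hf p q ε (F x) (G x) (∂_{ee k} F x) (∂_{ee k} G x) +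
      (bQz p q (bdel q) ε (F x) (G x) * F x + bQe p q (bdel q) ε (F x) (G x) * G x)) := by
  have e : ∀ x, bQz p q (bdel q) ε (F x) (G x) * LL F x + bQe p q (bdel q) ε (F x) (G x) * LL G x =
      ∑ k, (bQz p q (bdel q) ε (F x) (G x) * ∂_{ee k} (∂_{ee k} F) x +
      bQe p q (bdel q) ε (F x) (G x) * ∂_{ee k} (∂_{ee k} G) x) -
      (bQz p q (bdel q) ε (F x) (G x) * F x + bQe p q (bdel q) ε (F x) (G x) * G x) := by
    intro x
    simp only [LL_apply, mul_sub, Finset.mul_sum, Finset.sum_add_distrib]; ring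
  simp only [e]
  have i0 : Integrable fun x => bQz p q (bdel q) ε (F x) (G x) * F x +
    bQe p q (bdel q) ε (F x) (G x) * G x := (int_z hε F G F).add (int_e hε F G G)
  have i1 : ∀ k ∈ (Finset.univ : Finset (Fin 3)), Integrable fun x =>
    bQz p q (bdel q) ε (F x) (G x) * ∂_{ee k} (∂_{ee k} F) x +
      bQe p q (bdel q) ε (F x) (G x) * ∂_{ee k} (∂_{ee k} G) x := fun k _ =>
    (int_z hε F G _).add (int_e hε F G _)
  have i2 : ∀ k ∈ (Finset.univ : Finset (Fin 3)), Integrable fun x =>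
    hf p q ε (F x) (G x) (∂_{ee k} F x) (∂_{ee k} G x) := fun k _ => int_hf hε F G _ _
  rw [integral_sub (integrable_finsetSum _ i1) i0, integral_finsetSum _ i1,
    integral_add (integrable_finsetSum _ i2) i0, integral_finsetSum _ i2]
  simp only [ibp_k hε F G, Finset.sum_neg_distrib]
  ring

def DO (i : Option (Fin 3)) (F : 𝓢(E3, ℝ)) : 𝓢(E3, ℝ) :=
  match i with
  | none => F
  | some k => ∂_{ee k} F

lemma pointwise (hp : 2 ≤ p) (hpq : 1 / p + 1 / q = 1) (hε : 0 < ε) (F G : 𝓢(E3, ℝ))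
    (i j : Option (Fin 3)) (x : E3) {c : ℝ} (hc : |c| = bdel q) :
    - (2 * c * (DO i F x * DO j G x)) ≤
    ∑ k, hf p q ε (F x) (G x) (∂_{ee k} F x) (∂_{ee k} G x) +
      (bQz p q (bdel q) ε (F x) (G x) * F x + bQe p q (bdel q) ε (F x) (G x) * G x) := by
  obtain ⟨hq1, hq2, -⟩ := conj_facts hp hpq
  have hd : 0 < bdel q := by rw [bdel]; have := sub_pos.2 hq1; positivity
  have hh := fun k => bQ_hess hp hpq hε (F x) (G x) (∂_{ee k} F x) (∂_{ee k} G x)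
  have hg := bQ_grad hp hpq hε (F x) (G x)
  have hs := Real.rpow_pos_of_pos (bS_pos hε p q (F x) (G x)) (kap q)
  set s := bS p q ε (F x) (G x) ^ kap q
  have key : bdel q * (∑ o : Option (Fin 3), s * DO o F x ^ 2 +
      ∑ o : Option (Fin 3), DO o G x ^ 2 / s) ≤
      ∑ k, hf p q ε (F x) (G x) (∂_{ee k} F x) (∂_{ee k} G x) +
      (bQz p q (bdel q) ε (F x) (G x) * F x + bQe p q (bdel q) ε (F x) (G x) * G x) := by
    rw [Fintype.sum_option, Fintype.sum_option]
    have := Finset.sum_le_sum (s := Finset.univ) fun k _ => hh k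
    rw [← Finset.mul_sum, Finset.sum_add_distrib] at this
    simp only [DO]
    simp only [hf]
    linarith
  refine le_trans ?_ key
  have h1 : s * DO i F x ^ 2 ≤ ∑ o : Option (Fin 3), s * DO o F x ^ 2 :=
    Finset.single_le_sum (f := fun o => s * DO o F x ^ 2) (fun o _ => by positivity)
      (Finset.mem_univ i)
  have h2 : DO j G x ^ 2 / s ≤ ∑ o : Option (Fin 3), DO o G x ^ 2 / s :=
    Finset.single_le_sum (f := fun o => DO o G x ^ 2 / s) (fun o _ => by positivity)
      (Finset.mem_univ j)
  have h3 : 2 * |DO i F x * DO j G x| ≤ s * DO i F x ^ 2 + DO j G x ^ 2 / s := by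
    have : s * DO i F x ^ 2 + DO j G x ^ 2 / s - 2 * |DO i F x * DO j G x| =
        (s * |DO i F x| - |DO j G x|) ^ 2 / s := by
      rw [abs_mul]
      field_simp
      rw [← sq_abs (DO i F x), ← sq_abs (DO j G x)]; ring
    have h2 : 0 ≤ (s * |DO i F x| - |DO j G x|) ^ 2 / s := by positivity
    linarith
  have h4 : - (2 * c * (DO i F x * DO j G x)) ≤ bdel q * (2 * |DO i F x * DO j G x|) := by
    refine (neg_le_abs _).trans ?_
    rw [abs_mul, abs_mul, hc]
    norm_num
    linarith
  exact h4.trans (mul_le_mul_of_nonneg_left (h3.trans (add_le_add h1 h2)) hd.le)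

/-- the spatial inequality -/
lemma spatial (hp : 2 ≤ p) (hpq : 1 / p + 1 / q = 1) (hε : 0 < ε) (F G A B : 𝓢(E3, ℝ))
    (i j : Option (Fin 3)) {c : ℝ} (hc : |c| = bdel q) (hA : LL A = -DO i F) (hB : B = DO j G) :
    ∫ x, ((bQz p q (bdel q) ε (F x) (G x) * LL F x + bQe p q (bdel q) ε (F x) (G x) * LL G x) +
      c * (LL A x * B x + A x * LL B x)) ≤ 0 := by
  have i1 : Integrable fun x => bQz p q (bdel q) ε (F x) (G x) * LL F x +
    bQe p q (bdel q) ε (F x) (G x) * LL G x := (int_z hε F G _).add (int_e hε F G _)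
  have i0 : Integrable fun x => c * (LL A x * B x + A x * LL B x) :=
    ((schwartz_mul_integrable _ _).add (schwartz_mul_integrable _ _)).const_mul c
  rw [integral_add i1 i0,
    integral_const_mul, integral_add (schwartz_mul_integrable _ _) (schwartz_mul_integrable _ _),
    LL_symm, ibp_full hε]
  have i2 : Integrable fun x => ∑ k, hf p q ε (F x) (G x) (∂_{ee k} F x) (∂_{ee k} G x) +
      (bQz p q (bdel q) ε (F x) (G x) * F x + bQe p q (bdel q) ε (F x) (G x) * G x) :=
    (integrable_finsetSum _ fun k _ => int_hf hε F G _ _).add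
      ((int_z hε F G F).add (int_e hε F G G))
  have h := integral_mono (((schwartz_mul_integrable (DO i F) (DO j G)).const_mul (2 * c)).neg)
    i2 (fun x => pointwise hp hpq hε F G i j x hc)
  rw [integral_neg', integral_const_mul] at h
  have h3 : ∫ x, LL A x * B x = - ∫ x, DO i F x * DO j G x := by
    rw [hA, hB, ← integral_neg]
    refine integral_congr_ae (.of_forall fun x => ?_)
    simp
  rw [h3]
  linarith
end



def dO (i : Option (Fin 3)) (ψ : 𝓢(E3, ℂ)) : 𝓢(E3, ℂ) :=
  match i with
  | none => ψ
  | some k => dk (ee k) ψ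

lemma P_dO (i : Option (Fin 3)) (ψ : 𝓢(E3, ℂ)) (t : ℝ) : P (dO i ψ) t = DO i (P ψ t) := by
  cases i with
  | none => rfl
  | some k => simp only [dO, DO, P_deriv]

lemma lm_dO_il (i : Option (Fin 3)) (ψ : 𝓢(E3, ℂ)) : lm (dO i (il ψ)) = - dO i ψ := by
  cases i with
  | none => simp only [dO, lm_il]
  | some k => simp only [dO, lm_dk, lm_il, dk_neg]

lemma LL_P (ψ : 𝓢(E3, ℂ)) (t : ℝ) : LL (P ψ t) = P (lm ψ) t := by rw [P_lm, LL]

lemma P_sq_integrable (ψ : 𝓢(E3, ℂ)) (t : ℝ) : Integrable fun x => P ψ t x ^ 2 := by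
  simpa only [sq] using schwartz_mul_integrable (P ψ t) (P ψ t)

lemma P_memLp_prod (ψ : 𝓢(E3, ℂ)) (T : ℝ) :
    MemLp (fun z : ℝ × E3 => P ψ z.1 z.2) 2 ((volume.restrict (Ioc 0 T)).prod volume) := by
  have hc := P_cont ψ
  have hc2 : Continuous fun z : ℝ × E3 => P ψ z.1 z.2 ^ 2 := hc.pow 2
  rw [memLp_two_iff_integrable_sq hc.aestronglyMeasurable, integrable_prod_iff
    hc2.aestronglyMeasurable]
  refine ⟨.of_forall fun t => P_sq_integrable ψ t, ?_⟩
  have hm : AEStronglyMeasurable (fun t => ∫ x, ‖P ψ t x ^ 2‖) (volume.restrict (Ioc 0 T)) := by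
    have := (hc2.norm.stronglyMeasurable).integral_prod_right' (ν := (volume : Measure E3))
    exact this.aestronglyMeasurable
  refine Integrable.mono' (g := fun _ => ∫ ξ, ‖ψ ξ‖ ^ 2) (integrable_const _) hm ?_
  rw [ae_restrict_iff' measurableSet_Ioc]
  refine .of_forall fun t ht => ?_
  have h0 : 0 ≤ ∫ x, ‖P ψ t x ^ 2‖ := integral_nonneg fun x => norm_nonneg _
  rw [Real.norm_of_nonneg h0]
  simp only [norm_pow, Real.norm_eq_abs, sq_abs]
  refine (P_L2 ψ ht.1.le).trans ?_
  have h1 : Real.exp (-(2 * t)) ≤ 1 := by rw [Real.exp_le_one_iff]; linarith [ht.1]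
  have h2 : 0 ≤ ∫ ξ, ‖ψ ξ‖ ^ 2 := integral_nonneg fun x => by positivity
  nlinarith

lemma P_mul_integrable_prod (ψ φ : 𝓢(E3, ℂ)) (T : ℝ) :
    Integrable (fun z : ℝ × E3 => P ψ z.1 z.2 * P φ z.1 z.2)
      ((volume.restrict (Ioc 0 T)).prod volume) :=
  MemLp.integrable_mul (p := 2) (q := 2) (P_memLp_prod ψ T) (P_memLp_prod φ T)

section
variable {p q ε : ℝ}

def RR (p q ε c : ℝ) (φ γ a b : 𝓢(E3, ℂ)) (t : ℝ) (x : E3) : ℝ :=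
  bQ p q (bdel q) ε (P φ t x) (P γ t x) - bQ p q (bdel q) ε 0 0 + c * (P a t x * P b t x)

def RR' (p q ε c : ℝ) (φ γ a b : 𝓢(E3, ℂ)) (t : ℝ) (x : E3) : ℝ :=
  (bQz p q (bdel q) ε (P φ t x) (P γ t x) * P (lm φ) t x +
    bQe p q (bdel q) ε (P φ t x) (P γ t x) * P (lm γ) t x) +
    c * (P (lm a) t x * P b t x + P a t x * P (lm b) t x)

lemma P_cont_t (ψ : 𝓢(E3, ℂ)) (x : E3) : Continuous fun t => P ψ t x := by
  have h : Continuous fun t : ℝ => (t, x) := by fun_prop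
  have := Continuous.comp (P_cont ψ) h
  simp only [Function.comp_def] at this
  exact this

lemma RR_deriv (hε : 0 < ε) (c : ℝ) (φ γ a b : 𝓢(E3, ℂ)) {t : ℝ} (ht : 0 < t) (x : E3) :
    HasDerivAt (fun s => RR p q ε c φ γ a b s x) (RR' p q ε c φ γ a b t x) t := by
  unfold RR RR'
  exact ((hasDerivAt_bQ hε p q (bdel q) (P_hasDerivAt φ ht x) (P_hasDerivAt γ ht x)).sub_const _).add
    (((P_hasDerivAt a ht x).mul (P_hasDerivAt b ht x)).const_mul c)

lemma RR_ftc (hε : 0 < ε) (c : ℝ) (φ γ a b : 𝓢(E3, ℂ)) {T : ℝ} (hT : 0 ≤ T) (x : E3) :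
    ∫ t in (0:ℝ)..T, RR' p q ε c φ γ a b t x = RR p q ε c φ γ a b T x - RR p q ε c φ γ a b 0 x := by
  have c1 := P_cont_t φ x
  have c2 := P_cont_t γ x
  have c3 := P_cont_t a x
  have c4 := P_cont_t b x
  have c5 := P_cont_t (lm φ) x
  have c6 := P_cont_t (lm γ) x
  have c7 := P_cont_t (lm a) x
  have c8 := P_cont_t (lm b) x
  refine intervalIntegral.integral_eq_sub_of_hasDerivAt_of_le hT (Continuous.continuousOn ?_)
    (fun t ht => RR_deriv hε c φ γ a b ht.1 x) (Continuous.intervalIntegrable ?_ _ _)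
  · have := cont_bQ hε p q (bdel q) c1 c2
    unfold RR; fun_prop
  · have := (cont_bQz' (p := p) (q := q) hε (bdel q)).comp (c1.prodMk c2)
    have := (cont_bQe' (p := p) (q := q) hε (bdel q)).comp (c1.prodMk c2)
    simp only [Function.comp_def] at *
    unfold RR'; fun_prop

lemma P_bdd2 (φ γ : 𝓢(E3, ℂ)) : ∃ M, 0 ≤ M ∧ (∀ t x, |P φ t x| ≤ M) ∧ ∀ t x, |P γ t x| ≤ M :=
  ⟨max (∫ ξ, ‖φ ξ‖) (∫ ξ, ‖γ ξ‖), le_max_of_le_left (integral_nonneg fun _ => norm_nonneg _),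
    fun t x => (P_bdd φ t x).trans (le_max_left _ _),
    fun t x => (P_bdd γ t x).trans (le_max_right _ _)⟩

lemma RR'_integrable (hε : 0 < ε) (c : ℝ) (φ γ a b : 𝓢(E3, ℂ)) (T : ℝ) :
    Integrable (Function.uncurry (RR' p q ε c φ γ a b))
      ((volume.restrict (Ioc 0 T)).prod volume) := by
  obtain ⟨M, -, h1, h2⟩ := P_bdd2 φ γ
  obtain ⟨C1, -, hC1⟩ := bdd_square (cont_bA hε p q (bdel q) continuous_fst continuous_snd) M
  obtain ⟨C2, -, hC2⟩ := bdd_square (cont_bB hε p q (bdel q) continuous_fst continuous_snd) M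
  have e : Function.uncurry (RR' p q ε c φ γ a b) = fun z : ℝ × E3 =>
    (bA p q (bdel q) ε (P φ z.1 z.2) (P γ z.1 z.2) * (P φ z.1 z.2 * P (lm φ) z.1 z.2) +
    bB p q (bdel q) ε (P φ z.1 z.2) (P γ z.1 z.2) * (P γ z.1 z.2 * P (lm γ) z.1 z.2)) +
    c * (P (lm a) z.1 z.2 * P b z.1 z.2 + P a z.1 z.2 * P (lm b) z.1 z.2) := by
    ext z
    simp only [Function.uncurry, RR', bQz_eq, bQe_eq]; ring
  rw [e]
  refine Integrable.add (Integrable.add ?_ ?_) (Integrable.const_mul (Integrable.add ?_ ?_) c)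
  · exact (P_mul_integrable_prod φ (lm φ) T).bdd_mul (c := C1)
      (cont_bA hε p q (bdel q) (P_cont φ) (P_cont γ)).aestronglyMeasurable
      (.of_forall fun z => hC1 _ _ (h1 _ _) (h2 _ _))
  · exact (P_mul_integrable_prod γ (lm γ) T).bdd_mul (c := C2)
      (cont_bB hε p q (bdel q) (P_cont φ) (P_cont γ)).aestronglyMeasurable
      (.of_forall fun z => hC2 _ _ (h1 _ _) (h2 _ _))
  · exact P_mul_integrable_prod _ _ T
  · exact P_mul_integrable_prod _ _ T

/-- bound of `RR` -/
lemma RR_bound (hε : 0 < ε) (c : ℝ) (φ γ a b : 𝓢(E3, ℂ)) :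
    ∃ C, 0 ≤ C ∧ ∀ t x, |RR p q ε c φ γ a b t x| ≤
      C * (P φ t x ^ 2 + P γ t x ^ 2) + |c| * (P a t x ^ 2 + P b t x ^ 2) := by
  obtain ⟨M, -, h1, h2⟩ := P_bdd2 φ γ
  obtain ⟨C, h0, hC⟩ := bQ_sub_le (p := p) (q := q) (δ := bdel q) hε M
  refine ⟨C, h0, fun t x => (abs_add_le _ _).trans (add_le_add (hC _ _ (h1 _ _) (h2 _ _)) ?_)⟩
  rw [abs_mul]
  gcongr
  rw [abs_le]
  constructor <;> nlinarith [sq_nonneg (P a t x + P b t x), sq_nonneg (P a t x - P b t x), sq_nonneg (P a t x), sq_nonneg (P b t x)]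

lemma RR_integrable (hε : 0 < ε) (c : ℝ) (φ γ a b : 𝓢(E3, ℂ)) (t : ℝ) :
    Integrable (RR p q ε c φ γ a b t) := by
  obtain ⟨C, -, hC⟩ := RR_bound (p := p) (q := q) hε c φ γ a b
  refine Integrable.mono' (g := fun x => C * (P φ t x ^ 2 + P γ t x ^ 2) +
    |c| * (P a t x ^ 2 + P b t x ^ 2)) ?_ (Continuous.aestronglyMeasurable ?_)
    (.of_forall fun x => hC t x)
  · exact (((P_sq_integrable φ t).add (P_sq_integrable γ t)).const_mul C).add
      (((P_sq_integrable a t).add (P_sq_integrable b t)).const_mul |c|)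
  · have c1 := (P φ t).continuous
    have c2 := (P γ t).continuous
    have c3 := (P a t).continuous
    have c4 := (P b t).continuous
    have := cont_bQ hε p q (bdel q) c1 c2
    unfold RR
    fun_prop

lemma RR_decay (hε : 0 < ε) (c : ℝ) (φ γ a b : 𝓢(E3, ℂ)) :
    Filter.Tendsto (fun t => ∫ x, RR p q ε c φ γ a b t x) Filter.atTop (nhds 0) := by
  obtain ⟨C, h0, hC⟩ := RR_bound (p := p) (q := q) hε c φ γ a b
  set K := C * ((∫ ξ, ‖φ ξ‖ ^ 2) + ∫ ξ, ‖γ ξ‖ ^ 2) + |c| * ((∫ ξ, ‖a ξ‖ ^ 2) + ∫ ξ, ‖b ξ‖ ^ 2)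
  have hlim : Filter.Tendsto (fun t : ℝ => Real.exp (-(2 * t)) * K) Filter.atTop (nhds 0) := by
    have : Filter.Tendsto (fun t : ℝ => Real.exp (-(2 * t))) Filter.atTop (nhds 0) :=
      Real.tendsto_exp_neg_atTop_nhds_zero.comp
        (Filter.tendsto_id.const_mul_atTop (by norm_num : (0:ℝ) < 2))
    simpa using this.mul_const K
  refine squeeze_zero_norm' ?_ hlim
  filter_upwards [Filter.eventually_ge_atTop 0] with t ht
  have i1 := (((P_sq_integrable φ t).add (P_sq_integrable γ t)).const_mul C)
  have i2 := (((P_sq_integrable a t).add (P_sq_integrable b t)).const_mul |c|)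
  calc ‖∫ x, RR p q ε c φ γ a b t x‖ ≤ ∫ x, ‖RR p q ε c φ γ a b t x‖ :=
        norm_integral_le_integral_norm _
    _ ≤ ∫ x, (C * (P φ t x ^ 2 + P γ t x ^ 2) + |c| * (P a t x ^ 2 + P b t x ^ 2)) :=
        integral_mono (RR_integrable hε c φ γ a b t).norm (i1.add i2) (fun x => hC t x)
    _ = C * ((∫ x, P φ t x ^ 2) + ∫ x, P γ t x ^ 2) + |c| * ((∫ x, P a t x ^ 2) + ∫ x, P b t x ^ 2) := by
        rw [← integral_add (P_sq_integrable φ t) (P_sq_integrable γ t),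
          ← integral_add (P_sq_integrable a t) (P_sq_integrable b t), ← integral_const_mul,
          ← integral_const_mul]
        exact integral_add i1 i2
    _ ≤ C * (Real.exp (-(2 * t)) * (∫ ξ, ‖φ ξ‖ ^ 2) + Real.exp (-(2 * t)) * ∫ ξ, ‖γ ξ‖ ^ 2) +
        |c| * (Real.exp (-(2 * t)) * (∫ ξ, ‖a ξ‖ ^ 2) + Real.exp (-(2 * t)) * ∫ ξ, ‖b ξ‖ ^ 2) := by
        gcongr <;> exact P_L2 _ ht
    _ = _ := by simp only [K]; ring

lemma RR_nonneg (hp : 2 ≤ p) (hpq : 1 / p + 1 / q = 1) (hε : 0 < ε) (φ γ : 𝓢(E3, ℂ))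
    (i j : Option (Fin 3)) {c : ℝ} (hc : |c| = bdel q) :
    0 ≤ ∫ x, RR p q ε c φ γ (dO i (il φ)) (dO j γ) 0 x := by
  set a := dO i (il φ)
  set b := dO j γ
  refine le_of_tendsto (RR_decay (p := p) (q := q) hε c φ γ a b) ?_
  filter_upwards [Filter.eventually_ge_atTop 0] with T hT
  rw [← sub_nonpos, ← integral_sub (RR_integrable (p := p) (q := q) hε c φ γ a b T) (RR_integrable (p := p) (q := q) hε c φ γ a b 0)]
  simp only [← RR_ftc (p := p) (q := q) hε c φ γ a b hT, intervalIntegral.integral_of_le hT]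
  rw [← integral_integral_swap (RR'_integrable (p := p) (q := q) hε c φ γ a b T)]
  refine integral_nonpos fun t => ?_
  have hA : LL (P a t) = - DO i (P φ t) := by
    rw [LL_P, lm_dO_il, P_neg, P_dO]
  have := spatial hp hpq hε (P φ t) (P γ t) (P a t) (P b t) i j hc hA (P_dO j γ t)
  simp only [LL_P] at this
  exact this

lemma hk_zero (ξ : E3) : hk 0 ξ = 1 := by simp [hk]

lemma P_zero (ψ : 𝓢(E3, ℂ)) : P ψ 0 = reS (𝓕⁻ ψ) := by
  rw [P]
  congr 2
  ext ξ
  simp [SchwartzMap.smulLeftCLM_apply_apply (hk_tg 0), hk_zero]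

lemma abs_rpow_integrable (F : 𝓢(E3, ℝ)) {r : ℝ} (hr : 1 ≤ r) : Integrable fun x => |F x| ^ r := by
  have := (F.memLp (ENNReal.ofReal r) (μ := volume)).integrable_norm_rpow
    (by simp; linarith) ENNReal.ofReal_ne_top
  simpa [ENNReal.toReal_ofReal (by linarith : 0 ≤ r)] using this

lemma bilinear_eps (hp : 2 ≤ p) (hpq : 1 / p + 1 / q = 1) (hε : 0 < ε) (φ γ : 𝓢(E3, ℂ))
    (i j : Option (Fin 3)) :
    bdel q * |∫ x, DO i (P (il φ) 0) x * DO j (P γ 0) x| ≤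
      ∫ x, (bQ p q (bdel q) ε (P φ 0 x) (P γ 0 x) - bQ p q (bdel q) ε 0 0) := by
  obtain ⟨hq1, hq2, -⟩ := conj_facts hp hpq
  have hd : 0 < bdel q := by rw [bdel]; have := sub_pos.2 hq1; positivity
  have key : ∀ c : ℝ, |c| = bdel q → 0 ≤
      (∫ x, (bQ p q (bdel q) ε (P φ 0 x) (P γ 0 x) - bQ p q (bdel q) ε 0 0)) +
      c * ∫ x, DO i (P (il φ) 0) x * DO j (P γ 0) x := by
    intro c hc
    have := RR_nonneg hp hpq hε φ γ i j hc
    have e : (fun x => RR p q ε 0 φ γ φ γ 0 x) = fun x =>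
      bQ p q (bdel q) ε (P φ 0 x) (P γ 0 x) - bQ p q (bdel q) ε 0 0 := by
      ext x; simp [RR]
    have i1 : Integrable fun x =>
      bQ p q (bdel q) ε (P φ 0 x) (P γ 0 x) - bQ p q (bdel q) ε 0 0 := by
      rw [← e]; exact RR_integrable (p := p) (q := q) hε 0 φ γ φ γ 0
    simp only [RR, P_dO] at this
    rwa [integral_add i1 ((schwartz_mul_integrable _ _).const_mul c), integral_const_mul] at this
  have h1 := key (bdel q) (abs_of_pos hd)
  have h2 := key (-bdel q) (by rw [abs_neg, abs_of_pos hd])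
  rw [← abs_of_pos hd, ← abs_mul, abs_of_pos hd, abs_le]
  constructor <;> linarith

lemma bilinear (hp : 2 ≤ p) (hpq : 1 / p + 1 / q = 1) (φ γ : 𝓢(E3, ℂ))
    (i j : Option (Fin 3)) :
    bdel q * |∫ x, DO i (P (il φ) 0) x * DO j (P γ 0) x| ≤
      2 * ((∫ x, |P φ 0 x| ^ p) + ∫ x, |P γ 0 x| ^ q) := by
  obtain ⟨hq1, hq2, -⟩ := conj_facts hp hpq
  obtain ⟨M, -, h1, h2⟩ := P_bdd2 φ γ
  obtain ⟨C, hC0, hC⟩ := bQ_dom hp hpq M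
  have ip := abs_rpow_integrable (P φ 0) (by linarith : 1 ≤ p)
  have iq := abs_rpow_integrable (P γ 0) (by linarith : 1 ≤ q)
  have hlim : Filter.Tendsto (fun ε => ∫ x, (bQ p q (bdel q) ε (P φ 0 x) (P γ 0 x) -
      bQ p q (bdel q) ε 0 0)) (nhdsWithin 0 (Ioi 0))
      (nhds (∫ x, bQ p q (bdel q) 0 (P φ 0 x) (P γ 0 x))) := by
    refine tendsto_integral_filter_of_dominated_convergence
      (fun x => C * (P φ 0 x ^ 2 + |P γ 0 x| ^ q)) ?_ ?_ ?_ ?_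
    · filter_upwards [self_mem_nhdsWithin] with ε hε
      exact ((cont_bQ hε p q (bdel q) (P φ 0).continuous (P γ 0).continuous).sub
        continuous_const).aestronglyMeasurable
    · filter_upwards [Ioc_mem_nhdsGT (zero_lt_one : (0:ℝ) < 1)] with ε hε
      exact .of_forall fun x => hC ε hε.1 hε.2 _ _ (h1 0 x) (h2 0 x)
    · exact ((P_sq_integrable φ 0).add iq).const_mul C
    · exact .of_forall fun x => bQ_tendsto hp hpq _ _ _
  have h3 : bdel q * |∫ x, DO i (P (il φ) 0) x * DO j (P γ 0) x| ≤
      ∫ x, bQ p q (bdel q) 0 (P φ 0 x) (P γ 0 x) := by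
    refine ge_of_tendsto hlim ?_
    filter_upwards [self_mem_nhdsWithin] with ε hε
    exact bilinear_eps hp hpq hε φ γ i j
  refine h3.trans ?_
  rw [← integral_add ip iq, ← integral_const_mul]
  refine integral_mono_of_nonneg (.of_forall fun x => ?_) ((ip.add iq).const_mul 2)
    (.of_forall fun x => bQ_zero_le hp hpq _ _)
  have hd : 0 < bdel q := by rw [bdel]; have := sub_pos.2 hq1; positivity
  simp only [bQ, bS, bX, add_zero, Pi.zero_apply]
  positivity
end



def ofS : 𝓢(E3, ℝ) →L[ℝ] 𝓢(E3, ℂ) := SchwartzMap.postcompCLM Complex.ofRealCLM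

lemma ofS_apply (F : 𝓢(E3, ℝ)) (x : E3) : ofS F x = (F x : ℂ) := rfl

lemma lineDeriv_ofS (v : E3) (F : 𝓢(E3, ℝ)) : ∂_{v} (ofS F) = ofS (∂_{v} F) := by
  ext x
  rw [SchwartzMap.lineDerivOp_apply_eq_fderiv, ofS_apply, SchwartzMap.lineDerivOp_apply_eq_fderiv]
  have h1 : HasFDerivAt (fun y => Complex.ofRealCLM (F y)) (Complex.ofRealCLM ∘L fderiv ℝ F x) x :=
    Complex.ofRealCLM.hasFDerivAt.comp x (F.hasFDerivAt x)
  have : fderiv ℝ (ofS F) x = Complex.ofRealCLM ∘L fderiv ℝ F x := h1.fderiv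
  rw [this]; rfl

def fh (F : 𝓢(E3, ℝ)) : 𝓢(E3, ℂ) := 𝓕 (ofS F)

lemma P_fh (F : 𝓢(E3, ℝ)) : P (fh F) 0 = F := by
  rw [P_zero, fh, FourierTransform.fourierInv_fourier_eq]
  ext x; simp [reS_apply, ofS_apply]

lemma fh_deriv (v : E3) (F : 𝓢(E3, ℝ)) : fh (∂_{v} F) = dk v (fh F) := by
  rw [fh, ← lineDeriv_ofS, SchwartzMap.fourier_lineDerivOp_eq]; rfl

lemma fh_sub (F G : 𝓢(E3, ℝ)) : fh (F - G) = fh F - fh G := by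
  simp only [fh, map_sub]; rw [sub_eq_add_neg, FourierTransform.fourier_add, FourierTransform.fourier_neg, ← sub_eq_add_neg]
lemma fh_add (F G : 𝓢(E3, ℝ)) : fh (F + G) = fh F + fh G := by
  simp only [fh, map_add]; rw [FourierTransform.fourier_add]
lemma fh_neg (F : 𝓢(E3, ℝ)) : fh (-F) = - fh F := by
  simp only [fh, map_neg]; rw [FourierTransform.fourier_neg]

lemma fh_LL (F : 𝓢(E3, ℝ)) : fh (LL F) = lm (fh F) := by
  simp only [LL, lm, fh_sub, Fin.sum_univ_three, fh_add, fh_deriv]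

lemma il_neg (ψ : 𝓢(E3, ℂ)) : il (-ψ) = - il ψ := by simp only [il, map_neg]

/-- resolvent -/
def Rs (F : 𝓢(E3, ℝ)) : 𝓢(E3, ℝ) := P (il (fh F)) 0

lemma Rs_LL (F : 𝓢(E3, ℝ)) : Rs (LL F) = - F := by
  rw [Rs, fh_LL, il_lm, P_neg, P_fh]

lemma LL_Rs (F : 𝓢(E3, ℝ)) : LL (Rs F) = - F := by
  rw [Rs, LL_P, lm_il, P_neg, P_fh]

lemma LL_neg (F : 𝓢(E3, ℝ)) : LL (-F) = - LL F := by
  rw [← P_fh F, ← P_neg, LL_P, LL_P, ← P_neg]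
  congr 1
  ext ξ; simp [lm_apply]

lemma LL_smul (s : ℝ) (F : 𝓢(E3, ℝ)) : LL (s • F) = s • LL F := by
  ext x
  simp only [LL, LineDeriv.lineDerivOp_smul, Fin.sum_univ_three, sub_apply, add_apply, smul_apply]
  simp only [smul_eq_mul]; ring

lemma DO_smul (i : Option (Fin 3)) (s : ℝ) (F : 𝓢(E3, ℝ)) : DO i (s • F) = s • DO i F := by
  cases i with
  | none => rfl
  | some k => simp only [DO, LineDeriv.lineDerivOp_smul]

lemma lm_dO (i : Option (Fin 3)) (ψ : 𝓢(E3, ℂ)) : lm (dO i ψ) = dO i (lm ψ) := by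
  cases i with
  | none => simp only [dO]
  | some k => simp only [dO, lm_dk]

lemma LL_DO (i : Option (Fin 3)) (F : 𝓢(E3, ℝ)) : LL (DO i F) = DO i (LL F) := by
  rw [← P_fh F, ← P_dO, LL_P, lm_dO, P_dO, LL_P]

def Nr (r : ℝ) (F : 𝓢(E3, ℝ)) : ℝ := (∫ x, |F x| ^ r) ^ (1 / r)

lemma Nr_nonneg (r : ℝ) (F : 𝓢(E3, ℝ)) : 0 ≤ Nr r F :=
  Real.rpow_nonneg (integral_nonneg fun x => by positivity) _

lemma Nr_rpow {r : ℝ} (hr : 0 < r) (F : 𝓢(E3, ℝ)) : Nr r F ^ r = ∫ x, |F x| ^ r := by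
  rw [Nr, ← Real.rpow_mul (integral_nonneg fun x => by positivity), one_div_mul_cancel hr.ne', Real.rpow_one]

lemma int_smul {r : ℝ} (s : ℝ) (F : 𝓢(E3, ℝ)) :
    ∫ x, |(s • F) x| ^ r = |s| ^ r * ∫ x, |F x| ^ r := by
  rw [← integral_const_mul]
  congr 1; ext x
  rw [smul_apply, smul_eq_mul, abs_mul, Real.mul_rpow (abs_nonneg _) (abs_nonneg _)]

section
variable {p q : ℝ}

lemma bilinear1 (hp : 2 ≤ p) (hpq : 1 / p + 1 / q = 1) (u g : 𝓢(E3, ℝ))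
    (i j : Option (Fin 3)) :
    bdel q * |∫ x, DO i u x * DO j g x| ≤
      2 * ((∫ x, |LL u x| ^ p) + ∫ x, |g x| ^ q) := by
  have := bilinear hp hpq (fh (- LL u)) (fh g) i j
  rw [P_fh, P_fh, fh_neg, il_neg, fh_LL, il_lm, neg_neg, P_fh] at this
  simpa only [neg_apply, abs_neg] using this

lemma scaled {A : ℝ} (hA : 0 ≤ A) {r a : ℝ} (hr : 0 < r) (ha : A ≤ a) (ha0 : 0 < a) :
    |a⁻¹| ^ r * A ^ r ≤ 1 := by
  rw [abs_of_pos (by positivity), ← Real.mul_rpow (by positivity) hA]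
  refine Real.rpow_le_one (by positivity) ?_ hr.le
  rw [inv_mul_le_iff₀ ha0]; linarith

lemma bilinear2 (hp : 2 ≤ p) (hpq : 1 / p + 1 / q = 1) (u g : 𝓢(E3, ℝ))
    (i j : Option (Fin 3)) :
    |∫ x, DO i u x * DO j g x| ≤ 4 / bdel q * (Nr p (LL u) * Nr q g) := by
  obtain ⟨hq1, hq2, -⟩ := conj_facts hp hpq
  have hd : 0 < bdel q := by rw [bdel]; have := sub_pos.2 hq1; positivity
  set A := Nr p (LL u) with hA
  set B := Nr q g with hB
  have hA0 : 0 ≤ A := Nr_nonneg _ _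
  have hB0 : 0 ≤ B := Nr_nonneg _ _
  have key : ∀ η : ℝ, 0 < η → |∫ x, DO i u x * DO j g x| ≤ 4 / bdel q * ((A + η) * (B + η)) := by
    intro η hη
    have h := bilinear1 hp hpq ((A + η)⁻¹ • u) ((B + η)⁻¹ • g) i j
    rw [LL_smul, DO_smul, DO_smul, int_smul, int_smul, ← Nr_rpow (by linarith), ← Nr_rpow (by linarith)] at h
    have h1 := scaled hA0 (r := p) (by linarith) (by linarith : A ≤ A + η) (by linarith)
    have h2 := scaled hB0 (r := q) (by linarith) (by linarith : B ≤ B + η) (by linarith)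
    have e : ∫ x, ((A + η)⁻¹ • DO i u) x * ((B + η)⁻¹ • DO j g) x =
        ((A + η) * (B + η))⁻¹ * ∫ x, DO i u x * DO j g x := by
      rw [← integral_const_mul]
      congr 1; ext x
      simp only [smul_apply, smul_eq_mul, mul_inv]; ring
    have hpos : 0 < (A + η) * (B + η) := by positivity
    rw [e, abs_mul, abs_of_pos (inv_pos.2 hpos)] at h
    have h3 : bdel q * (((A + η) * (B + η))⁻¹ * |∫ x, DO i u x * DO j g x|) ≤ 4 := by linarith
    have h4 : bdel q * (((A + η) * (B + η))⁻¹ * |∫ x, DO i u x * DO j g x|) =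
      |∫ x, DO i u x * DO j g x| / (((A + η) * (B + η)) / bdel q) := by field_simp
    rw [h4, div_le_iff₀ (by positivity)] at h3
    refine h3.trans (le_of_eq ?_)
    ring
  have hlim : Filter.Tendsto (fun η : ℝ => 4 / bdel q * ((A + η) * (B + η))) (nhdsWithin 0 (Ioi 0))
      (nhds (4 / bdel q * ((A + 0) * (B + 0)))) := by
    refine Filter.Tendsto.mono_left (Continuous.tendsto ?_ 0) nhdsWithin_le_nhds
    fun_prop
  simp only [add_zero] at hlim
  refine ge_of_tendsto hlim ?_
  filter_upwards [self_mem_nhdsWithin] with η hη using key η hη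

lemma bilinear2' (hp : 2 ≤ p) (hpq : 1 / p + 1 / q = 1) (u g : 𝓢(E3, ℝ))
    (i j : Option (Fin 3)) :
    |∫ x, DO i u x * DO j g x| ≤ 4 / bdel q * (Nr q (LL u) * Nr p g) := by
  have h := bilinear2 hp hpq (- Rs g) (LL u) j i
  rw [LL_neg, LL_Rs, neg_neg] at h
  have e : ∫ x, DO j (-Rs g) x * DO i (LL u) x = ∫ x, DO i u x * DO j g x := by
    rw [← LL_DO, LL_symm, LL_DO, LL_neg, LL_Rs, neg_neg]
    congr 1; ext x; ring
  rw [e] at h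
  refine h.trans (le_of_eq (by ring))

lemma bilinear3 {r r' : ℝ} (h : r.HolderConjugate r') : ∃ C > 0, ∀ (u g : 𝓢(E3, ℝ))
    (i j : Option (Fin 3)), |∫ x, DO i u x * DO j g x| ≤ C * (Nr r (LL u) * Nr r' g) := by
  have h1 := h.lt
  have h2 := h.symm.lt
  have e : 1 / r + 1 / r' = 1 := by simpa using h.inv_add_inv_eq_one
  have e' : 1 / r' + 1 / r = 1 := by simpa using h.symm.inv_add_inv_eq_one
  rcases le_total 2 r with hr | hr
  · refine ⟨4 / bdel r', ?_, fun u g i j => bilinear2 hr e u g i j⟩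
    rw [bdel]; have := sub_pos.2 h2; positivity
  · have : 2 ≤ r' := by
      by_contra hc
      push Not at hc
      have a1 : 1 / 2 ≤ 1 / r := one_div_le_one_div_of_le (by linarith) hr
      have a2 : 1 / 2 < 1 / r' := one_div_lt_one_div_of_lt (by linarith) hc
      linarith
    refine ⟨4 / bdel r, ?_, fun u g i j => bilinear2' this e' u g i j⟩
    rw [bdel]; have := sub_pos.2 h1; positivity

lemma bilinear4 {r r' : ℝ} (h : r.HolderConjugate r') : ∃ C > 0, ∀ (u g : 𝓢(E3, ℝ))
    (i j : Option (Fin 3)), |∫ x, DO j (DO i u) x * g x| ≤ C * (Nr r (LL u) * Nr r' g) := by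
  obtain ⟨C, hC, H⟩ := bilinear3 h
  refine ⟨C, hC, fun u g i j => ?_⟩
  have := H u g i j
  cases j with
  | none => exact this
  | some k =>
    simp only [DO] at this ⊢
    rwa [SchwartzMap.integral_mul_lineDerivOp_right_eq_neg_left, abs_neg] at this

lemma eLpNorm_eq_Nr {r : ℝ} (hr : 0 < r) (F : 𝓢(E3, ℝ)) :
    eLpNorm F (ENNReal.ofReal r) volume = ENNReal.ofReal (Nr r F) := by
  rw [(F.memLp (ENNReal.ofReal r) (μ := volume)).eLpNorm_eq_integral_rpow_norm (by simpa using hr) ENNReal.ofReal_ne_top]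
  simp only [ENNReal.toReal_ofReal hr.le, Nr, one_div, Real.norm_eq_abs]

lemma dual {r r' : ℝ} (h : r.HolderConjugate r') (w : 𝓢(E3, ℝ)) {K : ℝ} (hK : 0 ≤ K)
    (H : ∀ g : 𝓢(E3, ℝ), |∫ x, w x * g x| ≤ K * Nr r' g) : Nr r w ≤ K := by
  have hr := h.lt
  have hr' := h.symm.lt
  have hc : ENNReal.HolderConjugate (ENNReal.ofReal r) (ENNReal.ofReal r') := h.ennrealOfReal
  have f1 : Fact (1 ≤ ENNReal.ofReal r') := ⟨by rw [ENNReal.one_le_ofReal]; exact hr'.le⟩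
  have f2 : Fact (1 ≤ ENNReal.ofReal r) := ⟨by rw [ENNReal.one_le_ofReal]; exact hr.le⟩
  let B := (ContinuousLinearMap.mul ℝ ℝ).lpPairing (volume : Measure E3) (ENNReal.ofReal r) (ENNReal.ofReal r')
    (w.toLp (ENNReal.ofReal r) volume)
  have hB : ∀ G : Lp ℝ (ENNReal.ofReal r') (volume : Measure E3), B G = ∫ x, w x * G x := by
    intro G
    simp only [B, ContinuousLinearMap.lpPairing_eq_integral, ContinuousLinearMap.mul_apply']
    refine integral_congr_ae ?_
    filter_upwards [w.coeFn_toLp (ENNReal.ofReal r) volume] with x hx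
    rw [hx]
  have key : ∀ G : Lp ℝ (ENNReal.ofReal r') (volume : Measure E3), |B G| ≤ K * ‖G‖ := by
    intro G
    refine DenseRange.induction_on (SchwartzMap.denseRange_toLpCLM (F := ℝ) (E := E3) (p := ENNReal.ofReal r')
      ENNReal.ofReal_ne_top (μ := volume)) G ?_ ?_
    · exact isClosed_le (by fun_prop) (by fun_prop)
    · intro g
      have e1 : B (SchwartzMap.toLpCLM ℝ ℝ (ENNReal.ofReal r') volume g) = ∫ x, w x * g x := by
        rw [hB]
        refine integral_congr_ae ?_
        filter_upwards [g.coeFn_toLp (ENNReal.ofReal r') volume] with x hx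
        rw [SchwartzMap.toLpCLM_apply, hx]
      have e2 : ‖SchwartzMap.toLpCLM ℝ ℝ (ENNReal.ofReal r') volume g‖ = Nr r' g := by
        rw [SchwartzMap.toLpCLM_apply, Lp.norm_def, eLpNorm_congr_ae (g.coeFn_toLp (ENNReal.ofReal r') volume),
          eLpNorm_eq_Nr (by linarith), ENNReal.toReal_ofReal (Nr_nonneg _ _)]
      rw [e1, e2]; exact H g
  -- test function
  set gt : E3 → ℝ := fun x => |w x| ^ (r - 2) * w x with hgt
  have habs : ∀ x, |gt x| ^ r' = |w x| ^ r := by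
    intro x
    rw [hgt]
    simp only [abs_mul, abs_of_nonneg (Real.rpow_nonneg (abs_nonneg (w x)) (r - 2))]
    rcases eq_or_ne (w x) 0 with h0 | h0
    · simp [h0, Real.zero_rpow (by linarith : r ≠ 0), Real.zero_rpow (by linarith : r' ≠ 0)]
    · have hp : 0 < |w x| := abs_pos.2 h0
      have : |w x| ^ (r - 2) * |w x| = |w x| ^ (r - 1) := by
        rw [← Real.rpow_add_one hp.ne']; congr 1; ring
      rw [this, ← Real.rpow_mul hp.le, h.sub_one_mul_conj]
  have hmul : ∀ x, w x * gt x = |w x| ^ r := by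
    intro x
    rw [hgt]
    rcases eq_or_ne (w x) 0 with h0 | h0
    · simp [h0, Real.zero_rpow (by linarith : r ≠ 0)]
    · have hp : 0 < |w x| := abs_pos.2 h0
      calc w x * (|w x| ^ (r - 2) * w x) = |w x| ^ (r - 2) * |w x| ^ 2 := by rw [sq_abs]; ring
        _ = |w x| ^ (r - 2) * |w x| ^ (2:ℝ) := by norm_cast
        _ = |w x| ^ r := by rw [← Real.rpow_add hp]; congr 1; ring
  have hmeas : AEStronglyMeasurable gt volume := by
    have := w.continuous.measurable
    exact Measurable.aestronglyMeasurable (by fun_prop)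
  have hInt := abs_rpow_integrable w hr.le
  have hmem : MemLp gt (ENNReal.ofReal r') volume := by
    rw [← integrable_norm_rpow_iff hmeas (by simp; linarith) ENNReal.ofReal_ne_top, ENNReal.toReal_ofReal (by linarith)]
    simp only [Real.norm_eq_abs, habs]
    exact hInt
  have hk := key (hmem.toLp gt)
  have e1 : B (hmem.toLp gt) = ∫ x, |w x| ^ r := by
    rw [hB]
    refine integral_congr_ae ?_
    filter_upwards [hmem.coeFn_toLp] with x hx
    rw [hx, hmul]
  have e2 : ‖hmem.toLp gt‖ = (∫ x, |w x| ^ r) ^ (1 / r') := by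
    rw [Lp.norm_toLp, hmem.eLpNorm_eq_integral_rpow_norm (by simp; linarith) ENNReal.ofReal_ne_top,
      ENNReal.toReal_ofReal (by positivity), ENNReal.toReal_ofReal (by linarith)]
    simp only [Real.norm_eq_abs, habs, one_div]
  have hS : 0 ≤ ∫ x, |w x| ^ r := integral_nonneg fun x => by positivity
  rw [e1, e2, abs_of_nonneg hS] at hk
  rcases hS.eq_or_lt with h0 | h0
  · rw [Nr, ← h0, Real.zero_rpow (by positivity)]; exact hK
  · have : (∫ x, |w x| ^ r) ^ (1 / r) * (∫ x, |w x| ^ r) ^ (1 / r') ≤ K * (∫ x, |w x| ^ r) ^ (1 / r') := by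
      rw [← Real.rpow_add h0]
      have e : 1 / r + 1 / r' = 1 := by simpa using h.inv_add_inv_eq_one
      rwa [e, Real.rpow_one]
    exact le_of_mul_le_mul_right this (Real.rpow_pos_of_pos h0 _)

/-- the unweighted estimate -/
lemma unweighted {r : ℝ} (hr : 1 < r) : ∃ C > 0, ∀ (u : 𝓢(E3, ℝ)) (i j : Option (Fin 3)),
    Nr r (DO j (DO i u)) ≤ C * Nr r (LL u) := by
  obtain ⟨C, hC, H⟩ := bilinear4 (Real.HolderConjugate.conjExponent hr)
  refine ⟨C, hC, fun u i j => dual (Real.HolderConjugate.conjExponent hr) _ 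
    (mul_nonneg hC.le (Nr_nonneg _ _)) fun g => ?_⟩
  rw [mul_assoc]; exact H u g i j
end



lemma Nr_le_sum {r : ℝ} (hr : 1 ≤ r) {ι : Type} (s : Finset ι) (F : 𝓢(E3, ℝ)) (c : ι → ℝ) (hc : ∀ i ∈ s, 0 ≤ c i)
    (G : ι → 𝓢(E3, ℝ)) (h : ∀ x, |F x| ≤ ∑ i ∈ s, c i * |G i x|) :
    Nr r F ≤ ∑ i ∈ s, c i * Nr r (G i) := by
  have h0 : 0 ≤ ∑ i ∈ s, c i * Nr r (G i) :=
    Finset.sum_nonneg fun i hi => mul_nonneg (hc i hi) (Nr_nonneg _ _)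
  rw [← ENNReal.ofReal_le_ofReal_iff h0, ← eLpNorm_eq_Nr (by linarith)]
  have h1 : eLpNorm F (ENNReal.ofReal r) volume ≤
      eLpNorm (∑ i ∈ s, fun x => c i * |G i x|) (ENNReal.ofReal r) volume := by
    refine eLpNorm_mono fun x => ?_
    rw [Finset.sum_apply, Real.norm_eq_abs, Real.norm_eq_abs]
    exact (h x).trans (le_abs_self _)
  refine h1.trans ((eLpNorm_sum_le (fun i _ => ?_) (by simpa using hr)).trans ?_)
  · have := (G i).continuous
    exact Continuous.aestronglyMeasurable (by fun_prop)
  · rw [ENNReal.ofReal_sum_of_nonneg fun i hi => mul_nonneg (hc i hi) (Nr_nonneg _ _)]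
    refine Finset.sum_le_sum fun i hi => ?_
    rw [ENNReal.ofReal_mul (hc i hi), ← eLpNorm_eq_Nr (by linarith)]
    have : (fun x => c i * |G i x|) = c i • fun x => ‖G i x‖ := by ext x; simp
    rw [this, eLpNorm_const_smul, eLpNorm_norm, Real.enorm_of_nonneg (hc i hi)]

section
variable (β ε : ℝ)

def bb (v : E3) : ℝ := 1 + ε ^ 2 * ‖v‖ ^ 2
def rho (v : E3) : ℝ := bb ε v ^ (β / 2)
def mI (i : Fin 3) (v : E3) : ℝ := β * ε ^ 2 * v i / bb ε v
def nI (j i : Fin 3) (v : E3) : ℝ :=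
  β * ε ^ 2 * ((if j = i then 1 else 0) / bb ε v - 2 * ε ^ 2 * v i * v j / bb ε v ^ 2)

lemma bb_pos (v : E3) : 0 < bb ε v := by unfold bb; positivity
lemma rho_pos (v : E3) : 0 < rho β ε v := Real.rpow_pos_of_pos (bb_pos ε v) _

lemma rho_tg : Function.HasTemperateGrowth (rho β ε) := by
  have h1 : Function.HasTemperateGrowth (fun v : E3 => ε • v) := by fun_prop
  have := (Function.hasTemperateGrowth_one_add_norm_sq_rpow E3 (β / 2)).comp h1
  refine (congrArg Function.HasTemperateGrowth ?_).mp this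
  ext v
  simp [rho, bb, norm_smul, mul_pow]

lemma bb_deriv (k : Fin 3) (v : E3) :
    HasDerivAt (fun t : ℝ => bb ε (v + t • ee k)) (2 * ε ^ 2 * v k) 0 := by
  have e : (fun t : ℝ => bb ε (v + t • ee k)) = fun t => 1 + ε ^ 2 * (‖v‖ ^ 2 + 2 * (t * v k) + t ^ 2) := by
    ext t
    rw [bb, norm_add_sq_real, inner_smul_right, inner_ee, norm_smul, mul_pow]
    simp
  rw [e]
  have := ((((((hasDerivAt_id (0:ℝ)).mul_const (v k)).const_mul 2).const_add (‖v‖ ^ 2)).add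
    ((hasDerivAt_id (0:ℝ)).pow 2)).const_mul (ε ^ 2)).const_add 1
  refine this.congr_deriv ?_
  simp; ring

lemma rho_deriv (k : Fin 3) (v : E3) :
    HasDerivAt (fun t : ℝ => rho β ε (v + t • ee k)) (rho β ε v * mI β ε k v) 0 := by
  have hb : bb ε (v + (0:ℝ) • ee k) = bb ε v := by simp
  have hp := bb_pos ε v
  have := (bb_deriv ε k v).rpow_const (p := β / 2) (Or.inl (by rw [hb]; exact hp.ne'))
  rw [hb] at this
  unfold rho
  convert this using 1
  rw [Real.rpow_sub_one hp.ne', mI]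
  field_simp

lemma mI_deriv (j i : Fin 3) (v : E3) :
    HasDerivAt (fun t : ℝ => mI β ε i (v + t • ee j)) (nI β ε j i v) 0 := by
  have hb : bb ε (v + (0:ℝ) • ee j) = bb ε v := by simp
  have hp := bb_pos ε v
  have h1 : HasDerivAt (fun t : ℝ => β * ε ^ 2 * (v + t • ee j) i) (β * ε ^ 2 * (if j = i then 1 else 0)) 0 := by
    have e : (fun t : ℝ => β * ε ^ 2 * (v + t • ee j) i) = fun t =>
        β * ε ^ 2 * (v i + t * (if j = i then 1 else 0)) := by
      ext t
      by_cases h : j = i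
      · subst h; simp
      · simp [h, Ne.symm h]
    rw [e]
    simpa using (((hasDerivAt_id (0:ℝ)).mul_const (if j = i then (1:ℝ) else 0)).const_add (v i)).const_mul (β * ε ^ 2)
  have := h1.div (bb_deriv ε j v) (by rw [hb]; exact hp.ne')
  rw [hb] at this
  unfold mI
  refine this.congr_deriv ?_
  rw [nI]
  simp only [zero_smul, add_zero]
  field_simp

lemma eps_le (hε : 0 ≤ ε) (i : Fin 3) (v : E3) : ε * |v i| ≤ bb ε v := by
  have h1 : |v i| ≤ ‖v‖ := by simpa using PiLp.norm_apply_le v i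
  have : ε * |v i| ≤ ε * ‖v‖ := by gcongr
  unfold bb
  nlinarith [sq_nonneg (ε * ‖v‖ - 1), sq_nonneg (ε * ‖v‖)]

lemma eps_le2 (i j : Fin 3) (v : E3) : ε ^ 2 * (|v i| * |v j|) ≤ bb ε v := by
  have h1 : |v i| ≤ ‖v‖ := by simpa using PiLp.norm_apply_le v i
  have h2 : |v j| ≤ ‖v‖ := by simpa using PiLp.norm_apply_le v j
  have : |v i| * |v j| ≤ ‖v‖ * ‖v‖ := by gcongr
  unfold bb
  nlinarith [sq_nonneg ε]

lemma bb_ge (v : E3) : 1 ≤ bb ε v := by unfold bb; nlinarith [mul_nonneg (sq_nonneg ε) (sq_nonneg ‖v‖)]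

lemma mI_le (hε : 0 ≤ ε) (i : Fin 3) (v : E3) : |mI β ε i v| ≤ |β| * ε := by
  have hp := bb_pos ε v
  rw [mI, abs_div, abs_of_pos hp, div_le_iff₀ hp, abs_mul, abs_mul, abs_of_nonneg (sq_nonneg ε)]
  have := eps_le ε hε i v
  calc |β| * ε ^ 2 * |v i| = |β| * ε * (ε * |v i|) := by ring
    _ ≤ _ := by gcongr

lemma nI_le (j i : Fin 3) (v : E3) : |nI β ε j i v| ≤ 3 * |β| * ε ^ 2 := by
  have hp := bb_pos ε v
  have h1 := bb_ge ε v
  have h2 := eps_le2 ε i j v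
  rw [nI, abs_mul, abs_mul, abs_of_nonneg (sq_nonneg ε)]
  have h3 : |(if j = i then (1:ℝ) else 0) / bb ε v - 2 * ε ^ 2 * v i * v j / bb ε v ^ 2| ≤ 3 := by
    refine (abs_sub _ _).trans ?_
    have a1 : |(if j = i then (1:ℝ) else 0) / bb ε v| ≤ 1 := by
      rw [abs_div, abs_of_pos hp, div_le_one hp]
      split_ifs <;> simp <;> linarith
    have a2 : |2 * ε ^ 2 * v i * v j / bb ε v ^ 2| ≤ 2 := by
      rw [abs_div, abs_of_pos (by positivity : 0 < bb ε v ^ 2), div_le_iff₀ (by positivity), abs_mul, abs_mul, abs_mul,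
        abs_of_nonneg (sq_nonneg ε), abs_two]
      nlinarith
    linarith
  calc _ ≤ |β| * ε ^ 2 * 3 := by gcongr
    _ = _ := by ring

def MM (F : 𝓢(E3, ℝ)) : 𝓢(E3, ℝ) := SchwartzMap.smulLeftCLM ℝ (rho β ε) F

lemma MM_apply (F : 𝓢(E3, ℝ)) (x : E3) : MM β ε F x = rho β ε x * F x := by
  rw [MM, SchwartzMap.smulLeftCLM_apply_apply (rho_tg β ε), smul_eq_mul]

lemma MM_d1 (u : 𝓢(E3, ℝ)) (k : Fin 3) (x : E3) :
    MM β ε (∂_{ee k} u) x = ∂_{ee k} (MM β ε u) x - mI β ε k x * MM β ε u x := by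
  have h1 := schwartz_lineDeriv (MM β ε u) (ee k) x
  have h2 := (rho_deriv β ε k x).mul (schwartz_lineDeriv u (ee k) x)
  have e : (fun t : ℝ => rho β ε (x + t • ee k)) * (fun t : ℝ => u (x + t • ee k)) =
    fun t : ℝ => MM β ε u (x + t • ee k) := by
    ext t; simp only [Pi.mul_apply, MM_apply]
  rw [e] at h2
  have := h1.unique h2
  rw [this]
  simp only [MM_apply, zero_smul, add_zero]
  ring

lemma MM_d2 (u : 𝓢(E3, ℝ)) (j i : Fin 3) (x : E3) :
    MM β ε (∂_{ee j} (∂_{ee i} u)) x = ∂_{ee j} (∂_{ee i} (MM β ε u)) x - nI β ε j i x * MM β ε u x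
      - mI β ε i x * ∂_{ee j} (MM β ε u) x - mI β ε j x * ∂_{ee i} (MM β ε u) x
      + mI β ε j x * mI β ε i x * MM β ε u x := by
  rw [MM_d1]
  have h1 := schwartz_lineDeriv (MM β ε (∂_{ee i} u)) (ee j) x
  have h2 := (schwartz_lineDeriv (∂_{ee i} (MM β ε u)) (ee j) x).sub
    ((mI_deriv β ε j i x).mul (schwartz_lineDeriv (MM β ε u) (ee j) x))
  have e : (fun t : ℝ => (∂_{ee i} (MM β ε u)) (x + t • ee j)) - (fun t : ℝ => mI β ε i (x + t • ee j)) *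
      (fun t : ℝ => MM β ε u (x + t • ee j)) =
    fun t : ℝ => MM β ε (∂_{ee i} u) (x + t • ee j) := by
    ext t; simp only [Pi.mul_apply, Pi.sub_apply, MM_d1]
  rw [e] at h2
  have := h1.unique h2
  rw [this, MM_d1]
  simp only [zero_smul, add_zero]
  ring

lemma LL_MM (u : 𝓢(E3, ℝ)) (x : E3) :
    LL (MM β ε u) x = MM β ε (LL u) x + ∑ k, (2 * mI β ε k x * ∂_{ee k} (MM β ε u) x +
      (nI β ε k k x - mI β ε k x * mI β ε k x) * MM β ε u x) := by
  have h := fun k => MM_d2 β ε u k k x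
  rw [LL_apply, MM_apply β ε (LL u), LL_apply]
  simp only [MM_apply β ε (∂_{_} _)] at h
  have h' : ∀ k, ∂_{ee k} (∂_{ee k} (MM β ε u)) x = rho β ε x * ∂_{ee k} (∂_{ee k} u) x +
     (2 * mI β ε k x * ∂_{ee k} (MM β ε u) x +
      (nI β ε k k x - mI β ε k x * mI β ε k x) * MM β ε u x) := by
    intro k; rw [h k]; ring
  simp only [h', Finset.sum_add_distrib, mul_sub, Finset.mul_sum]
  rw [MM_apply]
  ring
end

lemma weighted {r : ℝ} (hr : 1 < r) (β : ℝ) : ∃ C > 0, ∃ ε > 0, ε ≤ 1 ∧ ∀ u : 𝓢(E3, ℝ),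
    (∀ i, Nr r (MM β ε (∂_{ee i} u)) ≤ C * Nr r (MM β ε (LL u))) ∧
    (∀ j i, Nr r (MM β ε (∂_{ee j} (∂_{ee i} u))) ≤ C * Nr r (MM β ε (LL u))) := by
  obtain ⟨C0, hC0, H⟩ := unweighted hr
  set K := 3 * |β| + |β| ^ 2 with hK
  have hK0 : 0 ≤ K := by positivity
  set ε := 1 / (1 + 18 * K * C0) with hε
  have hε0 : 0 < ε := by positivity
  have hε1 : ε ≤ 1 := by
    rw [hε, div_le_one (by positivity)]
    have : 0 ≤ 18 * K * C0 := by positivity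
    linarith
  have hm : ∀ i v, |mI β ε i v| ≤ K * ε := fun i v => (mI_le β ε hε0.le i v).trans (by
    gcongr; nlinarith [abs_nonneg β])
  have hn : ∀ j i v, |nI β ε j i v - mI β ε j v * mI β ε i v| ≤ K * ε := by
    intro j i v
    refine (abs_sub _ _).trans ?_
    rw [abs_mul]
    have a1 := nI_le β ε j i v
    have a2 := mI_le β ε hε0.le i v
    have a3 := mI_le β ε hε0.le j v
    have a4 : |mI β ε j v| * |mI β ε i v| ≤ (|β| * ε) * (|β| * ε) := by gcongr
    have a5 : ε ^ 2 ≤ ε := by nlinarith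
    calc _ ≤ 3 * |β| * ε ^ 2 + |β| * ε * (|β| * ε) := add_le_add a1 a4
      _ = K * ε ^ 2 := by rw [hK]; ring
      _ ≤ K * ε := by gcongr
  refine ⟨2 * (C0 * (1 + 3 * K)), by positivity, ε, hε0, hε1, fun u => ?_⟩
  set w := MM β ε u with hw
  set U := Nr r (LL w) with hU
  have hU0 : 0 ≤ U := Nr_nonneg _ _
  have w0 : Nr r w ≤ C0 * U := H w none none
  have w1 : ∀ k, Nr r (∂_{ee k} w) ≤ C0 * U := fun k => H w (some k) none
  have w2 : ∀ j i, Nr r (∂_{ee j} (∂_{ee i} w)) ≤ C0 * U := fun j i => H w (some i) (some j)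
  have hUle : U ≤ Nr r (MM β ε (LL u)) + 9 * (K * ε) * (C0 * U) := by
    have := Nr_le_sum hr.le (Finset.univ : Finset (Option (Option (Fin 3)))) (LL w)
      (fun o => match o with | none => 1 | some none => 3 * (K * ε) | some (some k) => 2 * (K * ε))
      (fun o _ => by rcases o with _ | _ | k <;> positivity)
      (fun o => match o with | none => MM β ε (LL u) | some none => w | some (some k) => ∂_{ee k} w)
      (fun x => by
        simp only [Fintype.sum_option]
        rw [hw, LL_MM]
        refine (abs_add_le _ _).trans ?_
        rw [one_mul]
        gcongr
        refine (Finset.abs_sum_le_sum_abs _ _).trans ?_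
        have : ∀ k, |2 * mI β ε k x * ∂_{ee k} (MM β ε u) x +
          (nI β ε k k x - mI β ε k x * mI β ε k x) * MM β ε u x| ≤
          K * ε * |MM β ε u x| + 2 * (K * ε) * |∂_{ee k} (MM β ε u) x| := by
          intro k
          refine (abs_add_le _ _).trans ?_
          rw [abs_mul, abs_mul, abs_mul, abs_two, add_comm]
          gcongr
          · exact hn k k x
          · exact hm k x
        refine (Finset.sum_le_sum fun k _ => this k).trans (le_of_eq ?_)
        rw [Finset.sum_add_distrib]
        simp; ring)
    simp only [Fintype.sum_option, one_mul] at this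
    refine this.trans ?_
    have b1 : ∑ k, 2 * (K * ε) * Nr r (∂_{ee k} w) ≤ ∑ k : Fin 3, 2 * (K * ε) * (C0 * U) := by
      gcongr with k; exact w1 k
    simp only [Finset.sum_const, Finset.card_univ, Fintype.card_fin, nsmul_eq_mul] at b1
    have b2 : 3 * (K * ε) * Nr r w ≤ 3 * (K * ε) * (C0 * U) := by gcongr
    push_cast at b1
    linarith
  have hsm : 9 * (K * ε) * C0 ≤ 1 / 2 := by
    rw [hε, mul_one_div, mul_div_assoc', div_mul_eq_mul_div, div_le_iff₀ (by positivity)]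
    linarith
  have hU2 : U ≤ 2 * Nr r (MM β ε (LL u)) := by nlinarith
  have hKε : K * ε ≤ K := by nlinarith
  constructor
  · intro i
    have := Nr_le_sum hr.le (Finset.univ : Finset Bool) (MM β ε (∂_{ee i} u))
      (fun o => bif o then 1 else K) (fun o _ => by cases o <;> simp [hK0])
      (fun o => bif o then ∂_{ee i} w else w)
      (fun x => by
        rw [MM_d1]
        refine (abs_sub _ _).trans ?_
        simp only [Fintype.sum_bool, cond_true, cond_false, one_mul, abs_mul]
        gcongr
        exact (hm i x).trans hKε)
    simp only [Fintype.sum_bool, cond_true, cond_false, one_mul] at this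
    have a1 := w1 i
    have a2 : K * Nr r w ≤ K * (C0 * U) := by gcongr
    have a3 : 0 ≤ K * (C0 * U) := by positivity
    have a4 : C0 * (1 + 3 * K) * U ≤ C0 * (1 + 3 * K) * (2 * Nr r (MM β ε (LL u))) := by gcongr
    linarith
  · intro j i
    have := Nr_le_sum hr.le (Finset.univ : Finset (Fin 4)) (MM β ε (∂_{ee j} (∂_{ee i} u)))
      ![1, K, K, K] (fun o _ => by fin_cases o <;> simp [hK0])
      ![∂_{ee j} (∂_{ee i} w), w, ∂_{ee j} w, ∂_{ee i} w]
      (fun x => by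
        rw [MM_d2]
        simp only [Fin.sum_univ_four, Matrix.cons_val, one_mul]
        have e : ∂_{ee j} (∂_{ee i} w) x - nI β ε j i x * w x - mI β ε i x * ∂_{ee j} w x
          - mI β ε j x * ∂_{ee i} w x + mI β ε j x * mI β ε i x * w x =
          ∂_{ee j} (∂_{ee i} w) x + (-(nI β ε j i x - mI β ε j x * mI β ε i x)) * w x +
          (- mI β ε i x) * ∂_{ee j} w x + (- mI β ε j x) * ∂_{ee i} w x := by ring
        rw [← hw, e]
        refine (abs_add_le _ _).trans (add_le_add ((abs_add_le _ _).trans (add_le_add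
          ((abs_add_le _ _).trans (add_le_add le_rfl ?_)) ?_)) ?_) <;> rw [abs_mul, abs_neg] <;> gcongr
        · exact (hn j i x).trans hKε
        · exact (hm i x).trans hKε
        · exact (hm j x).trans hKε)
    simp only [Fin.sum_univ_four, Matrix.cons_val, one_mul] at this
    have a1 := w2 j i
    have a2 : K * Nr r w ≤ K * (C0 * U) := by gcongr
    have a3 : K * Nr r (∂_{ee j} w) ≤ K * (C0 * U) := by gcongr; exact w1 j
    have a5 : K * Nr r (∂_{ee i} w) ≤ K * (C0 * U) := by gcongr; exact w1 i
    have a4 : C0 * (1 + 3 * K) * U ≤ C0 * (1 + 3 * K) * (2 * Nr r (MM β ε (LL u))) := by gcongr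
    linarith

lemma jap_rho (β : ℝ) {ε : ℝ} (hε : 0 < ε) (hε1 : ε ≤ 1) : ∃ c > 0, ∀ v : E3,
    jap v ^ β ≤ c * rho β ε v ∧ rho β ε v ≤ c * jap v ^ β := by
  have hj : ∀ v : E3, jap v ^ β = (1 + ‖v‖ ^ 2) ^ (β / 2) := by
    intro v
    rw [jap, Real.sqrt_eq_rpow, ← Real.rpow_mul (by positivity)]
    congr 1; ring
  have h1 : ∀ v : E3, ε ^ 2 * (1 + ‖v‖ ^ 2) ≤ bb ε v := by
    intro v; unfold bb; nlinarith [sq_nonneg ‖v‖]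
  have h2 : ∀ v : E3, bb ε v ≤ 1 + ‖v‖ ^ 2 := by
    intro v; unfold bb
    have : ε ^ 2 ≤ 1 := by nlinarith
    nlinarith [sq_nonneg ‖v‖]
  have he : 0 < ε ^ 2 := by positivity
  rcases le_total 0 β with hβ | hβ
  · have hc : 1 ≤ (ε ^ 2) ^ (-(β / 2)) := Real.one_le_rpow_of_pos_of_le_one_of_nonpos he (by nlinarith) (by linarith)
    refine ⟨(ε ^ 2) ^ (-(β / 2)), by positivity, fun v => ?_⟩
    rw [hj]
    constructor
    · rw [Real.rpow_neg he.le, ← div_eq_inv_mul, le_div_iff₀ (by positivity), mul_comm,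
        ← Real.mul_rpow he.le (by positivity)]
      exact Real.rpow_le_rpow (by positivity) (h1 v) (by linarith)
    · refine (Real.rpow_le_rpow (bb_pos ε v).le (h2 v) (by linarith : 0 ≤ β / 2)).trans ?_
      exact le_mul_of_one_le_left (by positivity) hc
  · have hc : 1 ≤ (ε ^ 2) ^ (β / 2) := Real.one_le_rpow_of_pos_of_le_one_of_nonpos he (by nlinarith) (by linarith)
    refine ⟨(ε ^ 2) ^ (β / 2), by positivity, fun v => ?_⟩
    rw [hj]
    constructor
    · refine (Real.rpow_le_rpow_of_nonpos (bb_pos ε v) (h2 v) (by linarith : β / 2 ≤ 0)).trans ?_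
      exact le_mul_of_one_le_left (rho_pos β ε v).le hc
    · rw [← Real.mul_rpow he.le (by positivity)]
      exact Real.rpow_le_rpow_of_nonpos (by positivity) (h1 v) (by linarith)

lemma final_est {r : ℝ} (hr : 1 < r) (β : ℝ) : ∃ C > 0, ∀ u : 𝓢(E3, ℝ),
    (∀ i, eLpNorm (fun v => jap v ^ β * ∂_{ee i} u v) (ENNReal.ofReal r) volume ≤
      ENNReal.ofReal C * eLpNorm (fun v => jap v ^ β * LL u v) (ENNReal.ofReal r) volume) ∧
    (∀ j i, eLpNorm (fun v => jap v ^ β * ∂_{ee j} (∂_{ee i} u) v) (ENNReal.ofReal r) volume ≤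
      ENNReal.ofReal C * eLpNorm (fun v => jap v ^ β * LL u v) (ENNReal.ofReal r) volume) := by
  obtain ⟨C, hC, ε, hε, hε1, H⟩ := weighted hr β
  obtain ⟨c, hc, hjr⟩ := jap_rho β hε hε1
  refine ⟨c * (C * c), by positivity, fun u => ?_⟩
  have jp : ∀ v : E3, 0 ≤ jap v ^ β := fun v => Real.rpow_nonneg (Real.sqrt_nonneg _) _
  have A : ∀ F : 𝓢(E3, ℝ), eLpNorm (fun v => jap v ^ β * F v) (ENNReal.ofReal r) volume ≤
      ENNReal.ofReal c * ENNReal.ofReal (Nr r (MM β ε F)) := by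
    intro F
    rw [← eLpNorm_eq_Nr (by linarith)]
    refine eLpNorm_le_mul_eLpNorm_of_ae_le_mul (.of_forall fun v => ?_) _
    rw [MM_apply, norm_mul, norm_mul, Real.norm_of_nonneg (jp v), Real.norm_of_nonneg (rho_pos β ε v).le, ← mul_assoc]
    gcongr
    exact (hjr v).1
  have B : ENNReal.ofReal (Nr r (MM β ε (LL u))) ≤
      ENNReal.ofReal c * eLpNorm (fun v => jap v ^ β * LL u v) (ENNReal.ofReal r) volume := by
    rw [← eLpNorm_eq_Nr (by linarith)]
    refine eLpNorm_le_mul_eLpNorm_of_ae_le_mul (.of_forall fun v => ?_) _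
    rw [MM_apply, norm_mul, norm_mul, Real.norm_of_nonneg (jp v), Real.norm_of_nonneg (rho_pos β ε v).le, ← mul_assoc]
    gcongr
    exact (hjr v).2
  have key : ∀ F : 𝓢(E3, ℝ), Nr r (MM β ε F) ≤ C * Nr r (MM β ε (LL u)) →
      eLpNorm (fun v => jap v ^ β * F v) (ENNReal.ofReal r) volume ≤
      ENNReal.ofReal (c * (C * c)) * eLpNorm (fun v => jap v ^ β * LL u v) (ENNReal.ofReal r) volume := by
    intro F hF
    calc _ ≤ ENNReal.ofReal c * ENNReal.ofReal (Nr r (MM β ε F)) := A F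
      _ ≤ ENNReal.ofReal c * (ENNReal.ofReal C * ENNReal.ofReal (Nr r (MM β ε (LL u)))) := by
        rw [← ENNReal.ofReal_mul hC.le]; gcongr
      _ ≤ ENNReal.ofReal c * (ENNReal.ofReal C * (ENNReal.ofReal c * eLpNorm (fun v => jap v ^ β * LL u v) (ENNReal.ofReal r) volume)) := by
        gcongr
      _ = _ := by rw [ENNReal.ofReal_mul hc.le, ENNReal.ofReal_mul hC.le]; ring
  exact ⟨fun i => key _ ((H u).1 i), fun j i => key _ ((H u).2 j i)⟩



/-- primitive of the gaussian -/
def Ph (s : ℝ) : ℝ := ∫ x in (0:ℝ)..s, Real.exp (-x ^ 2)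

lemma Ph_deriv (s : ℝ) : HasDerivAt Ph (Real.exp (-s ^ 2)) s := by
  have hc : Continuous fun x : ℝ => Real.exp (-x ^ 2) := by fun_prop
  exact intervalIntegral.integral_hasDerivAt_right (hc.intervalIntegrable _ _)
    hc.aestronglyMeasurable.stronglyMeasurableAtFilter hc.continuousAt

lemma Ph_neg (s : ℝ) : Ph (-s) = - Ph s := by
  have := intervalIntegral.integral_comp_neg (a := 0) (b := s) (fun x : ℝ => Real.exp (-x ^ 2))
  simp only [neg_zero, even_two, Even.neg_pow] at this
  rw [Ph, Ph, this, intervalIntegral.integral_symm]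

lemma Ph_top : Filter.Tendsto Ph Filter.atTop (nhds (√Real.pi / 2)) := by
  have h := integral_gaussian_Ioi 1
  simp only [div_one, neg_mul, one_mul] at h
  rw [← h]
  refine intervalIntegral_tendsto_integral_Ioi 0 ?_ Filter.tendsto_id
  have := integrable_exp_neg_mul_sq (b := 1) one_pos
  simp only [neg_mul, one_mul] at this
  exact this.integrableOn

lemma Ph_bot : Filter.Tendsto Ph Filter.atBot (nhds (-(√Real.pi / 2))) := by
  have := (Ph_top.comp Filter.tendsto_neg_atBot_atTop).neg
  refine this.congr fun s => ?_
  simp [Ph_neg]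

def oneF (a t : ℝ) : ℝ := if t = 0 then -(2 / a) * (Real.exp (-a) * (√Real.pi / 2) + Real.exp a * (√Real.pi / 2)) else
  -(2 / a) * (Real.exp (-a) * Ph (a / (2 * √t) - √t) + Real.exp a * Ph (a / (2 * √t) + √t))

lemma one_dim {a : ℝ} (ha : 0 < a) :
    ∫ t in Ioi (0:ℝ), 1 / (t * √t) * Real.exp (-t - a ^ 2 / (4 * t)) = 2 * √Real.pi / a * Real.exp (-a) := by
  have hs0 : Filter.Tendsto (fun t : ℝ => √t) (nhdsWithin 0 (Ioi 0)) (nhdsWithin 0 (Ioi 0)) := by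
    refine tendsto_nhdsWithin_iff.2 ⟨?_, ?_⟩
    · have := Real.continuous_sqrt.tendsto 0
      rw [Real.sqrt_zero] at this
      exact this.mono_left nhdsWithin_le_nhds
    · filter_upwards [self_mem_nhdsWithin] with t ht using Real.sqrt_pos.2 ht
  have hq0 : Filter.Tendsto (fun t : ℝ => a / (2 * √t)) (nhdsWithin 0 (Ioi 0)) Filter.atTop := by
    have := (tendsto_inv_nhdsGT_zero.comp hs0).const_mul_atTop (by positivity : 0 < a / 2)
    refine this.congr fun t => ?_
    simp only [Function.comp_apply]
    rw [← div_eq_mul_inv, div_div]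
  have hs00 : Filter.Tendsto (fun t : ℝ => √t) (nhdsWithin 0 (Ioi 0)) (nhds 0) := hs0.mono_right nhdsWithin_le_nhds
  have hcont : ContinuousWithinAt (oneF a) (Ici 0) 0 := by
    rw [← Ioi_insert, continuousWithinAt_insert_self, ContinuousWithinAt]
    have e : oneF a 0 = -(2 / a) * (Real.exp (-a) * (√Real.pi / 2) + Real.exp a * (√Real.pi / 2)) := by simp [oneF]
    rw [e]
    have l1 := Ph_top.comp (hq0.atTop_add hs00.neg)
    have l2 := Ph_top.comp (hq0.atTop_add hs00)
    refine (((l1.const_mul (Real.exp (-a))).add (l2.const_mul (Real.exp a))).const_mul (-(2 / a))).congr' ?_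
    filter_upwards [self_mem_nhdsWithin] with t ht
    simp only [oneF, Function.comp_apply, if_neg (ne_of_gt ht : t ≠ 0), ← sub_eq_add_neg]
  have htop : Filter.Tendsto (oneF a) Filter.atTop (nhds (-(2 / a) * (Real.exp (-a) * (-(√Real.pi / 2)) + Real.exp a * (√Real.pi / 2)))) := by
    have hq : Filter.Tendsto (fun t : ℝ => a / (2 * √t)) Filter.atTop (nhds 0) := 
      Filter.Tendsto.const_div_atTop (Real.tendsto_sqrt_atTop.const_mul_atTop two_pos) a
    have l1 := Ph_bot.comp (hq.add_atBot (Filter.tendsto_neg_atTop_atBot.comp Real.tendsto_sqrt_atTop))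
    have l2 := Ph_top.comp (hq.add_atTop Real.tendsto_sqrt_atTop)
    refine (((l1.const_mul (Real.exp (-a))).add (l2.const_mul (Real.exp a))).const_mul (-(2 / a))).congr' ?_
    filter_upwards [Filter.eventually_gt_atTop 0] with t ht
    simp only [oneF, Function.comp_apply, if_neg (ne_of_gt ht : t ≠ 0), ← sub_eq_add_neg]
  rw [integral_Ioi_of_hasDerivAt_of_nonneg hcont (fun t ht => ?_) (fun t ht => ?_) htop]
  · simp only [oneF, if_true]
    ring
  · have ht0 : 0 < t := ht
    have hst : 0 < √t := Real.sqrt_pos.2 ht0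
    have hsq : √t ^ 2 = t := Real.sq_sqrt ht0.le
    have ds := Real.hasDerivAt_sqrt ht0.ne'
    have dq : HasDerivAt (fun t : ℝ => a / (2 * √t)) (-(a / (4 * (t * √t)))) t := by
      have := (hasDerivAt_const t a).div (ds.const_mul 2) (by positivity)
      refine this.congr_deriv ?_
      field_simp
      rw [hsq]; ring
    have d1 := ((Ph_deriv _).comp t (dq.sub ds)).const_mul (Real.exp (-a))
    have d2 := ((Ph_deriv _).comp t (dq.add ds)).const_mul (Real.exp a)
    have d := (d1.add d2).const_mul (-(2 / a))
    have h4 : (a / (2 * √t)) ^ 2 = a ^ 2 / (4 * t) := by rw [div_pow, mul_pow, hsq]; norm_num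
    have h5 : a / (2 * √t) * √t = a / 2 := by field_simp
    have e1 : Real.exp (-(a / (2 * √t) - √t) ^ 2) = Real.exp a * Real.exp (-t - a ^ 2 / (4 * t)) := by
      rw [← Real.exp_add]; congr 1
      linear_combination -h4 + 2 * h5 - hsq
    have e2 : Real.exp (-(a / (2 * √t) + √t) ^ 2) = Real.exp (-a) * Real.exp (-t - a ^ 2 / (4 * t)) := by
      rw [← Real.exp_add]; congr 1
      linear_combination -h4 - 2 * h5 - hsq
    have e3 : Real.exp (-a) * Real.exp a = 1 := by rw [← Real.exp_add]; simp
    have d' := d.congr_of_eventuallyEq (f₁ := oneF a) (by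
      filter_upwards [lt_mem_nhds ht0] with s hs
      simp [oneF, if_neg hs.ne'])
    refine d'.congr_deriv ?_
    simp only [Pi.sub_apply, Pi.add_apply, e1, e2]
    have : -(2 / a) * (Real.exp (-a) * (Real.exp a * Real.exp (-t - a ^ 2 / (4 * t)) * (-(a / (4 * (t * √t))) - 1 / (2 * √t))) +
       Real.exp a * (Real.exp (-a) * Real.exp (-t - a ^ 2 / (4 * t)) * (-(a / (4 * (t * √t))) + 1 / (2 * √t)))) =
       -(2 / a) * ((Real.exp (-a) * Real.exp a) * (Real.exp (-t - a ^ 2 / (4 * t)) * (- (a / (2 * (t * √t)))))) := by ring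
    rw [this, e3]
    field_simp
  · have ht0 : 0 < t := ht
    positivity

/-- heat kernel with damping -/
def kern (t : ℝ) (y : E3) : ℝ :=
  Real.exp (-t) * ((Real.pi / ((2 * Real.pi) ^ 2 * t)) ^ (3 / 2 : ℝ) * Real.exp (-Real.pi ^ 2 * ‖y‖ ^ 2 / ((2 * Real.pi) ^ 2 * t)))

lemma kern_eq {t : ℝ} (ht : 0 < t) (y : E3) :
    kern t y = 1 / (8 * Real.pi * √Real.pi) * (1 / (t * √t) * Real.exp (-t - ‖y‖ ^ 2 / (4 * t))) := by
  have hpi := Real.pi_pos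
  have e1 : Real.pi / ((2 * Real.pi) ^ 2 * t) = (4 * Real.pi * t)⁻¹ := by field_simp; norm_num
  have e2 : (4 * Real.pi * t) ^ (3 / 2 : ℝ) = 8 * Real.pi * √Real.pi * (t * √t) := by
    have h1 : (3 / 2 : ℝ) = 1 + 1 / 2 := by norm_num
    rw [h1, Real.rpow_add (by positivity), Real.rpow_one, ← Real.sqrt_eq_rpow, Real.sqrt_mul (by positivity),
      Real.sqrt_mul (by positivity)]
    have : √4 = 2 := by rw [show (4:ℝ) = 2 ^ 2 by norm_num, Real.sqrt_sq (by norm_num)]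
    rw [this]; ring
  have e3 : -Real.pi ^ 2 * ‖y‖ ^ 2 / ((2 * Real.pi) ^ 2 * t) = - (‖y‖ ^ 2 / (4 * t)) := by field_simp; norm_num
  rw [kern, e1, Real.inv_rpow (by positivity), e2, e3, sub_eq_add_neg, Real.exp_add]
  field_simp

lemma kern_int {y : E3} (hy : y ≠ 0) :
    ∫ t in Ioi (0:ℝ), kern t y = 1 / (4 * Real.pi) * (Real.exp (-‖y‖) / ‖y‖) := by
  have hpi := Real.pi_pos
  rw [setIntegral_congr_fun measurableSet_Ioi (fun t ht => kern_eq ht y), integral_const_mul,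
    one_dim (norm_pos_iff.2 hy)]
  have := norm_pos_iff.2 hy
  have := Real.sqrt_pos.2 hpi
  field_simp
  norm_num

lemma heat (f : 𝓢(E3, ℝ)) {t : ℝ} (ht : 0 < t) (x : E3) :
    P (fh f) t x = ∫ z, kern t (x - z) * f z := by
  have hpi := Real.pi_pos
  set b : ℝ := (2 * Real.pi) ^ 2 * t with hb
  have hb0 : 0 < b := by positivity
  have J : Integrable (fun w : E3 ↦ Complex.exp (- (b:ℂ) * ‖w‖ ^ 2 + 2 * Real.pi * Complex.I * (inner ℝ x w : ℝ))) :=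
      GaussianFourier.integrable_cexp_neg_mul_sq_norm_add (by simpa) _ _
  have hflip : ∫ w : E3, Complex.exp (- (b:ℂ) * ‖w‖ ^ 2 + 2 * Real.pi * Complex.I * (inner ℝ x w : ℝ)) • (𝓕 (ofS f : E3 → ℂ)) w =
      ∫ w : E3, 𝓕 (fun w : E3 ↦ Complex.exp (- (b:ℂ) * ‖w‖ ^ 2 + 2 * Real.pi * Complex.I * (inner ℝ x w : ℝ))) w • ofS f w := by
    simpa using! (VectorFourier.integral_fourierIntegral_smul_eq_flip (L := innerₗ E3)
      Real.continuous_fourierChar continuous_inner J (ofS f).integrable).symm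
  have e : ∀ ξ : E3, Real.fourierChar (inner ℝ ξ x) • (hk t ξ • fh f ξ) =
      (Real.exp (-t) : ℂ) * (Complex.exp (- (b:ℂ) * ‖ξ‖ ^ 2 + 2 * Real.pi * Complex.I * (inner ℝ x ξ : ℝ)) • (𝓕 (ofS f : E3 → ℂ)) ξ) := by
    intro ξ
    rw [Circle.smul_def, Real.fourierChar_apply, fh, SchwartzMap.fourier_coe, hk, lam, max_eq_left ht.le]
    simp only [smul_eq_mul, Complex.real_smul, ← mul_assoc]
    congr 1
    rw [Complex.ofReal_exp, Complex.ofReal_exp, ← Complex.exp_add, ← Complex.exp_add, real_inner_comm]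
    congr 1
    rw [hb]; push_cast; ring
  have e2 : ∀ w : E3, 𝓕 (fun w : E3 ↦ Complex.exp (- (b:ℂ) * ‖w‖ ^ 2 + 2 * Real.pi * Complex.I * (inner ℝ x w : ℝ))) w • ofS f w =
    (((Real.pi / b) ^ (3 / 2 : ℝ) * Real.exp (-Real.pi ^ 2 * ‖x - w‖ ^ 2 / b) * f w : ℝ) : ℂ) := by
    intro w
    rw [fourier_gaussian_innerProductSpace' (by simpa), ofS_apply, smul_eq_mul]
    simp only [Complex.ofReal_mul, finrank_euclideanSpace, Fintype.card_fin]
    rw [Complex.ofReal_cpow (by positivity)]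
    push_cast
    rfl
  rw [P_formula]
  simp only [e]
  rw [integral_const_mul, hflip]
  simp only [e2]
  rw [integral_complex_ofReal, ← Complex.ofReal_mul, Complex.ofReal_re, ← integral_const_mul]
  congr 1; ext z
  simp only [kern]; ring

lemma P_decay (ψ : 𝓢(E3, ℂ)) {t : ℝ} (ht : 0 ≤ t) (x : E3) : |P ψ t x| ≤ Real.exp (-t) * ∫ ξ, ‖ψ ξ‖ := by
  rw [P_formula, ← integral_const_mul]
  refine (Complex.abs_re_le_norm _).trans ?_
  refine (norm_integral_le_integral_norm _).trans ?_
  refine integral_mono_of_nonneg (.of_forall fun _ => norm_nonneg _) (ψ.integrable.norm.const_mul _)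
    (.of_forall fun ξ => ?_)
  simp only
  rw [Circle.norm_smul, norm_smul, Real.norm_of_nonneg (hk_pos _ _).le]
  gcongr
  exact hk_le ht ξ

lemma P_neg_lm (ψ : 𝓢(E3, ℂ)) (t : ℝ) (x : E3) : P (lm (il ψ)) t x = - P ψ t x := by
  rw [lm_il, P_neg]; rfl

lemma Rs_int (f : 𝓢(E3, ℝ)) (x : E3) : Rs f x = ∫ t in Ioi (0:ℝ), P (fh f) t x := by
  have hexp : IntegrableOn (fun t : ℝ => Real.exp (-t) * ∫ ξ, ‖fh f ξ‖) (Ioi 0) :=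
    (integrableOn_exp_neg_Ioi 0).mul_const _
  have hInt : IntegrableOn (fun t => - P (fh f) t x) (Ioi 0) := by
    refine Integrable.mono' hexp (P_cont_t (fh f) x).neg.aestronglyMeasurable ?_
    rw [ae_restrict_iff' measurableSet_Ioi]
    refine .of_forall fun t ht => ?_
    rw [norm_neg]
    exact P_decay _ (le_of_lt ht) x
  have hlim : Filter.Tendsto (fun t => P (il (fh f)) t x) Filter.atTop (nhds 0) := by
    have h0 : Filter.Tendsto (fun t : ℝ => Real.exp (-t) * ∫ ξ, ‖il (fh f) ξ‖) Filter.atTop (nhds 0) := by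
      simpa using Real.tendsto_exp_neg_atTop_nhds_zero.mul_const (∫ ξ, ‖il (fh f) ξ‖)
    refine squeeze_zero_norm' ?_ h0
    filter_upwards [Filter.eventually_ge_atTop 0] with t ht
    exact P_decay _ ht x
  have := integral_Ioi_of_hasDerivAt_of_tendsto (a := 0) (f := fun t => P (il (fh f)) t x)
    (f' := fun t => - P (fh f) t x) (P_cont_t _ x).continuousWithinAt
    (fun t ht => by
      have := P_hasDerivAt (il (fh f)) ht x
      rwa [P_neg_lm] at this) hInt hlim
  rw [integral_neg] at this
  rw [Rs]; linarith

lemma kern_nonneg {t : ℝ} (ht : 0 < t) (y : E3) : 0 ≤ kern t y := by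
  have := Real.pi_pos
  unfold kern; positivity

lemma kern_mass {t : ℝ} (ht : 0 < t) (x : E3) : Integrable (fun z => kern t (x - z)) ∧
    ∫ z, kern t (x - z) = Real.exp (-t) := by
  have hpi := Real.pi_pos
  have hb : 0 < Real.pi ^ 2 / ((2 * Real.pi) ^ 2 * t) := by positivity
  have h1 := GaussianFourier.integral_rexp_neg_mul_sq_norm (V := E3) hb
  have hI : Integrable fun y : E3 => Real.exp (-(Real.pi ^ 2 / ((2 * Real.pi) ^ 2 * t)) * ‖y‖ ^ 2) := by
    by_contra hc
    rw [integral_undef hc] at h1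
    have : 0 < (Real.pi / (Real.pi ^ 2 / ((2 * Real.pi) ^ 2 * t))) ^ ((Module.finrank ℝ E3 : ℝ) / 2) := by positivity
    linarith
  have ek : ∀ y : E3, kern t y = Real.exp (-t) * (Real.pi / ((2 * Real.pi) ^ 2 * t)) ^ (3 / 2 : ℝ) *
      Real.exp (-(Real.pi ^ 2 / ((2 * Real.pi) ^ 2 * t)) * ‖y‖ ^ 2) := by
    intro y
    rw [kern, mul_assoc]
    congr 3; ring
  have hk : Integrable (kern t) := by
    have := hI.const_mul (Real.exp (-t) * (Real.pi / ((2 * Real.pi) ^ 2 * t)) ^ (3 / 2 : ℝ))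
    exact this.congr (.of_forall fun y => (ek y).symm)
  refine ⟨hk.comp_sub_left x, ?_⟩
  rw [integral_sub_left_eq_self (kern t)]
  simp only [ek]
  rw [integral_const_mul, h1, mul_assoc, finrank_euclideanSpace, Fintype.card_fin, Nat.cast_ofNat,
    ← Real.mul_rpow (by positivity) (by positivity)]
  have : Real.pi / ((2 * Real.pi) ^ 2 * t) * (Real.pi / (Real.pi ^ 2 / ((2 * Real.pi) ^ 2 * t))) = 1 := by field_simp
  rw [this, Real.one_rpow, mul_one]

lemma kern_meas (x : E3) : Measurable fun z : ℝ × E3 => kern z.1 (x - z.2) := by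
  unfold kern; fun_prop

lemma kern_prod (f : 𝓢(E3, ℝ)) (x : E3) :
    Integrable (Function.uncurry fun (t : ℝ) (z : E3) => kern t (x - z) * f z) ((volume.restrict (Ioi 0)).prod volume) := by
  obtain ⟨M, hM0, hM⟩ := schwartz_bdd f
  have hfm : Measurable f := f.continuous.measurable
  have hm : Measurable (Function.uncurry fun (t : ℝ) (z : E3) => kern t (x - z) * f z) :=
    (kern_meas x).mul (hfm.comp measurable_snd)
  have hi : ∀ t : ℝ, 0 < t → Integrable fun z => kern t (x - z) * f z := fun t ht =>
    (kern_mass ht x).1.mul_bdd (c := M) f.continuous.aestronglyMeasurable (.of_forall fun z => hM z)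
  rw [integrable_prod_iff hm.aestronglyMeasurable]
  constructor
  · rw [ae_restrict_iff' measurableSet_Ioi]
    exact .of_forall fun t ht => hi t ht
  · have hm2 := (hm.norm.stronglyMeasurable).integral_prod_right' (ν := (volume : Measure E3))
    refine Integrable.mono' ((integrableOn_exp_neg_Ioi 0).const_mul M) hm2.aestronglyMeasurable ?_
    rw [ae_restrict_iff' measurableSet_Ioi]
    refine .of_forall fun t ht => ?_
    rw [Real.norm_of_nonneg (integral_nonneg fun _ => norm_nonneg _), ← (kern_mass ht x).2, ← integral_const_mul]
    refine integral_mono (hi t ht).norm ((kern_mass ht x).1.const_mul M) fun z => ?_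
    simp only [Function.uncurry, norm_mul, Real.norm_of_nonneg (kern_nonneg ht _), Real.norm_eq_abs]
    rw [mul_comm]
    exact mul_le_mul_of_nonneg_right (hM z) (kern_nonneg ht _)

lemma bessel_eq (f : 𝓢(E3, ℝ)) : besselM f = Rs f := by
  ext x
  rw [Rs_int, setIntegral_congr_fun measurableSet_Ioi (fun t ht => heat f ht x),
    integral_integral_swap (kern_prod f x), besselM, ← integral_const_mul]
  refine integral_congr_ae ?_
  have : ∀ᵐ z : E3, z ≠ x := by
    rw [ae_iff]; simp
  filter_upwards [this] with z hz
  rw [integral_mul_const, kern_int (sub_ne_zero.2 hz.symm)]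
  ring

lemma pd_schwartz (i : Fin 3) (F : 𝓢(E3, ℝ)) : pd i F = ∂_{ee i} F := by
  ext x
  rw [pd, SchwartzMap.lineDerivOp_apply_eq_fderiv]

theorem main_est (p β : ℝ) (hp : 1 < p) (l : List (Fin 3))
    (hl : l.length = 1 ∨ l.length = 2) :
    ∃ C > 0, ∀ f : SchwartzMap (EuclideanSpace ℝ (Fin 3)) ℝ,
      eLpNorm (fun v => jap v ^ β * pdMany l (besselM ⇑f) v) (ENNReal.ofReal p) volume ≤
        ENNReal.ofReal C * eLpNorm (fun v => jap v ^ β * f v) (ENNReal.ofReal p) volume := by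
  obtain ⟨C, hC, H⟩ := final_est hp β
  refine ⟨C, hC, fun f => ?_⟩
  have h := H (Rs f)
  have e : eLpNorm (fun v => jap v ^ β * LL (Rs f) v) (ENNReal.ofReal p) volume =
      eLpNorm (fun v => jap v ^ β * f v) (ENNReal.ofReal p) volume := by
    rw [← eLpNorm_neg]
    congr 1; ext v
    simp [LL_Rs, neg_apply]
  rw [e] at h
  rw [bessel_eq]
  rcases hl with hl | hl
  · obtain ⟨i, rfl⟩ := List.length_eq_one_iff.1 hl
    simp only [pdMany, pd_schwartz]
    exact h.1 i
  · obtain ⟨j, i, rfl⟩ := List.length_eq_two.1 hl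
    simp only [pdMany, pd_schwartz]
    exact h.2 j i


end Aux

/-- Lemma 2.1(f), inequality (2.2): weighted `L^p` bounds for first and second derivatives
of the Bessel potential, `‖⟨·⟩^β ∂^α(𝓜f)‖_{L^p} ≤ C ‖⟨·⟩^β f‖_{L^p}`, `|α| = 1, 2`. -/
theorem bessel_weighted_derivative_bound (p β : ℝ) (hp : 1 < p) (l : List (Fin 3))
    (hl : l.length = 1 ∨ l.length = 2) :
    ∃ C > 0, ∀ f : SchwartzMap (EuclideanSpace ℝ (Fin 3)) ℝ,
      eLpNorm (fun v => jap v ^ β * pdMany l (besselM ⇑f) v) (ENNReal.ofReal p) volume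
        ≤ ENNReal.ofReal C *
            eLpNorm (fun v => jap v ^ β * f v) (ENNReal.ofReal p) volume := by
  exact main_est p β hp l hl
end
end

section
/- Pointwise bound on gradients of the Landau coefficients (Lemma 2.2(B)(a)): for every k ∈ ℝ there exist constants C_k > 0 and C > 0 (with C independent of k) such that for every Schwartz function h on ℝ³ and every v ∈ ℝ³: ⟨v⟩² ( |∇_v A[h](v)| + |∇_v a[h](v)| ) ≤ C_k ⟨v⟩^{−1−k} ∫_{|v−v₁| ≤ ⟨v⟩/2} ( ⟨v₁⟩^{3+k} |h(v₁)| / |v−v₁|² ) dv₁ + C ‖h‖_{L¹(ℝ³)}, where |∇_v A[h](v)| denotes any fixed norm of the array of first partial derivatives of the matrix entries of A[h] at v. -/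
open MeasureTheory Set
open scoped ENNReal

noncomputable section

lemma radial_integrable :
    Integrable (fun w : (EuclideanSpace ℝ (Fin 3)) => ((1 + ‖w‖) ^ 4)⁻¹ / ‖w‖ ^ 2) volume := by
  have h := (integrable_fun_norm_addHaar (volume : Measure (EuclideanSpace ℝ (Fin 3)))
    (f := fun r : ℝ => ((1 + r) ^ 4)⁻¹ / r ^ 2))
  refine h.2 ?_
  have h2 : IntegrableOn (fun x : ℝ => (x + 1) ^ (-4 : ℝ)) (Ioi 0) :=
    integrableOn_add_rpow_Ioi_of_lt (by norm_num) (by norm_num)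
  refine h2.congr_fun ?_ measurableSet_Ioi
  intro x hx
  have hx : 0 < x := hx
  have : ((x + 1) ^ (-4 : ℝ) : ℝ) = ((1 + x) ^ 4)⁻¹ := by
    rw [Real.rpow_neg (by positivity), add_comm]
    norm_cast
  simp only [this, finrank_euclideanSpace, Fintype.card_fin, smul_eq_mul]
  field_simp

lemma schwartz_bound (h : SchwartzMap (EuclideanSpace ℝ (Fin 3)) ℝ) :
    ∃ D, 0 ≤ D ∧ ∀ x, |h x| ≤ D * ((1 + ‖x‖) ^ 4)⁻¹ := by
  refine ⟨2 ^ 4 * ((Finset.Iic ((4, 0) : ℕ × ℕ)).sup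
    (fun m => SchwartzMap.seminorm ℝ m.1 m.2)) h, by positivity, fun x => ?_⟩
  have := SchwartzMap.one_add_le_sup_seminorm_apply (𝕜 := ℝ) (m := (4, 0)) (k := 4) (n := 0)
    le_rfl le_rfl h x
  rw [norm_iteratedFDeriv_zero, Real.norm_eq_abs] at this
  rw [← div_eq_mul_inv, le_div_iff₀ (by positivity), mul_comm]
  exact this

/-- local uniform bound -/
lemma schwartz_bound_loc (h : SchwartzMap (EuclideanSpace ℝ (Fin 3)) ℝ) (v : (EuclideanSpace ℝ (Fin 3))) :
    ∃ D, 0 ≤ D ∧ ∀ u, ‖u - v‖ < 1 → ∀ w, |h (u - w)| ≤ D * ((1 + ‖w‖) ^ 4)⁻¹ := by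
  obtain ⟨D, hD, hb⟩ := schwartz_bound h
  refine ⟨D * (2 + ‖v‖) ^ 4, by positivity, fun u hu w => (hb _).trans ?_⟩
  rw [mul_assoc]
  gcongr
  rw [← div_eq_mul_inv, le_div_iff₀ (by positivity), inv_mul_le_iff₀ (by positivity), ← mul_pow]
  gcongr
  have h1 : ‖u‖ ≤ ‖v‖ + 1 := by
    have := norm_le_norm_add_norm_sub v u
    rw [norm_sub_rev] at this
    linarith
  have h2 : ‖w‖ ≤ ‖u‖ + ‖u - w‖ := norm_le_norm_add_norm_sub u w
  nlinarith [norm_nonneg v, norm_nonneg (u - w)]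

def FF (h : SchwartzMap (EuclideanSpace ℝ (Fin 3)) ℝ) (v : (EuclideanSpace ℝ (Fin 3))) : ℝ := ∫ z, |h z| / ‖v - z‖ ^ 2

lemma FF_eq (h : SchwartzMap (EuclideanSpace ℝ (Fin 3)) ℝ) (v : (EuclideanSpace ℝ (Fin 3))) :
    FF h v = ∫ w, |h (v - w)| / ‖w‖ ^ 2 := by
  rw [FF, ← integral_sub_left_eq_self _ volume v]
  simp

lemma meas_shift (h : SchwartzMap (EuclideanSpace ℝ (Fin 3)) ℝ) (u : (EuclideanSpace ℝ (Fin 3))) :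
    AEStronglyMeasurable (fun w => |h (u - w)| / ‖w‖ ^ 2) volume := by
  have : Continuous h := h.continuous
  have h1 : Measurable (fun w => |h (u - w)|) := by
    have : Continuous (fun w => |h (u - w)|) := by fun_prop
    exact this.measurable
  exact (h1.div (by fun_prop)).aestronglyMeasurable

lemma bound_shift (h : SchwartzMap (EuclideanSpace ℝ (Fin 3)) ℝ) (v : (EuclideanSpace ℝ (Fin 3))) :
    ∃ D, 0 ≤ D ∧ ∀ u, ‖u - v‖ < 1 → ∀ w, ‖|h (u - w)| / ‖w‖ ^ 2‖ ≤
      D * (((1 + ‖w‖) ^ 4)⁻¹ / ‖w‖ ^ 2) := by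
  obtain ⟨D, hD, hb⟩ := schwartz_bound_loc h v
  refine ⟨D, hD, fun u hu w => ?_⟩
  rw [Real.norm_of_nonneg (by positivity), ← mul_div_assoc]
  gcongr
  exact hb u hu w

lemma FF_integrable (h : SchwartzMap (EuclideanSpace ℝ (Fin 3)) ℝ) (v : (EuclideanSpace ℝ (Fin 3))) :
    Integrable (fun z => |h z| / ‖v - z‖ ^ 2) volume := by
  obtain ⟨D, hD, hb⟩ := bound_shift h v
  have : Integrable (fun w => |h (v - w)| / ‖w‖ ^ 2) volume :=
    Integrable.mono' (radial_integrable.const_mul D) (meas_shift h v)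
      (Filter.Eventually.of_forall (hb v (by simp)))
  simpa using this.comp_sub_left v

lemma FF_continuousAt (h : SchwartzMap (EuclideanSpace ℝ (Fin 3)) ℝ) (v : (EuclideanSpace ℝ (Fin 3))) : ContinuousAt (FF h) v := by
  have : FF h = fun u => ∫ w, |h (u - w)| / ‖w‖ ^ 2 := funext (FF_eq h)
  rw [this]
  obtain ⟨D, hD, hb⟩ := bound_shift h v
  have hc : Continuous h := h.continuous
  refine continuousAt_of_dominated (Filter.Eventually.of_forall (meas_shift h)) ?_
    (radial_integrable.const_mul D) (Filter.Eventually.of_forall fun w => ?_)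
  · filter_upwards [Metric.ball_mem_nhds v one_pos] with u hu
    rw [mem_ball_iff_norm] at hu
    exact Filter.Eventually.of_forall (hb u hu)
  · have : Continuous (fun x => |h (x - w)| / ‖w‖ ^ 2) := by fun_prop
    exact this.continuousAt

lemma kernel_integrable (h : SchwartzMap (EuclideanSpace ℝ (Fin 3)) ℝ) (K : (EuclideanSpace ℝ (Fin 3)) → ℝ) (hK : Measurable K)
    (hb : ∀ w, |K w| ≤ 1 / ‖w‖) (v : (EuclideanSpace ℝ (Fin 3))) :
    Integrable (fun z => K (v - z) * h z) volume := by
  have hc : Continuous h := h.continuous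
  have hi : Integrable (fun z => |h z|) volume := h.integrable.abs
  refine Integrable.mono' (hi.add (FF_integrable h v)) ?_
    (Filter.Eventually.of_forall fun z => ?_)
  · exact ((hK.comp (by fun_prop)).mul hc.measurable).aestronglyMeasurable
  · simp only [Pi.add_apply, norm_mul, Real.norm_eq_abs]
    have h1 : 1 / ‖v - z‖ ≤ 1 + 1 / ‖v - z‖ ^ 2 := by
      have : 1 / ‖v - z‖ ^ 2 = (1 / ‖v - z‖) ^ 2 := by simp
      rw [this]
      nlinarith [sq_nonneg (1 / ‖v - z‖ - 1), sq_nonneg (1 / ‖v - z‖)]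
    calc |K (v - z)| * |h z| ≤ (1 + 1 / ‖v - z‖ ^ 2) * |h z| := by
          gcongr; exact (hb _).trans h1
      _ = _ := by ring

lemma kernel_diff (h : SchwartzMap (EuclideanSpace ℝ (Fin 3)) ℝ) (K : (EuclideanSpace ℝ (Fin 3)) → ℝ) (hK : Measurable K)
    (hb : ∀ w, |K w| ≤ 1 / ‖w‖)
    (hd : ∀ x y, x ≠ 0 → y ≠ 0 → |K x - K y| ≤ ‖x - y‖ / (‖x‖ * ‖y‖)) (u v : (EuclideanSpace ℝ (Fin 3))) :
    |(∫ z, K (u - z) * h z) - ∫ z, K (v - z) * h z| ≤ ‖u - v‖ * ((FF h u + FF h v) / 2) := by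
  rw [← integral_sub (kernel_integrable h K hK hb u) (kernel_integrable h K hK hb v)]
  rw [← Real.norm_eq_abs]
  have hi := (((FF_integrable h u).add (FF_integrable h v)).div_const 2).const_mul ‖u - v‖
  refine (norm_integral_le_of_norm_le hi ?_).trans_eq ?_
  · have e1 : ∀ᵐ z : (EuclideanSpace ℝ (Fin 3)), z ≠ u := by simp [ae_iff]
    have e2 : ∀ᵐ z : (EuclideanSpace ℝ (Fin 3)), z ≠ v := by simp [ae_iff]
    filter_upwards [e1, e2] with z h1 h2
    have h1 : u - z ≠ 0 := sub_ne_zero.2 h1.symm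
    have h2 : v - z ≠ 0 := sub_ne_zero.2 h2.symm
    have := hd _ _ h1 h2
    rw [← sub_mul, norm_mul, Real.norm_eq_abs, Real.norm_eq_abs]
    rw [sub_sub_sub_cancel_right] at this
    have h3 : 1 / (‖u - z‖ * ‖v - z‖) ≤ (1 / ‖u - z‖ ^ 2 + 1 / ‖v - z‖ ^ 2) / 2 := by
      have e1 : 1 / ‖u - z‖ ^ 2 = (1 / ‖u - z‖) ^ 2 := by simp
      have e2 : 1 / ‖v - z‖ ^ 2 = (1 / ‖v - z‖) ^ 2 := by simp
      rw [e1, e2, ← one_div_mul_one_div]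
      nlinarith [sq_nonneg (1 / ‖u - z‖ - 1 / ‖v - z‖)]
    calc |K (u - z) - K (v - z)| * |h z|
        ≤ (‖u - v‖ * (1 / (‖u - z‖ * ‖v - z‖))) * |h z| := by
          gcongr; rwa [mul_one_div]
      _ ≤ (‖u - v‖ * ((1 / ‖u - z‖ ^ 2 + 1 / ‖v - z‖ ^ 2) / 2)) * |h z| := by gcongr
      _ = _ := by simp only [Pi.add_apply]; ring
  · rw [integral_const_mul, integral_div]
    simp only [Pi.add_apply]
    rw [integral_add (FF_integrable h u) (FF_integrable h v)]
    rfl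

lemma FF_nonneg (h : SchwartzMap (EuclideanSpace ℝ (Fin 3)) ℝ) (v : (EuclideanSpace ℝ (Fin 3))) : 0 ≤ FF h v :=
  integral_nonneg fun z => by positivity

lemma pd_bound (h : SchwartzMap (EuclideanSpace ℝ (Fin 3)) ℝ) (K : (EuclideanSpace ℝ (Fin 3)) → ℝ) (hK : Measurable K)
    (hb : ∀ w, |K w| ≤ 1 / ‖w‖)
    (hd : ∀ x y, x ≠ 0 → y ≠ 0 → |K x - K y| ≤ ‖x - y‖ / (‖x‖ * ‖y‖)) (v : (EuclideanSpace ℝ (Fin 3))) (m : Fin 3) :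
    |pd m (fun u => ∫ z, K (u - z) * h z) v| ≤ FF h v := by
  unfold pd
  by_cases hdiff : DifferentiableAt ℝ (fun u => ∫ z, K (u - z) * h z) v
  · have ht := (hdiff.hasFDerivAt.hasLineDerivAt (EuclideanSpace.single m 1)).tendsto_slope_zero
    have ht := ht.abs
    have hF : Filter.Tendsto (fun t : ℝ => (FF h (v + t • EuclideanSpace.single m 1) + FF h v) / 2)
        (nhdsWithin 0 {0}ᶜ) (nhds ((FF h v + FF h v) / 2)) := by
      have h0 : Filter.Tendsto (fun t : ℝ => v + t • (EuclideanSpace.single m 1 : (EuclideanSpace ℝ (Fin 3))))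
          (nhdsWithin 0 {0}ᶜ) (nhds v) := by
        have : Continuous (fun t : ℝ => v + t • (EuclideanSpace.single m 1 : (EuclideanSpace ℝ (Fin 3)))) := by fun_prop
        have := (this.tendsto 0).mono_left (nhdsWithin_le_nhds (s := {0}ᶜ))
        simpa using this
      exact (((FF_continuousAt h v).tendsto.comp h0).add_const _).div_const _
    rw [add_self_div_two] at hF
    refine le_of_tendsto_of_tendsto ht hF ?_
    filter_upwards [self_mem_nhdsWithin] with t ht
    have ht : t ≠ 0 := ht
    have := kernel_diff h K hK hb hd (v + t • EuclideanSpace.single m 1) v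
    rw [smul_eq_mul, abs_mul, abs_inv, inv_mul_le_iff₀ (by positivity)]
    simpa [norm_smul] using this
  · rw [fderiv_zero_of_not_differentiableAt hdiff]
    simpa using FF_nonneg h v

lemma inv_norm_diff (x y : (EuclideanSpace ℝ (Fin 3))) (hx : x ≠ 0) (hy : y ≠ 0) :
    |1 / ‖x‖ - 1 / ‖y‖| ≤ ‖x - y‖ / (‖x‖ * ‖y‖) := by
  have hx' := norm_pos_iff.2 hx
  have hy' := norm_pos_iff.2 hy
  have : 1 / ‖x‖ - 1 / ‖y‖ = (‖y‖ - ‖x‖) / (‖x‖ * ‖y‖) := by field_simp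
  rw [this, abs_div, abs_of_pos (mul_pos hx' hy')]
  gcongr
  rw [norm_sub_rev]
  exact abs_norm_sub_norm_le y x

lemma coord_le (x : (EuclideanSpace ℝ (Fin 3))) (i : Fin 3) : |x i| ≤ ‖x‖ := by
  simpa using PiLp.norm_apply_le x i

lemma unit_diff (x y : (EuclideanSpace ℝ (Fin 3))) (hx : x ≠ 0) (hy : y ≠ 0) (i : Fin 3) :
    |x i / ‖x‖ - y i / ‖y‖| ≤ 2 * (‖x - y‖ / ‖x‖) := by
  have hx' := norm_pos_iff.2 hx
  have hy' := norm_pos_iff.2 hy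
  have e : x i / ‖x‖ - y i / ‖y‖ = (x - y) i / ‖x‖ + y i * (1 / ‖x‖ - 1 / ‖y‖) := by
    simp only [PiLp.sub_apply]; ring
  rw [e]
  refine (abs_add_le _ _).trans ?_
  rw [abs_div, abs_mul, abs_of_pos hx']
  have h1 : |(x - y) i| / ‖x‖ ≤ ‖x - y‖ / ‖x‖ := by gcongr; exact coord_le _ _
  have h2 : |y i| * |1 / ‖x‖ - 1 / ‖y‖| ≤ ‖y‖ * (‖x - y‖ / (‖x‖ * ‖y‖)) := by
    gcongr
    · exact coord_le _ _
    · exact inv_norm_diff x y hx hy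
  have h3 : ‖y‖ * (‖x - y‖ / (‖x‖ * ‖y‖)) = ‖x - y‖ / ‖x‖ := by field_simp
  linarith

lemma unit_le (x : (EuclideanSpace ℝ (Fin 3))) (i : Fin 3) : |x i / ‖x‖| ≤ 1 := by
  rw [abs_div, abs_norm]
  exact div_le_one_of_le₀ (coord_le x i) (norm_nonneg _)

lemma Pker_eq (x : (EuclideanSpace ℝ (Fin 3))) (i j : Fin 3) :
    Pker x i j / ‖x‖ = (if i = j then (1 : ℝ) else 0) * (1 / ‖x‖) -
      (x i / ‖x‖) * (x j / ‖x‖) * (1 / ‖x‖) := by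
  unfold Pker; ring

lemma Pker_le (x : (EuclideanSpace ℝ (Fin 3))) (i j : Fin 3) : |Pker x i j / ‖x‖| ≤ 2 * (1 / ‖x‖) := by
  rw [Pker_eq, ← sub_mul, abs_mul, abs_of_nonneg (by positivity : 0 ≤ 1 / ‖x‖)]
  gcongr
  refine (abs_sub _ _).trans ?_
  rw [abs_mul]
  have h1 : |(if i = j then (1 : ℝ) else 0)| ≤ 1 := by split_ifs <;> simp
  have := mul_le_one₀ (unit_le x i) (abs_nonneg _) (unit_le x j)
  linarith

lemma Pker_diff (x y : (EuclideanSpace ℝ (Fin 3))) (hx : x ≠ 0) (hy : y ≠ 0) (i j : Fin 3) :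
    |Pker x i j / ‖x‖ - Pker y i j / ‖y‖| ≤ 6 * (‖x - y‖ / (‖x‖ * ‖y‖)) := by
  have hx' := norm_pos_iff.2 hx
  have hy' := norm_pos_iff.2 hy
  set Q := ‖x - y‖ / (‖x‖ * ‖y‖) with hQ
  have e : Pker x i j / ‖x‖ - Pker y i j / ‖y‖ =
      ((if i = j then (1 : ℝ) else 0) - (x i / ‖x‖) * (x j / ‖x‖)) * (1 / ‖x‖ - 1 / ‖y‖)
      - (((x i / ‖x‖) - (y i / ‖y‖)) * (x j / ‖x‖) * (1 / ‖y‖) +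
        (y i / ‖y‖) * ((x j / ‖x‖) - (y j / ‖y‖)) * (1 / ‖y‖)) := by
    rw [Pker_eq, Pker_eq]; ring
  have h0 := inv_norm_diff x y hx hy
  have hu : ∀ l, |x l / ‖x‖ - y l / ‖y‖| * (1 / ‖y‖) ≤ 2 * Q := fun l => by
    calc _ ≤ 2 * (‖x - y‖ / ‖x‖) * (1 / ‖y‖) := by
          gcongr; exact unit_diff x y hx hy l
      _ = 2 * Q := by rw [hQ]; field_simp
  have h1 : |((if i = j then (1 : ℝ) else 0) - (x i / ‖x‖) * (x j / ‖x‖)) *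
      (1 / ‖x‖ - 1 / ‖y‖)| ≤ 2 * Q := by
    rw [abs_mul]
    refine mul_le_mul ?_ h0 (abs_nonneg _) (by norm_num)
    refine (abs_sub _ _).trans ?_
    rw [abs_mul]
    have h1 : |(if i = j then (1 : ℝ) else 0)| ≤ 1 := by split_ifs <;> simp
    have := mul_le_one₀ (unit_le x i) (abs_nonneg _) (unit_le x j)
    linarith
  have hyy : 0 ≤ 1 / ‖y‖ := by positivity
  have h2 : |((x i / ‖x‖) - (y i / ‖y‖)) * (x j / ‖x‖) * (1 / ‖y‖)| ≤ 2 * Q := by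
    rw [abs_mul, abs_mul, abs_of_nonneg hyy, mul_right_comm]
    exact (mul_le_of_le_one_right (by positivity) (unit_le x j)).trans (hu i)
  have h3 : |(y i / ‖y‖) * ((x j / ‖x‖) - (y j / ‖y‖)) * (1 / ‖y‖)| ≤ 2 * Q := by
    rw [abs_mul, abs_mul, abs_of_nonneg hyy, mul_assoc]
    exact (mul_le_of_le_one_left (by positivity) (unit_le y i)).trans (hu j)
  rw [e]
  refine (abs_sub _ _).trans ?_
  have := abs_add_le (((x i / ‖x‖) - (y i / ‖y‖)) * (x j / ‖x‖) * (1 / ‖y‖))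
    ((y i / ‖y‖) * ((x j / ‖x‖) - (y j / ‖y‖)) * (1 / ‖y‖))
  linarith

lemma pd_A (h : SchwartzMap (EuclideanSpace ℝ (Fin 3)) ℝ) (v : (EuclideanSpace ℝ (Fin 3))) (m i j : Fin 3) :
    |pd m (fun u => LandauA (⇑h) u i j) v| ≤ FF h v := by
  have hpi := Real.pi_gt_three
  have hc0 : 0 ≤ 1 / (8 * Real.pi) := by positivity
  have hc : 1 / (8 * Real.pi) ≤ 1 / 6 := by
    apply one_div_le_one_div_of_le <;> linarith
  have e : (fun u => LandauA (⇑h) u i j) =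
      fun u => ∫ z, (fun w => 1 / (8 * Real.pi) * (Pker w i j / ‖w‖)) (u - z) * h z := by
    funext u
    simp only [LandauA, mul_assoc]
    rw [integral_const_mul]
  rw [e]
  refine pd_bound h (fun w => 1 / (8 * Real.pi) * (Pker w i j / ‖w‖)) ?_ ?_ ?_ v m
  · unfold Pker
    have hm : ∀ l : Fin 3, Measurable (fun w : (EuclideanSpace ℝ (Fin 3)) => w l) := fun l => by
      have : Continuous (fun w : (EuclideanSpace ℝ (Fin 3)) => w l) := by fun_prop
      exact this.measurable
    have := hm i
    have := hm j
    fun_prop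
  · intro w
    rw [abs_mul, abs_of_nonneg hc0]
    have h1 := Pker_le w i j
    have h2 : 0 ≤ 1 / ‖w‖ := by positivity
    calc _ ≤ 1 / 6 * (2 * (1 / ‖w‖)) := by gcongr
      _ ≤ _ := by linarith
  · intro x y hx hy
    rw [← mul_sub, abs_mul, abs_of_nonneg hc0]
    have h1 := Pker_diff x y hx hy i j
    calc _ ≤ 1 / 6 * (6 * (‖x - y‖ / (‖x‖ * ‖y‖))) := by gcongr
      _ = _ := by ring

lemma pd_a (h : SchwartzMap (EuclideanSpace ℝ (Fin 3)) ℝ) (v : (EuclideanSpace ℝ (Fin 3))) (m : Fin 3) :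
    |pd m (landaua ⇑h) v| ≤ FF h v := by
  have hpi := Real.pi_gt_three
  have hc0 : 0 ≤ 1 / (4 * Real.pi) := by positivity
  have hc : 1 / (4 * Real.pi) ≤ 1 := by
    rw [div_le_one (by positivity)]; linarith
  have e : landaua ⇑h =
      fun u => ∫ z, (fun w => 1 / (4 * Real.pi) * (1 / ‖w‖)) (u - z) * h z := by
    funext u
    simp only [landaua, mul_assoc]
    rw [integral_const_mul]
    congr 2
    funext z
    ring
  rw [e]
  refine pd_bound h (fun w => 1 / (4 * Real.pi) * (1 / ‖w‖)) ?_ ?_ ?_ v m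
  · fun_prop
  · intro w
    rw [abs_mul, abs_of_nonneg hc0, abs_of_nonneg (by positivity : 0 ≤ 1 / ‖w‖)]
    exact mul_le_of_le_one_left (by positivity) hc
  · intro x y hx hy
    rw [← mul_sub, abs_mul, abs_of_nonneg hc0]
    exact (mul_le_of_le_one_left (by positivity) hc).trans (inv_norm_diff x y hx hy)

lemma jap_pos (v : (EuclideanSpace ℝ (Fin 3))) : 0 < jap v := Real.sqrt_pos.2 (by positivity)

lemma jap_sq (v : (EuclideanSpace ℝ (Fin 3))) : jap v ^ 2 = 1 + ‖v‖ ^ 2 := Real.sq_sqrt (by positivity)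

lemma jap_lip (v w : (EuclideanSpace ℝ (Fin 3))) : jap v ≤ jap w + ‖v - w‖ := by
  have hw : ‖w‖ ≤ jap w := Real.le_sqrt_of_sq_le (by linarith)
  have h1 : ‖v‖ ≤ ‖w‖ + ‖v - w‖ := by
    rw [norm_sub_rev]
    have := norm_le_norm_add_norm_sub w v
    linarith
  refine le_of_sq_le_sq ?_ (add_nonneg (jap_pos w).le (norm_nonneg _))
  have := jap_sq w
  have h2 := norm_nonneg (v - w)
  have h3 := norm_nonneg v
  rw [jap_sq]
  nlinarith [mul_le_mul_of_nonneg_right hw h2, mul_self_le_mul_self h3 h1]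

lemma rpow_cmp {a b p : ℝ} (ha : 0 < a) (hb : 0 < b) (h1 : a ≤ 2 * b) (h2 : b ≤ 2 * a) :
    a ^ p ≤ 2 ^ |p| * b ^ p := by
  rcases le_total 0 p with hp | hp
  · rw [abs_of_nonneg hp, ← Real.mul_rpow (by norm_num) hb.le]
    exact Real.rpow_le_rpow ha.le h1 hp
  · rw [abs_of_nonpos hp]
    have e : b ^ p = (2 : ℝ) ^ p * (b / 2) ^ p := by
      rw [← Real.mul_rpow (by norm_num) (by positivity)]; congr 1; ring
    rw [e, ← mul_assoc, ← Real.rpow_add (by norm_num), neg_add_cancel, Real.rpow_zero, one_mul]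
    exact Real.rpow_le_rpow_of_nonpos (by positivity) (by linarith) hp

lemma jap_cont : Continuous jap := by unfold jap; fun_prop

lemma near_cmp (v z : (EuclideanSpace ℝ (Fin 3))) (hz : ‖v - z‖ ≤ jap v / 2) : jap v ≤ 2 * jap z ∧ jap z ≤ 2 * jap v := by
  have h1 := jap_lip v z
  have h2 := jap_lip z v
  rw [norm_sub_rev] at h2
  have := jap_pos v
  constructor <;> linarith

lemma near_integrable (h : SchwartzMap (EuclideanSpace ℝ (Fin 3)) ℝ) (v : (EuclideanSpace ℝ (Fin 3))) (p : ℝ) :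
    IntegrableOn (fun z => jap z ^ p * |h z| / ‖v - z‖ ^ 2)
      {z : (EuclideanSpace ℝ (Fin 3)) | ‖v - z‖ ≤ jap v / 2} := by
  have hS : MeasurableSet {z : (EuclideanSpace ℝ (Fin 3)) | ‖v - z‖ ≤ jap v / 2} :=
    measurableSet_le (by fun_prop) (by fun_prop)
  have hc : Continuous h := h.continuous
  refine Integrable.mono' (((FF_integrable h v).const_mul (2 ^ |p| * jap v ^ p)).integrableOn) ?_ ?_
  · have h1 : Measurable jap := jap_cont.measurable
    have h2 : Measurable (fun z => |h z|) := hc.abs.measurable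
    exact (((h1.pow_const p).mul h2).div (by fun_prop)).aestronglyMeasurable
  · rw [ae_restrict_iff' hS]
    refine Filter.Eventually.of_forall fun z hz => ?_
    obtain ⟨h1, h2⟩ := near_cmp v z hz
    have hj := jap_pos z
    rw [Real.norm_of_nonneg (by positivity), mul_div_assoc]
    gcongr
    exact rpow_cmp hj (jap_pos v) h2 h1

lemma FF_split (h : SchwartzMap (EuclideanSpace ℝ (Fin 3)) ℝ) (v : (EuclideanSpace ℝ (Fin 3))) (k : ℝ) :
    jap v ^ 2 * FF h v ≤ 2 ^ |3 + k| * jap v ^ (-1 - k) *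
      (∫ z in {z : (EuclideanSpace ℝ (Fin 3)) | ‖v - z‖ ≤ jap v / 2}, jap z ^ (3 + k) * |h z| / ‖v - z‖ ^ 2) +
      4 * ∫ z, |h z| := by
  have hv := jap_pos v
  have hS : MeasurableSet {z : (EuclideanSpace ℝ (Fin 3)) | ‖v - z‖ ≤ jap v / 2} :=
    measurableSet_le (by fun_prop) (by fun_prop)
  have hi : Integrable (fun z => |h z|) volume := h.integrable.abs
  rw [FF, ← integral_add_compl hS (FF_integrable h v), mul_add, ← integral_const_mul,
    ← integral_const_mul, ← integral_const_mul, ← integral_const_mul]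
  apply add_le_add
  · refine setIntegral_mono_on ((FF_integrable h v).const_mul _).integrableOn
      ((near_integrable h v (3 + k)).const_mul _) hS fun z hz => ?_
    obtain ⟨h1, h2⟩ := near_cmp v z hz
    have hz0 := jap_pos z
    have e : jap v ^ 2 = jap v ^ (-1 - k) * jap v ^ (3 + k) := by
      rw [← Real.rpow_add hv, ← Real.rpow_natCast]; congr 1; push_cast; ring
    have hc := rpow_cmp (p := 3 + k) hv hz0 h1 h2
    calc jap v ^ 2 * (|h z| / ‖v - z‖ ^ 2)
        = jap v ^ (-1 - k) * jap v ^ (3 + k) * (|h z| / ‖v - z‖ ^ 2) := by rw [e]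
      _ ≤ jap v ^ (-1 - k) * (2 ^ |3 + k| * jap z ^ (3 + k)) * (|h z| / ‖v - z‖ ^ 2) := by gcongr
      _ = _ := by ring
  · refine (setIntegral_mono_on ((FF_integrable h v).const_mul _).integrableOn
      (hi.const_mul 4).integrableOn hS.compl fun z hz => ?_).trans
      (setIntegral_le_integral (hi.const_mul 4) (Filter.Eventually.of_forall fun z => by
        simp only [Pi.zero_apply]; positivity))
    have hz : jap v / 2 < ‖v - z‖ := by simpa using hz
    have h0 : 0 < ‖v - z‖ := by linarith
    rw [← mul_div_assoc, div_le_iff₀ (by positivity), mul_right_comm]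
    gcongr
    nlinarith

/-- Lemma 2.2(B)(a): pointwise bound on the gradients of the Landau coefficients,
`⟨v⟩²(|∇A[h](v)| + |∇a[h](v)|) ≤ C_k ⟨v⟩^{−1−k} ∫_{|v−v₁|≤⟨v⟩/2} ⟨v₁⟩^{3+k}|h(v₁)|/|v−v₁|² dv₁
  + C ‖h‖_{L¹}`, with `C` independent of `k`. -/
theorem landau_gradient_pointwise_bound :
    ∃ C > 0, ∀ k : ℝ, ∃ Ck > 0, ∀ h : SchwartzMap (EuclideanSpace ℝ (Fin 3)) ℝ,
      ∀ v : EuclideanSpace ℝ (Fin 3),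
      jap v ^ 2 *
          ((∑ m, ∑ i, ∑ j, |pd m (fun u => LandauA (⇑h) u i j) v|) +
            ∑ m, |pd m (landaua ⇑h) v|)
        ≤ Ck * jap v ^ (-1 - k) *
            (∫ v₁ in {v₁ : EuclideanSpace ℝ (Fin 3) | ‖v - v₁‖ ≤ jap v / 2},
              jap v₁ ^ (3 + k) * |h v₁| / ‖v - v₁‖ ^ 2) +
          C * ∫ v₁, |h v₁| := by
  refine ⟨120, by norm_num, fun k => ⟨30 * 2 ^ |3 + k|, by positivity, fun h v => ?_⟩⟩
  have h1 : (∑ m, ∑ i, ∑ j, |pd m (fun u => LandauA (⇑h) u i j) v|) ≤ 27 * FF h v := by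
    calc _ ≤ ∑ m : Fin 3, ∑ i : Fin 3, ∑ j : Fin 3, FF h v :=
          Finset.sum_le_sum fun m _ => Finset.sum_le_sum fun i _ => Finset.sum_le_sum fun j _ =>
            pd_A h v m i j
      _ = _ := by simp; ring
  have h2 : ∑ m, |pd m (landaua ⇑h) v| ≤ 3 * FF h v := by
    calc _ ≤ ∑ m : Fin 3, FF h v := Finset.sum_le_sum fun m _ => pd_a h v m
      _ = _ := by simp
  have h3 := FF_split h v k
  have h4 := mul_le_mul_of_nonneg_left (add_le_add h1 h2) (sq_nonneg (jap v))
  refine h4.trans ?_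
  rw [show 27 * FF h v + 3 * FF h v = 30 * FF h v by ring]
  linarith
end
end
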